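/- Belk–Bleak–Matucci–Zaremsky: Every hyperbolic group embeds in a finitely presented simple group; that is, if G is a hyperbolic group then there exist a finitely presented simple group Q and an injective group homomorphism from G into Q. -/

import Mathlib

/-- The word length of `g` with respect to a generating set `S`: the least `k` such
that `g` is a product of `k` elements of `S ∪ S⁻¹`. -/
noncomputable def wordNorm {G : Type*} [Group G] (S : Set G) (g : G) : ℕ :=
  sInf {k | ∃ l : List G, l.length = k ∧ (∀ x ∈ l, x ∈ S ∨ x⁻¹ ∈ S) ∧ l.prod = g}

/-- The word metric on `G` with respect to `S`. -/
noncomputable def wordDist {G : Type*} [Group G] (S : Set G) (g h : G) : ℕ :=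
  wordNorm S (g⁻¹ * h)

/-- The Gromov product `(x|y)_w = ½(d(x,w) + d(y,w) − d(x,y))` with respect to the
word metric for `S`. -/
noncomputable def gromovProd {G : Type*} [Group G] (S : Set G) (w x y : G) : ℝ :=
  ((wordDist S x w : ℝ) + (wordDist S y w : ℝ) - (wordDist S x y : ℝ)) / 2

/-- A group is hyperbolic if it has a finite generating set `S` and a `δ ≥ 0` such
that `(x|y)_w ≥ min((x|z)_w, (z|y)_w) − δ` for all `w, x, y, z`. -/
def IsHyperbolic (G : Type*) [Group G] : Prop :=
  ∃ S : Finset G, Subgroup.closure (S : Set G) = ⊤ ∧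
    ∃ δ : ℝ, 0 ≤ δ ∧ ∀ w x y z : G,
      min (gromovProd (S : Set G) w x z) (gromovProd (S : Set G) w z y) - δ ≤
        gromovProd (S : Set G) w x y

/-- A group is finitely presented if it is isomorphic to the quotient of a finitely
generated free group by the normal closure of a finite set of relators. -/
def IsFinitelyPresented (H : Type*) [Group H] : Prop :=
  ∃ (n : ℕ) (R : Finset (FreeGroup (Fin n))),
    Nonempty (H ≃* FreeGroup (Fin n) ⧸ Subgroup.normalClosure (R : Set (FreeGroup (Fin n))))

namespace HE

universe u v

/-- Criterion for finite presentability. -/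
theorem fp_of_partialHom {G : Type u} [Group G] (S : Set G) (hS : S.Finite)
    (hgen : Subgroup.closure S = ⊤)
    (hext : ∀ (H : Type u) [Group H] (f : G → H),
      (∀ a ∈ S, ∀ b ∈ S, a * b ∈ S → f (a * b) = f a * f b) →
      ∃ F : G →* H, ∀ a ∈ S, F a = f a) : Group.IsFinitelyPresented G := by
  classical
  haveI : Finite S := hS
  let rel : S × S → FreeGroup S := fun p =>
    if h : (p.1 : G) * p.2 ∈ S then
      FreeGroup.of p.1 * FreeGroup.of p.2 * (FreeGroup.of ⟨_, h⟩)⁻¹ else 1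
  let R : Set (FreeGroup S) := Set.range rel
  haveI : Finite R := Set.finite_range rel
  let f : G → PresentedGroup R := fun g => if h : g ∈ S then PresentedGroup.of ⟨g, h⟩ else 1
  have hf : ∀ a ∈ S, ∀ b ∈ S, a * b ∈ S → f (a * b) = f a * f b := by
    intro a ha b hb hab
    have h1 : (PresentedGroup.mk R) (rel (⟨a, ha⟩, ⟨b, hb⟩)) = 1 := by
      apply PresentedGroup.one_of_mem
      exact ⟨_, rfl⟩
    simp only [rel, dif_pos hab, map_mul, map_inv] at h1
    simp only [f, dif_pos ha, dif_pos hb, dif_pos hab]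
    exact (mul_inv_eq_one.1 h1).symm
  obtain ⟨F, hF⟩ := hext _ f hf
  have hrel : ∀ r ∈ R, FreeGroup.lift (fun s : S => (s : G)) r = 1 := by
    rintro _ ⟨⟨a, b⟩, rfl⟩
    simp only [rel]
    split_ifs with h <;> simp
  let ψ : PresentedGroup R →* G := PresentedGroup.toGroup hrel
  have hψ : ∀ s : S, ψ (PresentedGroup.of s) = s := fun s => PresentedGroup.toGroup.of hrel
  have h1 : F.comp ψ = MonoidHom.id _ := by
    apply PresentedGroup.ext
    intro s
    simp only [MonoidHom.comp_apply, hψ, MonoidHom.id_apply]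
    rw [hF _ s.2]; simp [f]
  have h2 : ψ.comp F = MonoidHom.id _ := by
    apply MonoidHom.eq_of_eqOn_dense hgen
    intro s hs
    simp only [MonoidHom.comp_apply, hF s hs, MonoidHom.id_apply]
    simp only [f, dif_pos hs, hψ]
  exact Group.IsFinitelyPresented.equiv (MonoidHom.toMulEquiv ψ F h1 h2)

/-- Finite free powers of finitely presented groups. -/
theorem fp_coprodI (V : Type u) [Group V] [Group.IsFinitelyPresented V] (n : ℕ) :
    Group.IsFinitelyPresented (Monoid.CoprodI (fun _ : Fin n => V)) := by
  induction n with
  | zero =>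
    haveI : Subsingleton (Monoid.CoprodI (fun _ : Fin 0 => V)) := by
      have : (MonoidHom.id (Monoid.CoprodI (fun _ : Fin 0 => V))) = 1 := by
        ext i; exact i.elim0
      constructor
      intro a b
      rw [← MonoidHom.id_apply _ a, ← MonoidHom.id_apply _ b, this]; rfl
    infer_instance
  | succ n ih =>
    let A : Monoid.Coprod V (Monoid.CoprodI (fun _ : Fin n => V)) →*
        Monoid.CoprodI (fun _ : Fin (n+1) => V) :=
      Monoid.Coprod.lift (Monoid.CoprodI.of (M := fun _ : Fin (n+1) => V) (i := 0))
        (Monoid.CoprodI.lift fun i : Fin n =>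
          Monoid.CoprodI.of (M := fun _ : Fin (n+1) => V) (i := i.succ))
    let B : Monoid.CoprodI (fun _ : Fin (n+1) => V) →*
        Monoid.Coprod V (Monoid.CoprodI (fun _ : Fin n => V)) :=
      Monoid.CoprodI.lift (fun i : Fin (n+1) => Fin.cases
        (motive := fun _ => V →* Monoid.Coprod V (Monoid.CoprodI (fun _ : Fin n => V)))
        Monoid.Coprod.inl
        (fun j => Monoid.Coprod.inr.comp (Monoid.CoprodI.of (M := fun _ : Fin n => V) (i := j))) i)
    refine Group.IsFinitelyPresented.equiv (MonoidHom.toMulEquiv A B ?_ ?_)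
    · apply Monoid.Coprod.hom_ext
      · ext v; simp [A, B]
      · ext i v; simp [A, B]
    · ext i v
      refine Fin.cases ?_ (fun j => ?_) i <;> simp [A, B]

end HE

namespace HE

universe u

/-- A length function turning a group into a hyperbolic geodesic metric space. -/
structure HypLen (G : Type u) [Group G] where
  ℓ : G → ℕ
  one : ℓ 1 = 0
  eq_one : ∀ g, ℓ g = 0 → g = 1
  inv : ∀ g, ℓ g⁻¹ = ℓ g
  mul_le : ∀ g h, ℓ (g * h) ≤ ℓ g + ℓ h
  fin : ∀ n, {g | ℓ g ≤ n}.Finite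
  geod : ∀ g k, k ≤ ℓ g → ∃ h, ℓ h = k ∧ k + ℓ (h⁻¹ * g) = ℓ g
  N : ℕ
  hyp : ∀ x y z w, ℓ (x⁻¹ * y) + ℓ (z⁻¹ * w) ≤
    max (ℓ (x⁻¹ * z) + ℓ (y⁻¹ * w)) (ℓ (y⁻¹ * z) + ℓ (x⁻¹ * w)) + N

/-- Finite groups. -/
noncomputable def HypLen.ofFinite (G : Type u) [Group G] [Finite G] : HypLen G := by
  classical
  refine ⟨fun g => if g = 1 then 0 else 1, by simp, ?_, ?_, ?_, ?_, ?_, 2, ?_⟩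
  · intro g h; by_contra h'; simp [h'] at h
  · intro g; simp
  · intro g h
    by_cases h1 : g = 1 <;> by_cases h2 : h = 1 <;> simp [h1, h2]
    split_ifs <;> omega
  · intro n; exact Set.toFinite _
  · intro g k hk
    by_cases h1 : g = 1
    · refine ⟨1, ?_⟩
      simp [h1] at hk ⊢; omega
    · simp [h1] at hk ⊢
      rcases Nat.eq_zero_or_pos k with rfl | hk'
      · exact ⟨1, by simp [h1]⟩
      · exact ⟨g, by simp [h1]; omega⟩
  · intro x y z w
    split_ifs <;> omega

section word
variable {G : Type u} [Group G] (S : Finset G)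

theorem word_exists (hS : Subgroup.closure (S : Set G) = ⊤) (g : G) :
    ∃ l : List G, (∀ x ∈ l, x ∈ (S : Set G) ∨ x⁻¹ ∈ (S : Set G)) ∧ l.prod = g := by
  have : g ∈ Subgroup.closure (S : Set G) := by rw [hS]; trivial
  rw [← Subgroup.mem_toSubmonoid, Subgroup.closure_toSubmonoid] at this
  exact Submonoid.exists_list_of_mem_closure this

theorem wordNorm_spec (hS : Subgroup.closure (S : Set G) = ⊤) (g : G) :
    ∃ l : List G, l.length = wordNorm (S : Set G) g ∧
      (∀ x ∈ l, x ∈ (S : Set G) ∨ x⁻¹ ∈ (S : Set G)) ∧ l.prod = g := by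
  have h : {k | ∃ l : List G, l.length = k ∧
      (∀ x ∈ l, x ∈ (S : Set G) ∨ x⁻¹ ∈ (S : Set G)) ∧ l.prod = g}.Nonempty := by
    obtain ⟨l, h1, h2⟩ := word_exists S hS g
    exact ⟨_, l, rfl, h1, h2⟩
  exact Nat.sInf_mem h

theorem wordNorm_le (l : List G) (h : ∀ x ∈ l, x ∈ (S : Set G) ∨ x⁻¹ ∈ (S : Set G)) :
    wordNorm (S : Set G) l.prod ≤ l.length :=
  Nat.sInf_le ⟨l, rfl, h, rfl⟩

theorem wordNorm_mul_le (hS : Subgroup.closure (S : Set G) = ⊤) (g h : G) :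
    wordNorm (S : Set G) (g * h) ≤ wordNorm (S : Set G) g + wordNorm (S : Set G) h := by
  obtain ⟨l, h1, h2, h3⟩ := wordNorm_spec S hS g
  obtain ⟨m, k1, k2, k3⟩ := wordNorm_spec S hS h
  rw [← h1, ← k1, ← List.length_append, ← h3, ← k3, ← List.prod_append]
  apply wordNorm_le
  intro x hx
  rcases List.mem_append.1 hx with hx | hx
  · exact h2 x hx
  · exact k2 x hx

theorem wordNorm_inv_le (hS : Subgroup.closure (S : Set G) = ⊤) (g : G) :
    wordNorm (S : Set G) g⁻¹ ≤ wordNorm (S : Set G) g := by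
  obtain ⟨l, h1, h2, h3⟩ := wordNorm_spec S hS g
  rw [← h1, ← h3, List.prod_inv_reverse]
  refine (wordNorm_le S _ ?_).trans (by simp)
  intro x hx
  simp only [List.mem_reverse, List.mem_map] at hx
  obtain ⟨y, hy, rfl⟩ := hx
  rw [inv_inv]; exact (h2 y hy).symm

theorem wordNorm_fin (hS : Subgroup.closure (S : Set G) = ⊤) (n : ℕ) :
    {g | wordNorm (S : Set G) g ≤ n}.Finite := by
  classical
  have hT : ((S : Set G) ∪ (S : Set G)⁻¹).Finite := S.finite_toSet.union S.finite_toSet.inv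
  haveI := hT.to_subtype
  have h1 : {l : List ((S : Set G) ∪ (S : Set G)⁻¹ : Set G) | l.length ≤ n}.Finite :=
    List.finite_length_le _ n
  refine (h1.image (fun l => (l.map Subtype.val).prod)).subset ?_
  intro g hg
  obtain ⟨l, h1, h2, h3⟩ := wordNorm_spec S hS g
  refine ⟨l.attach.map fun x => ⟨x.1, h2 x.1 x.2⟩, ?_, ?_⟩
  · simp [h1]; exact hg
  · simp only [List.map_map]
    rw [← h3]
    congr 1
    exact List.attach_map_subtype_val l

theorem wordNorm_one : wordNorm (S : Set G) 1 = 0 := by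
  have := wordNorm_le S (G := G) [] (by simp)
  simpa using this

theorem hypLen_of_isHyperbolic (hG : IsHyperbolic G) : Nonempty (HypLen G) := by
  obtain ⟨S, hS, δ, hδ, H⟩ := hG
  refine ⟨⟨wordNorm (S : Set G), wordNorm_one S, ?_, ?_, wordNorm_mul_le S hS, wordNorm_fin S hS,
    ?_, ⌈2 * δ⌉₊, ?_⟩⟩
  · intro g hg
    obtain ⟨l, h1, h2, h3⟩ := wordNorm_spec S hS g
    rw [hg, List.length_eq_zero_iff] at h1
    rw [← h3, h1]; rfl
  · intro g
    apply le_antisymm (wordNorm_inv_le S hS g)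
    simpa using wordNorm_inv_le S hS g⁻¹
  · intro g k hk
    obtain ⟨l, h1, h2, h3⟩ := wordNorm_spec S hS g
    have e : (l.take k).prod * (l.drop k).prod = g := by
      rw [← List.prod_append, List.take_append_drop, h3]
    have e1 := wordNorm_le S (l.take k) (fun x hx => h2 x (List.mem_of_mem_take hx))
    have e2 := wordNorm_le S (l.drop k) (fun x hx => h2 x (List.mem_of_mem_drop hx))
    have e3 := wordNorm_mul_le S hS (l.take k).prod (l.drop k).prod
    simp only [List.length_take, List.length_drop, e] at e1 e2 e3
    refine ⟨(l.take k).prod, by omega, ?_⟩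
    have : (l.take k).prod⁻¹ * g = (l.drop k).prod := by rw [← e]; group
    rw [this]; omega
  · intro x y z w
    have h := H w x y z
    have hc := Nat.le_ceil (2 * δ)
    have sym : ∀ a b : G, wordDist (S : Set G) a b = wordDist (S : Set G) b a := by
      intro a b
      have : ∀ a b : G, wordDist (S : Set G) a b ≤ wordDist (S : Set G) b a := by
        intro a b
        unfold wordDist
        have := wordNorm_inv_le S hS (b⁻¹ * a)
        simpa using this
      exact le_antisymm (this _ _) (this _ _)
    have key : (wordDist (S : Set G) x y : ℝ) + wordDist (S : Set G) z w ≤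
        max ((wordDist (S : Set G) x z : ℝ) + wordDist (S : Set G) y w)
          (wordDist (S : Set G) y z + wordDist (S : Set G) x w) + ⌈2 * δ⌉₊ := by
      unfold gromovProd at h
      rw [sym z y] at h
      rcases le_total (((wordDist (S : Set G) x w : ℝ) + (wordDist S z w : ℝ) - (wordDist S x z : ℝ)) / 2)
        (((wordDist (S : Set G) z w : ℝ) + (wordDist S y w : ℝ) - (wordDist S y z : ℝ)) / 2) with h' | h'
      · rw [min_eq_left h'] at h
        have := le_max_left ((wordDist (S : Set G) x z : ℝ) + wordDist (S : Set G) y w)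
          (wordDist (S : Set G) y z + wordDist (S : Set G) x w)
        linarith
      · rw [min_eq_right h'] at h
        have := le_max_right ((wordDist (S : Set G) x z : ℝ) + wordDist (S : Set G) y w)
          (wordDist (S : Set G) y z + wordDist (S : Set G) x w)
        linarith
    exact_mod_cast key

end word

namespace HypLen
variable {G : Type u} [Group G] (L : HypLen G)

/-- The distance. -/
def d (x y : G) : ℕ := L.ℓ (x⁻¹ * y)

theorem d_comm (x y : G) : L.d x y = L.d y x := by
  unfold d; rw [← L.inv]; simp
theorem d_tri (x y z : G) : L.d x z ≤ L.d x y + L.d y z := by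
  unfold d; have := L.mul_le (x⁻¹ * y) (y⁻¹ * z); simpa [mul_assoc] using this
theorem d_self (x : G) : L.d x x = 0 := by simp [d, L.one]
theorem d_one (x : G) : L.d 1 x = L.ℓ x := by simp [d]
theorem d_mul (g x y : G) : L.d (g * x) (g * y) = L.d x y := by simp [d, mul_assoc]
theorem eq_of_d (x y : G) (h : L.d x y = 0) : x = y := by
  have := L.eq_one _ h; exact (inv_mul_eq_one.1 this)
theorem d_geod (x y : G) (k : ℕ) (hk : k ≤ L.d x y) : ∃ z, L.d x z = k ∧ k + L.d z y = L.d x y := by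
  obtain ⟨h, h1, h2⟩ := L.geod _ k hk
  refine ⟨x * h, by simpa [d] using h1, ?_⟩
  simpa [d, mul_assoc] using h2
theorem d_hyp (x y z w : G) : L.d x y + L.d z w ≤
    max (L.d x z + L.d y w) (L.d y z + L.d x w) + L.N := L.hyp x y z w

/-- Finite presentability of hyperbolic groups. -/
theorem fp {G : Type u} [Group G] (L : HypLen G) : Group.IsFinitelyPresented G := by
  classical
  let M := L.N + 1
  let n := 2 * M
  have hpred : ∀ g : G, ∃ h, L.ℓ h = L.ℓ g - M ∧ L.d h g = min M (L.ℓ g) := by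
    intro g
    obtain ⟨h, h1, h2⟩ := L.geod g (L.ℓ g - M) (Nat.sub_le _ _)
    exact ⟨h, h1, by unfold d; omega⟩
  choose pred hp1 hp2 using hpred
  have gen : ∀ (P : G → Prop), P 1 → (∀ g s, P g → L.ℓ s ≤ n → P (g * s)) → ∀ g, P g := by
    intro P h1 hs g
    induction hk : L.ℓ g using Nat.strong_induction_on generalizing g with
    | _ k ih =>
      by_cases h0 : L.ℓ g = 0
      · rw [L.eq_one _ h0]; exact h1
      · have := ih _ (by rw [hp1]; omega) (pred g) rfl
        have := hs _ ((pred g)⁻¹ * g) this (by have := hp2 g; unfold d at this; omega)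
        simpa using this
  apply fp_of_partialHom {g | L.ℓ g ≤ n} (L.fin n)
  · rw [eq_top_iff]
    intro g _
    refine gen (fun g => g ∈ Subgroup.closure {g | L.ℓ g ≤ n}) (one_mem _) ?_ g
    intro g s hg hs
    exact mul_mem hg (Subgroup.subset_closure hs)
  intro H _ f hf
  have f1 : f 1 = 1 := by
    have := hf 1 (by simp [L.one]) 1 (by simp [L.one]) (by simp [L.one])
    simpa using this
  have hf' : ∀ x y z, L.d x y ≤ n → L.d y z ≤ n → L.d x z ≤ n →
      f (x⁻¹ * z) = f (x⁻¹ * y) * f (y⁻¹ * z) := by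
    intro x y z h1 h2 h3
    have := hf _ h1 _ h2 (by simpa [mul_assoc, d] using h3)
    simpa [mul_assoc] using this
  have finv : ∀ x y, L.d x y ≤ n → f (y⁻¹ * x) = (f (x⁻¹ * y))⁻¹ := by
    intro x y h
    have := hf' x y x h (by rwa [L.d_comm]) (by rw [L.d_self]; omega)
    rw [inv_mul_cancel, f1] at this
    exact (inv_eq_of_mul_eq_one_right this.symm).symm
  -- recursive definition
  let F0 : ℕ → G → H := fun k => Nat.rec (fun _ => 1)
    (fun _ Fk g => if L.ℓ g = 0 then 1 else Fk (pred g) * f ((pred g)⁻¹ * g)) k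
  have F0s : ∀ k g, F0 (k+1) g = if L.ℓ g = 0 then 1 else F0 k (pred g) * f ((pred g)⁻¹ * g) :=
    fun _ _ => rfl
  have F0st : ∀ k k' g, L.ℓ g ≤ k → L.ℓ g ≤ k' → F0 k g = F0 k' g := by
    intro k
    induction k with
    | zero =>
      intro k' g h _
      cases k' with
      | zero => rfl
      | succ k' => rw [F0s, if_pos (by omega)]; rfl
    | succ k ih =>
      intro k' g h h'
      cases k' with
      | zero => rw [F0s, if_pos (by omega)]; rfl
      | succ k' =>
        rw [F0s, F0s]
        split_ifs with h0
        · rfl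
        · rw [ih k' (pred g) (by rw [hp1]; omega) (by rw [hp1]; omega)]
  let F : G → H := fun g => F0 (L.ℓ g) g
  have F1 : F 1 = 1 := by simp only [F, L.one]; rfl
  have Fs : ∀ g, L.ℓ g ≠ 0 → F g = F (pred g) * f ((pred g)⁻¹ * g) := by
    intro g hg
    have : F g = F0 (L.ℓ g + 1) g := F0st (L.ℓ g) (L.ℓ g + 1) g le_rfl (by omega)
    rw [this, F0s, if_neg hg]
    rw [F0st (L.ℓ g) (L.ℓ (pred g)) (pred g) (by rw [hp1]; omega) le_rfl]
  have main : ∀ k g h, L.ℓ g + L.ℓ h ≤ k → L.ℓ g ≤ L.ℓ h → L.d g h ≤ n →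
      F h = F g * f (g⁻¹ * h) := by
    intro k
    induction k using Nat.strong_induction_on with
    | _ k ih =>
    intro g h hk hgh hd
    by_cases h0 : L.ℓ h = 0
    · rw [L.eq_one _ h0, L.eq_one g (by omega)]; simp [f1]
    · have a1 := hp1 h
      have a2 := hp2 h
      have key : L.d g (pred h) ≤ n := by
        by_cases hM : L.ℓ h < M
        · have : pred h = 1 := L.eq_one _ (by omega)
          rw [this, L.d_comm, L.d_one]; omega
        · have := L.d_hyp g (pred h) 1 h
          rw [L.d_comm g 1, L.d_comm (pred h) 1, L.d_one, L.d_one, L.d_one] at this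
          omega
      have e : F (pred h) = F g * f (g⁻¹ * pred h) := by
        rcases le_total (L.ℓ g) (L.ℓ (pred h)) with hle | hle
        · exact ih (L.ℓ g + L.ℓ (pred h)) (by omega) _ _ le_rfl hle key
        · have := ih (L.ℓ g + L.ℓ (pred h)) (by omega) _ _ (by omega) hle (by rwa [L.d_comm])
          rw [this, finv _ _ key]
          simp
      rw [Fs h h0, e, hf' g (pred h) h key (by omega) hd, mul_assoc]
  have main2 : ∀ g s, L.ℓ s ≤ n → F (g * s) = F g * f s := by
    intro g s hs
    have hd : L.d g (g * s) ≤ n := by simpa [d] using hs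
    rcases le_total (L.ℓ g) (L.ℓ (g * s)) with h | h
    · have := main _ g (g * s) le_rfl h hd
      simpa using this
    · have := main _ (g * s) g le_rfl h (by rwa [L.d_comm])
      rw [finv _ _ hd] at this
      rw [this]; simp
  have main3 : ∀ s, L.ℓ s ≤ n → F s = f s := by
    intro s hs
    have := main2 1 s hs
    simpa [F1] using this
  refine ⟨MonoidHom.mk' F ?_, fun s hs => main3 s hs⟩
  intro a
  refine gen _ (by simp [F1]) ?_
  intro g s h hs
  rw [← mul_assoc, main2 _ _ hs, h, main2 _ _ hs, mul_assoc]

end HypLen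
end HE

namespace HE

universe u

/-- The combinatorial structure extracted from a hyperbolic group. -/
structure Star (G : Type u) [Group G] where
  k : ℕ
  a : G → Fin k
  surj : Function.Surjective a
  ℓ : G → ℕ
  D : ℕ
  fin : {g | ℓ g ≤ D}.Finite
  isol : ∀ p, a p = a 1 → p = 1
  markov : ∀ y, D < ℓ y → ∃ z, ℓ z < ℓ y ∧ ℓ (z⁻¹ * y) < ℓ y ∧
    ∀ p p', a (z⁻¹ * p) = a (z⁻¹ * p') → a p = a p' ∨ a (y⁻¹ * p) = a (y⁻¹ * p')
  ρ : ℕ → Setoid G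
  ρ_fin : ∀ n, Finite (Quotient (ρ n))
  ρ_zero : ∀ p p', (ρ 0) p p'
  ρ_mono : ∀ n p p', (ρ (n+1)) p p' → (ρ n) p p'
  ρ_step : ∀ n p₀, ∃ x, ∀ p p', (ρ n) p p₀ → a (x⁻¹ * p) = a (x⁻¹ * p') → (ρ (n+1)) p p'
  ρ_fine : ∀ y, ∃ n, ∀ p p', (ρ n) p p' → a (y⁻¹ * p) = a (y⁻¹ * p')

namespace HypLen
variable {G : Type u} [Group G] (L : HypLen G)

/-- Agreement of distance patterns. -/
def sp (n : ℕ) (z p p' : G) : Prop :=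
  ∀ u, L.d z u ≤ n → (L.d u p : ℤ) - L.d z p = L.d u p' - L.d z p'

theorem sp_symm {n : ℕ} {z p p' : G} (h : L.sp n z p p') : L.sp n z p' p :=
  fun u hu => (h u hu).symm

theorem keyK_le (c R : ℕ) (hR : c + 2 * L.N + 1 ≤ R) (z p p' w : G) (h : L.sp R z p p')
    (hw : L.d z w + L.d z p ≤ L.d w p + c + L.N) :
    (L.d w p' : ℤ) - L.d z p' ≤ L.d w p - L.d z p := by
  have hq : ∃ q, L.d z q ≤ R ∧ L.d w q + L.d q p = L.d w p := by
    by_cases hc : L.d z w ≤ L.d w p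
    · obtain ⟨q, h1, h2⟩ := L.d_geod w p (L.d z w) hc
      refine ⟨q, ?_, by omega⟩
      have h3 := L.d_hyp z q w p
      have h4 := L.d_comm q w
      have h5 := L.d_comm w z
      omega
    · exact ⟨p, by omega, by rw [L.d_self]; omega⟩
  obtain ⟨q, h1, h2⟩ := hq
  have h3 := h q h1
  have h4 := L.d_tri w q p'
  omega

theorem keyK (c R : ℕ) (hR : c + 2 * L.N + 1 ≤ R) (z p p' w : G) (h : L.sp R z p p')
    (hw : L.d z w + L.d z p ≤ L.d w p + c) :
    (L.d w p : ℤ) - L.d z p = L.d w p' - L.d z p' := by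
  by_cases hc : L.d z w ≤ R
  · exact h w hc
  apply le_antisymm _ (L.keyK_le c R hR z p p' w h (by omega))
  apply L.keyK_le c R hR z p' p w (L.sp_symm h)
  obtain ⟨u, h1, h2⟩ := L.d_geod z w R (by omega)
  have h3 := h u (by omega)
  have h4 := L.d_tri w u p
  have h5 := L.d_comm w u
  -- four points: z w / u p'
  have h6 := L.d_hyp u p' w z
  have h7 := L.d_comm u z
  have h8 := L.d_comm w z
  have h9 := L.d_comm p' w
  have h10 := L.d_comm p' z
  omega

/-- The pattern map. -/
def pat (n : ℕ) (p : G) : {y : G // L.ℓ y ≤ n} → ℤ := fun y => (L.d y p : ℤ) - L.ℓ p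

theorem pat_fin (n : ℕ) : (Set.range (L.pat n)).Finite := by
  haveI : Finite {y : G // L.ℓ y ≤ n} := L.fin n
  have : (Set.univ.pi fun _ : {y : G // L.ℓ y ≤ n} => Set.Icc (-(n:ℤ)) n).Finite :=
    Set.Finite.pi fun _ => Set.finite_Icc _ _
  refine this.subset ?_
  rintro _ ⟨p, rfl⟩ y _
  have h1 := L.d_tri y 1 p
  have h2 := L.d_tri 1 y p
  have h3 := L.d_comm y 1
  rw [L.d_one] at h1 h2 h3
  have := y.2
  simp only [pat, Set.mem_Icc]
  rw [L.d_one] at h2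
  omega

theorem pat_eq (n : ℕ) (z p p' : G) : L.pat n (z⁻¹ * p) = L.pat n (z⁻¹ * p') ↔ L.sp n z p p' := by
  have key : ∀ (y : {y : G // L.ℓ y ≤ n}) p, L.pat n (z⁻¹ * p) y = (L.d (z * y) p : ℤ) - L.d z p := by
    intro y p
    simp [pat, d, mul_assoc]
  constructor
  · intro h u hu
    have := congrFun h ⟨z⁻¹ * u, hu⟩
    rw [key, key] at this
    simpa using this
  · intro h
    funext y
    rw [key, key]
    apply h
    simpa [d] using y.2

theorem exists_star (L : HypLen G) : Nonempty (Star G) := by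
  classical
  let c := 3 * L.N + 1
  let R := c + 2 * L.N + 1
  let D := 2 * R + 2 * L.N + 2
  haveI : Finite (Set.range (L.pat R)) := L.pat_fin R
  obtain ⟨k, ⟨e⟩⟩ := Finite.exists_equiv_fin (Set.range (L.pat R))
  let a : G → Fin k := fun p => e ⟨L.pat R p, p, rfl⟩
  have ha : ∀ p p', a p = a p' ↔ L.pat R p = L.pat R p' := by
    intro p p'
    simp only [a, e.injective.eq_iff]
    exact Subtype.ext_iff
  have haz : ∀ z p p', a (z⁻¹ * p) = a (z⁻¹ * p') ↔ L.sp R z p p' := by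
    intro z p p'; rw [ha, L.pat_eq]
  have ha1 : ∀ p p', a p = a p' ↔ L.sp R 1 p p' := by
    intro p p'; rw [← haz]; simp
  have isol : ∀ z p, L.sp R z p z → p = z := by
    intro z p h
    by_contra hne
    have h0 : 1 ≤ L.d z p := by
      by_contra h0
      exact hne (L.eq_of_d z p (by omega)).symm
    obtain ⟨u, h1, h2⟩ := L.d_geod z p 1 h0
    have h3 := h u (by omega)
    rw [L.d_self, L.d_comm u z] at h3
    omega
  refine ⟨⟨k, a, ?_, L.ℓ, D, L.fin D, ?_, ?_, fun n => Setoid.comap (L.pat n) ⊥, ?_, ?_, ?_, ?_, ?_⟩⟩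
  · intro i
    obtain ⟨p, hp⟩ := (e.symm i).2
    refine ⟨p, ?_⟩
    simp only [a, hp]
    exact e.apply_symm_apply i
  · intro p h
    exact isol 1 p ((ha1 _ _).1 h)
  · intro y hy
    have hy' : L.d 1 y = L.ℓ y := L.d_one y
    obtain ⟨z, h1, h2⟩ := L.d_geod 1 y (L.ℓ y / 2) (by omega)
    refine ⟨z, by rw [← L.d_one z]; omega, by change L.d z y < _; omega, ?_⟩
    intro p p' hp
    rw [haz] at hp
    rw [ha1, haz]
    have far : ∀ w w', L.d 1 w ≤ R → L.d y w' ≤ R →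
        L.d z w + L.d z w' ≤ L.d w w' + 2 * L.N := by
      intro w w' hw hw'
      have a1 := L.d_hyp 1 y w z
      have a2 := L.d_hyp w y w' z
      have a3 := L.d_tri 1 w z
      have a4 := L.d_tri z w' y
      have a5 := L.d_comm w' y
      have a6 := L.d_comm w z
      have a7 := L.d_comm w' z
      have a8 := L.d_comm y z
      have a9 := L.d_comm y w
      omega
    by_cases hall : ∀ w, L.d 1 w ≤ R → L.d z w + L.d z p ≤ L.d w p + c
    · left
      intro u hu
      have b1 := L.keyK c R le_rfl z p p' u hp (hall u hu)
      have b2 := L.keyK c R le_rfl z p p' 1 hp (hall 1 (by simp [L.d_self]))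
      omega
    · right
      push Not at hall
      obtain ⟨w, hw, hw2⟩ := hall
      have hall' : ∀ w', L.d y w' ≤ R → L.d z w' + L.d z p ≤ L.d w' p + c := by
        intro w' hw'
        have b1 := far w w' hw hw'
        have b2 := L.d_hyp w w' p z
        have a6 := L.d_comm w z
        have a7 := L.d_comm w' z
        have a8 := L.d_comm p z
        omega
      intro u hu
      have b1 := L.keyK c R le_rfl z p p' u hp (hall' u hu)
      have b2 := L.keyK c R le_rfl z p p' y hp (hall' y (by simp [L.d_self]))
      omega
  · intro n
    haveI : Finite (Set.range (L.pat n)) := L.pat_fin n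
    refine Finite.of_injective (β := Set.range (L.pat n)) (Quotient.lift (fun p => ⟨L.pat n p, p, rfl⟩) ?_) ?_
    · intro p p' h; exact Subtype.ext h
    · intro q q'
      refine Quotient.inductionOn₂ q q' ?_
      intro p p' h
      exact Quotient.sound (Subtype.ext_iff.1 h)
  · intro p p'
    change L.pat 0 p = L.pat 0 p'
    funext y
    have : (y : G) = 1 := L.eq_one _ (by have := y.2; omega)
    simp [pat, this, L.d_one]
  · intro n p p' h
    change L.pat n p = L.pat n p'
    have h : L.pat (n+1) p = L.pat (n+1) p' := h
    funext y
    exact congrFun h ⟨y.1, y.2.trans (by omega)⟩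
  · intro n p₀
    have conv : ∀ n p p', (Setoid.comap (L.pat n) ⊥) p p' ↔ L.sp n 1 p p' := by
      intro n p p'
      have := L.pat_eq n 1 p p'
      simp only [inv_one, one_mul] at this
      exact this
    simp only [conv, haz]
    by_cases hn : n ≤ L.ℓ p₀
    · have hy' : L.d 1 p₀ = L.ℓ p₀ := L.d_one _
      obtain ⟨x, h1, h2⟩ := L.d_geod 1 p₀ n (by omega)
      refine ⟨x, fun p p' hp hx => ?_⟩
      have h3 := hp x (by omega)
      have hall : ∀ w, L.d 1 w ≤ n + 1 → (L.d w p : ℤ) - L.d x p = L.d w p' - L.d x p' := by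
        intro w hw
        by_cases hwR : L.d x w ≤ R
        · exact hx w hwR
        · apply L.keyK c R le_rfl x p p' w hx
          have h4 := L.d_hyp w x 1 p
          have a1 := L.d_comm w x
          have a2 := L.d_comm w 1
          have a3 := L.d_comm x 1
          omega
      intro u hu
      have b1 := hall u hu
      have b2 := hall 1 (by simp [L.d_self])
      omega
    · refine ⟨p₀, fun p p' hp hx => ?_⟩
      have hy' : L.d 1 p₀ = L.ℓ p₀ := L.d_one _
      have hpp : p = p₀ := by
        by_contra hne
        have h0 : 1 ≤ L.d p₀ p := by
          by_contra h0
          exact hne (L.eq_of_d _ _ (by omega)).symm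
        obtain ⟨u, h1, h2⟩ := L.d_geod p₀ p 1 h0
        have h3 := hp p₀ (by omega)
        have h4 := hp u (by have := L.d_tri 1 p₀ u; omega)
        have h5 := L.d_comm u p₀
        have h6 := L.d_self p₀
        omega
      subst hpp
      have := isol p p' (L.sp_symm hx)
      subst this
      intro u _; rfl
  · intro y
    refine ⟨L.ℓ y + R, fun p p' h => ?_⟩
    have h : L.pat (L.ℓ y + R) p = L.pat (L.ℓ y + R) p' := h
    have h' : L.sp (L.ℓ y + R) 1 p p' := by
      rw [← L.pat_eq]; simpa using h
    rw [haz]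
    intro u hu
    have hy' : L.d 1 y = L.ℓ y := L.d_one _
    have b1 := h' u (by have := L.d_tri 1 y u; omega)
    have b2 := h' y (by omega)
    omega

end HypLen
end HE

namespace HE

/-- Infinite binary words. -/
abbrev Y := ℕ → Bool

def ycons (b : Bool) (y : Y) : Y := fun n => Nat.casesOn n b y

def app : List Bool → Y → Y
  | [], y => y
  | b :: l, y => ycons b (app l y)

@[simp] theorem app_nil (y : Y) : app [] y = y := rfl
theorem app_cons (b l) (y : Y) : app (b :: l) y = ycons b (app l y) := rfl

theorem ycons_inj {b c : Bool} {y z : Y} (h : ycons b y = ycons c z) : b = c ∧ y = z := by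
  refine ⟨congrFun h 0, ?_⟩
  funext n
  exact congrFun h (n+1)

theorem exists_ycons (y : Y) : ∃ b z, y = ycons b z :=
  ⟨y 0, fun n => y (n+1), by funext n; cases n <;> rfl⟩

theorem app_append (α β : List Bool) (y : Y) : app (α ++ β) y = app α (app β y) := by
  induction α with
  | nil => rfl
  | cons b l ih => simp [app, ih]

theorem app_inj {α : List Bool} {y z : Y} (h : app α y = app α z) : y = z := by
  induction α with
  | nil => exact h
  | cons b l ih => exact ih (ycons_inj h).2

@[simp] theorem app_inj_iff {α : List Bool} {y z : Y} : app α y = app α z ↔ y = z :=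
  ⟨app_inj, fun h => h ▸ rfl⟩

theorem app_split (n : ℕ) (y : Y) : ∃ α z, α.length = n ∧ y = app α z := by
  induction n generalizing y with
  | zero => exact ⟨[], y, rfl, rfl⟩
  | succ n ih =>
    obtain ⟨b, z, rfl⟩ := exists_ycons y
    obtain ⟨α, w, h, rfl⟩ := ih z
    exact ⟨b :: α, w, by simp [h], rfl⟩

theorem app_cmp {α β : List Bool} {y z : Y} (h : app α y = app β z) (hl : α.length ≤ β.length) :
    ∃ γ, β = α ++ γ ∧ y = app γ z := by
  induction α generalizing β with
  | nil => exact ⟨β, rfl, h⟩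
  | cons b l ih =>
    cases β with
    | nil => simp at hl
    | cons c m =>
      obtain ⟨h1, h2⟩ := ycons_inj h
      obtain ⟨γ, h3, h4⟩ := ih h2 (by simpa using hl)
      exact ⟨γ, by rw [h1, h3]; rfl, h4⟩

/-- `Pre α y`: the finite word `α` is an initial segment of `y`. -/
def Pre (α : List Bool) (y : Y) : Prop := ∃ z, y = app α z

theorem pre_app (α : List Bool) (y : Y) : Pre α (app α y) := ⟨y, rfl⟩

theorem pre_append {α β : List Bool} {y : Y} (h : Pre (α ++ β) y) : Pre α y := by
  obtain ⟨z, rfl⟩ := h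
  exact ⟨app β z, app_append _ _ _⟩

theorem pre_cmp {α β : List Bool} {y : Y} (h : Pre α y) (h' : Pre β y)
    (hl : α.length ≤ β.length) : α <+: β := by
  obtain ⟨z, rfl⟩ := h
  obtain ⟨z', h'⟩ := h'
  obtain ⟨γ, h1, _⟩ := app_cmp h' hl
  exact ⟨γ, h1.symm⟩

theorem pre_of_pfx {α β : List Bool} {y : Y} (h : α <+: β) (h' : Pre β y) : Pre α y := by
  obtain ⟨γ, rfl⟩ := h
  exact pre_append h'

theorem eq_of_app_eq {α β : List Bool} (h : ∀ y, app α y = app β y) : α = β := by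
  have key : ∀ α β : List Bool, α.length ≤ β.length → (∀ y, app α y = app β y) → α = β := by
    intro α β hl h
    obtain ⟨γ, h1, -⟩ := app_cmp (h (fun _ => true)) hl
    cases γ with
    | nil => simpa using h1.symm
    | cons b m =>
      exfalso
      subst h1
      have := h (fun _ => !b)
      rw [app_append, app_inj_iff, app_cons] at this
      have := congrFun this 0
      simp [ycons] at this
  rcases le_total α.length β.length with hl | hl
  · exact key α β hl h
  · exact (key β α hl (fun y => (h y).symm)).symm

/-- Thompson's group `V`, as a subgroup of the permutation group of Cantor space. -/
def VSub : Subgroup (Equiv.Perm Y) where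
  carrier := {v | ∃ N, ∀ α : List Bool, α.length = N → ∃ β, ∀ y, v (app α y) = app β y}
  one_mem' := ⟨0, fun α _ => ⟨α, fun y => rfl⟩⟩
  mul_mem' := by
    rintro v w ⟨N, hv⟩ ⟨M, hw⟩
    refine ⟨M + N, fun α hα => ?_⟩
    obtain ⟨β, hβ⟩ := hw (α.take M) (by simp; omega)
    have hl : N ≤ (β ++ α.drop M).length := by simp; omega
    obtain ⟨γ, hγ⟩ := hv ((β ++ α.drop M).take N) (by rw [List.length_take]; omega)
    refine ⟨γ ++ (β ++ α.drop M).drop N, fun y => ?_⟩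
    rw [Equiv.Perm.mul_apply]
    conv_lhs => rw [← List.take_append_drop M α, app_append, hβ, ← app_append,
      ← List.take_append_drop N (β ++ α.drop M), app_append, hγ, ← app_append]
  inv_mem' := by
    rintro v ⟨N, hv⟩
    choose f hf using hv
    classical
    have hfin : {α : List Bool | α.length = N}.Finite := List.finite_length_eq Bool N
    obtain ⟨M, hM⟩ : ∃ M, ∀ α h, (f α h).length ≤ M := by
      haveI : Finite {α : List Bool // α.length = N} := hfin
      obtain ⟨M, hM⟩ := (Set.finite_range fun α : {α : List Bool // α.length = N} =>
        (f α.1 α.2).length).bddAbove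
      exact ⟨M, fun α h => hM ⟨⟨α, h⟩, rfl⟩⟩
    refine ⟨M, fun γ hγ => ?_⟩
    obtain ⟨α, z, hα, hz⟩ := app_split N (v⁻¹ (app γ fun _ => true))
    have h1 : app γ (fun _ => true) = app (f α hα) z := by
      rw [← hf α hα, ← hz]; simp
    obtain ⟨γ', h2, h3⟩ := app_cmp h1.symm ((hM α hα).trans hγ.ge)
    refine ⟨α ++ γ', fun y => ?_⟩
    rw [Equiv.Perm.inv_eq_iff_eq, app_append, hf α hα, h2, app_append]

/-- Thompson's group. -/
abbrev V := ↥VSub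

theorem V_ext {v w : V} (h : ∀ y, v.1 y = w.1 y) : v = w :=
  Subtype.ext (Equiv.ext h)

theorem V_mul (v w : V) (y : Y) : (v * w).1 y = v.1 (w.1 y) := rfl
theorem V_one (y : Y) : (1 : V).1 y = y := rfl
theorem V_inv_app (v : V) (y : Y) : (v⁻¹).1 (v.1 y) = y := by
  rw [← V_mul]; simp [V_one]
theorem V_app_inv (v : V) (y : Y) : v.1 ((v⁻¹).1 y) = y := by
  rw [← V_mul]; simp [V_one]
theorem V_inv_eq {v : V} {y z : Y} (h : v.1 y = z) : (v⁻¹).1 z = y := by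
  rw [← h, V_inv_app]

section base
variable {ι : Type} 

/-- A complete code indexed by `ι` . -/
def Base (l : ι → List Bool) : Prop := ∀ y : Y, ∃! i, Pre (l i) y

theorem Base.bij {l : ι → List Bool} (h : Base l) :
    Function.Bijective (fun p : ι × Y => app (l p.1) p.2) := by
  constructor
  · rintro ⟨i, y⟩ ⟨j, z⟩ hij
    simp only at hij
    have : i = j := (h (app (l i) y)).unique (pre_app _ _) (by rw [hij]; exact pre_app _ _)
    subst this
    rw [app_inj hij]
  · intro y
    obtain ⟨i, ⟨z, hz⟩, -⟩ := h y
    exact ⟨(i, z), hz.symm⟩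

/-- Tabulation. -/
noncomputable def tab {l : ι → List Bool} (h : Base l) : ι × Y ≃ Y := Equiv.ofBijective _ h.bij

theorem tab_apply {l : ι → List Bool} (h : Base l) (i : ι) (y : Y) :
    tab h (i, y) = app (l i) y := rfl

theorem tab_symm {l : ι → List Bool} (h : Base l) (i : ι) (y : Y) :
    (tab h).symm (app (l i) y) = (i, y) := by
  rw [Equiv.symm_apply_eq]; rfl

theorem Base.len_bdd [Finite ι] (l : ι → List Bool) : ∃ M, ∀ i, (l i).length ≤ M := by
  obtain ⟨M, hM⟩ := (Set.finite_range fun i => (l i).length).bddAbove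
  exact ⟨M, fun i => hM ⟨i, rfl⟩⟩

/-- The element of `V` taking `l i` to `m i`. -/
noncomputable def bv [Finite ι] {m l : ι → List Bool} (hm : Base m) (hl : Base l) : V :=
  ⟨(tab hl).symm.trans (tab hm), by
    obtain ⟨N, hN⟩ := Base.len_bdd l
    refine ⟨N, fun α hα => ?_⟩
    obtain ⟨i, hi, -⟩ := hl (app α fun _ => true)
    obtain ⟨γ, hγ⟩ := pre_cmp hi (pre_app _ _) ((hN i).trans hα.ge)
    refine ⟨m i ++ γ, fun y => ?_⟩
    rw [← hγ, app_append, Equiv.trans_apply, tab_symm, tab_apply, app_append]⟩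

theorem bv_app [Finite ι] {m l : ι → List Bool} (hm : Base m) (hl : Base l) (i : ι) (y : Y) :
    (bv hm hl).1 (app (l i) y) = app (m i) y := by
  change ((tab hl).symm.trans (tab hm)) _ = _
  rw [Equiv.trans_apply, tab_symm, tab_apply]

theorem eq_bv [Finite ι] {m l : ι → List Bool} (hm : Base m) (hl : Base l) {v : V}
    (h : ∀ i y, v.1 (app (l i) y) = app (m i) y) : v = bv hm hl := by
  apply V_ext
  intro y
  obtain ⟨i, ⟨z, rfl⟩, -⟩ := hl y
  rw [h, bv_app]

theorem bv_mul [Finite ι] {n m l : ι → List Bool} (hn : Base n) (hm : Base m) (hl : Base l) :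
    bv hn hm * bv hm hl = bv hn hl :=
  eq_bv _ _ fun i y => by rw [V_mul, bv_app, bv_app]

theorem bv_self [Finite ι] {l : ι → List Bool} (hl : Base l) : bv hl hl = 1 :=
  (eq_bv _ _ fun i y => rfl).symm

theorem Base.comp {κ : Type} {l : ι → List Bool} (h : Base l) (e : κ ≃ ι) : Base (l ∘ e) := by
  intro y
  obtain ⟨i, hi, hu⟩ := h y
  refine ⟨e.symm i, by simpa using hi, fun j hj => ?_⟩
  rw [Equiv.eq_symm_apply]; exact hu _ hj

theorem Base.map {l : ι → List Bool} (h : Base l) (v : V) (m : ι → List Bool)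
    (hv : ∀ i y, v.1 (app (l i) y) = app (m i) y) : Base m := by
  intro y
  obtain ⟨i, ⟨z, hz⟩, hu⟩ := h ((v⁻¹).1 y)
  have : y = app (m i) z := by rw [← hv, ← hz, V_app_inv]
  refine ⟨i, ⟨z, this⟩, fun j hj => hu _ ?_⟩
  obtain ⟨w, hw⟩ := hj
  exact ⟨w, V_inv_eq (by rw [hv, hw])⟩

theorem Base.inj {l : ι → List Bool} (h : Base l) : Function.Injective l := by
  intro i j hij
  exact (h (app (l i) fun _ => true)).unique (pre_app _ _) (by rw [hij]; exact pre_app _ _)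

theorem Base.eq_of_pfx {l : ι → List Bool} (h : Base l) {i j : ι} (hij : l i <+: l j) : i = j :=
  (h (app (l j) fun _ => true)).unique (pre_of_pfx hij (pre_app _ _)) (pre_app _ _)

/-- Existence of carets below a given word. -/
theorem Base.caret [Finite ι] {l : ι → List Bool} (h : Base l) (a : List Bool) (i₀ : ι)
    (ha : a <+: l i₀) (hlt : a.length < (l i₀).length) :
    ∃ i j w, l i = a ++ w ++ [false] ∧ l j = a ++ w ++ [true] := by
  have hfin : {i | a <+: l i ∧ a.length < (l i).length}.Finite := Set.toFinite _
  obtain ⟨i, ⟨⟨w, hw⟩, hi2⟩, hmax⟩ := Set.exists_max_image _ (fun i => (l i).length) hfin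
    ⟨i₀, ha, hlt⟩
  have hw0 : w ≠ [] := by rintro rfl; simp at hw; rw [← hw] at hi2; omega
  obtain ⟨w', b, rfl⟩ := List.eq_nil_or_concat w |>.resolve_left hw0
  rw [List.concat_eq_append, ← List.append_assoc] at hw
  obtain ⟨j, hj, -⟩ := h (app (a ++ w' ++ [!b]) fun _ => true)
  have hlen : (a ++ w').length < (l j).length := by
    by_contra hc
    have h1 : l j <+: a ++ w' := pre_cmp hj (pre_append (pre_app _ _)) (by omega)
    have h2 : l j <+: l i := h1.trans ⟨[b], hw⟩
    have := h.eq_of_pfx h2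
    subst this
    rw [← hw] at h1
    have := h1.length_le
    simp at this
  have h1 : a ++ w' ++ [!b] <+: l j := pre_cmp (pre_app _ _) hj (by simp at hlen ⊢; omega)
  have h2 : a <+: l j := ((List.prefix_append a (w' ++ [!b])).trans (by simpa using h1))
  have h3 := hmax j ⟨h2, lt_of_le_of_lt (by simp) hlen⟩
  have h4 : a ++ w' ++ [!b] = l j := h1.eq_of_length (by
    have := h1.length_le
    rw [← hw] at h3
    simp at h3 this ⊢; omega)
  cases b
  · exact ⟨i, j, w', hw.symm, h4.symm⟩
  · exact ⟨j, i, w', h4.symm, hw.symm⟩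

theorem Base.length_le {n : ℕ} {l : Fin n → List Bool} (h : Base l) (i : Fin n) :
    (l i).length ≤ n := by
  -- branch points
  have hb : ∀ k : Fin (l i).length, ∃ j, (l i).take k ++ [!(l i).get k] <+: l j := by
    intro k
    obtain ⟨j, hj, -⟩ := h (app ((l i).take k ++ [!(l i).get k]) fun _ => true)
    refine ⟨j, pre_cmp (pre_app _ _) hj ?_⟩
    by_contra hc
    have hlk : ((l i).take k).length = k := by simp
    have h1 : l j <+: (l i).take k := pre_cmp hj (pre_append (pre_app _ _)) (by simp at hc ⊢; omega)
    have h2 := h.eq_of_pfx (h1.trans ⟨_, List.take_append_drop _ _⟩)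
    subst h2
    have := h1.length_le
    simp at this; omega
  choose f hf using hb
  have : Function.Injective f := by
    have key : ∀ k k' : Fin (l i).length, k < k' → f k ≠ f k' := by
      intro k k' hk he
      have h1 := hf k
      have h2 := hf k'
      rw [← he] at h2
      obtain ⟨r, hr⟩ := h1
      obtain ⟨s, hs⟩ := h2
      have e1 : (l (f k))[(k:ℕ)]? = some (!(l i).get k) := by
        rw [← hr, List.append_assoc, List.getElem?_append_right (by simp)]
        simp
      have e2 : (l (f k))[(k:ℕ)]? = some ((l i).get k) := by
        rw [← hs, List.append_assoc, List.getElem?_append_left (by simp; omega)]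
        rw [List.getElem?_take_of_lt (by exact hk)]
        simp
      rw [e1] at e2
      simp at e2
    intro k k' he
    rcases lt_trichotomy k k' with hk | hk | hk
    · exact absurd he (key _ _ hk)
    · exact hk
    · exact absurd he.symm (key _ _ hk)
  simpa using Fintype.card_le_of_injective f this

end base

section baseOn
variable {ι : Type} [DecidableEq ι]

/-- A code indexed by the members of a finite set. -/
def BaseOn (A : Finset ι) (l : ι → List Bool) : Prop := ∀ y : Y, ∃! i, i ∈ A ∧ Pre (l i) y

theorem pre_snoc (w : List Bool) (y : Y) (h : Pre w y) :
    (Pre (w ++ [false]) y ∧ ¬ Pre (w ++ [true]) y) ∨ (Pre (w ++ [true]) y ∧ ¬ Pre (w ++ [false]) y) := by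
  obtain ⟨z, rfl⟩ := h
  obtain ⟨b, z, rfl⟩ := exists_ycons z
  cases b
  · left
    refine ⟨⟨z, by rw [app_append]; rfl⟩, ?_⟩
    rintro ⟨z', h⟩
    rw [app_append, app_inj_iff] at h
    exact absurd (ycons_inj h).1 (by simp)
  · right
    refine ⟨⟨z, by rw [app_append]; rfl⟩, ?_⟩
    rintro ⟨z', h⟩
    rw [app_append, app_inj_iff] at h
    exact absurd (ycons_inj h).1 (by simp)

theorem BaseOn.step {A : Finset ι} {l : ι → List Bool} (h : BaseOn A l) {i j : ι} (hi : i ∈ A)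
    (hj : j ∉ A) : BaseOn (insert j A)
      (Function.update (Function.update l j (l i ++ [true])) i (l i ++ [false])) := by
  have hij : j ≠ i := fun h => hj (h ▸ hi)
  intro y
  obtain ⟨k, ⟨hk, hp⟩, hu⟩ := h y
  by_cases hki : k = i
  · subst hki
    rcases pre_snoc _ _ hp with ⟨h1, h2⟩ | ⟨h1, h2⟩
    · refine ⟨k, ⟨by simp [hk], by simpa using h1⟩, ?_⟩
      rintro r ⟨hr, hr2⟩
      by_contra hne
      rw [Function.update_of_ne hne] at hr2
      by_cases hrj : r = j
      · subst hrj; rw [Function.update_self] at hr2; exact h2 hr2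
      · rw [Function.update_of_ne hrj] at hr2
        exact hne (hu r ⟨(Finset.mem_insert.1 hr).resolve_left hrj, hr2⟩)
    · refine ⟨j, ⟨by simp, ?_⟩, ?_⟩
      · rw [Function.update_of_ne hij, Function.update_self]; exact h1
      rintro r ⟨hr, hr2⟩
      by_contra hne
      by_cases hrk : r = k
      · subst hrk; rw [Function.update_self] at hr2; exact h2 hr2
      · rw [Function.update_of_ne hrk, Function.update_of_ne hne] at hr2
        exact hrk (hu r ⟨(Finset.mem_insert.1 hr).resolve_left hne, hr2⟩)
  · have hkj : k ≠ j := fun h => hj (h ▸ hk)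
    refine ⟨k, ⟨by simp [hk], ?_⟩, ?_⟩
    · rw [Function.update_of_ne hki, Function.update_of_ne hkj]; exact hp
    rintro r ⟨hr, hr2⟩
    by_cases hri : r = i
    · subst hri
      rw [Function.update_self] at hr2
      exact hu r ⟨hi, pre_append hr2⟩
    · rw [Function.update_of_ne hri] at hr2
      by_cases hrj : r = j
      · subst hrj
        rw [Function.update_self] at hr2
        exact absurd (hu i ⟨hi, pre_append hr2⟩).symm hki
      · rw [Function.update_of_ne hrj] at hr2
        exact hu r ⟨(Finset.mem_insert.1 hr).resolve_left hrj, hr2⟩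

theorem exists_baseOn (A : Finset ι) (hA : A.Nonempty) : ∃ l, BaseOn A l := by
  induction hA using Finset.Nonempty.cons_induction with
  | singleton a => exact ⟨fun _ => [], fun y => ⟨a, ⟨by simp, ⟨y, rfl⟩⟩, by simp⟩⟩
  | cons a s ha hs ih =>
    obtain ⟨l, hl⟩ := ih
    obtain ⟨i, hi⟩ := hs
    exact ⟨_, by rw [Finset.cons_eq_insert]; exact hl.step hi ha⟩

theorem BaseOn.base [Fintype ι] {l : ι → List Bool} (h : BaseOn Finset.univ l) : Base l := by
  intro y; simpa using h y

theorem Base.baseOn [Fintype ι] {l : ι → List Bool} (h : Base l) : BaseOn Finset.univ l := by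
  intro y; simpa using h y

end baseOn
end HE

namespace HE

/-- Gluing lemma for cocycles. -/
theorem glue {O Q H : Type*} [Group H] (L : Q → Set O) (orth : Q → Q → Prop)
    (hsym : ∀ q r, orth q r → orth r q)
    (h1 : ∀ l, ∃ q, l ∈ L q) (h2 : ∀ l q r, l ∈ L q → l ∈ L r → q = r ∨ orth q r)
    (h3 : ∀ q r s, orth q r → orth q s → orth r s → ∃ n, n ∈ L q ∧ n ∈ L r ∧ n ∈ L s)
    (h4 : ∀ q r s t w, ∃ u, orth u q ∧ orth u r ∧ orth u s ∧ orth u t ∧ orth u w)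
    (E : O → O → H)
    (hE : ∀ q, ∀ n ∈ L q, ∀ m ∈ L q, ∀ l ∈ L q, E n l = E n m * E m l) :
    (∃ h : O → H, ∀ q, ∀ l ∈ L q, ∀ m ∈ L q, h m = E m l * h l) ∧
    (∀ l m, ∃ n n' q s r, l ∈ L q ∧ n ∈ L q ∧ n ∈ L s ∧ n' ∈ L s ∧ n' ∈ L r ∧ m ∈ L r) := by
  have h3' : ∀ q r, orth q r → ∃ n, n ∈ L q ∧ n ∈ L r := by
    intro q r hqr
    obtain ⟨u, hu1, hu2, -⟩ := h4 q r q q q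
    obtain ⟨n, a, b, -⟩ := h3 q r u hqr (hsym _ _ hu1) (hsym _ _ hu2)
    exact ⟨n, a, b⟩
  constructor
  swap
  · intro l m
    obtain ⟨q, hq⟩ := h1 l
    obtain ⟨r, hr⟩ := h1 m
    obtain ⟨s, hs1, hs2, -⟩ := h4 q r q q q
    obtain ⟨n, hn1, hn2⟩ := h3' s q hs1
    obtain ⟨n', hn1', hn2'⟩ := h3' s r hs2
    exact ⟨n, n', q, s, r, hq, hn2, hn1, hn1', hn2', hr⟩
  by_cases hO : Nonempty O
  swap
  · exact ⟨fun l => absurd ⟨l⟩ hO, fun q l => absurd ⟨l⟩ hO⟩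
  obtain ⟨l₀⟩ := hO
  obtain ⟨q₀, hq₀⟩ := h1 l₀
  let val : O → O → O → H := fun l n n' => E l n * E n n' * E n' l₀
  -- same data
  have A0 : ∀ q s l n n' t t', l ∈ L q → n ∈ L q → n ∈ L s → n' ∈ L s → n' ∈ L q₀ →
      t ∈ L q → t ∈ L s → t' ∈ L s → t' ∈ L q₀ → val l n n' = val l t t' := by
    intro q s l n n' t t' a1 a2 a3 a4 a5 b1 b2 b3 b4
    simp only [val]
    rw [hE q l a1 t b1 n a2, mul_assoc (E l t), ← hE s t b2 n a3 n' a4, hE s t b2 t' b3 n' a4,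
      hE q₀ t' b4 n' a5 l₀ hq₀]
    simp only [mul_assoc]
  have A1 : ∀ q s u l n n' t t', orth s q₀ → orth s q → orth u q₀ → orth u q → orth s u → l ∈ L q →
      n ∈ L q → n ∈ L s → n' ∈ L s → n' ∈ L q₀ →
      t ∈ L q → t ∈ L u → t' ∈ L u → t' ∈ L q₀ → val l n n' = val l t t' := by
    intro q s u l n n' t t' o1 o2 o3 o4 o5 a1 a2 a3 a4 a5 b1 b2 b3 b4
    obtain ⟨w, c1, c2, c3⟩ := h3 s u q o5 o2 o4
    obtain ⟨w', d1, d2, d3⟩ := h3 s u q₀ o5 o1 o3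
    rw [A0 q s l n n' w w' a1 a2 a3 a4 a5 c3 c1 d1 d3, A0 q u l t t' w w' a1 b1 b2 b3 b4 c3 c2 d2 d3]
  have U : ∀ q s r u l n n' t t', orth s q₀ → orth s q → orth u q₀ → orth u r → l ∈ L q → l ∈ L r →
      n ∈ L q → n ∈ L s → n' ∈ L s → n' ∈ L q₀ →
      t ∈ L r → t ∈ L u → t' ∈ L u → t' ∈ L q₀ → val l n n' = val l t t' := by
    intro q s r u l n n' t t' o1 o2 o3 o4 a0 a1 a2 a3 a4 a5 b1 b2 b3 b4
    obtain ⟨v, v1, v2, v3, v4, v5⟩ := h4 q₀ q r s u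
    obtain ⟨w', d1, d2⟩ := h3' v q₀ v1
    rcases h2 l q r a0 a1 with rfl | hqr
    · obtain ⟨w, c1, c2⟩ := h3' v q v2
      rw [A1 q s v l n n' w w' o1 o2 v1 v2 (hsym _ _ v4) a0 a2 a3 a4 a5 c2 c1 d1 d2,
        A1 q u v l t t' w w' o3 o4 v1 v2 (hsym _ _ v5) a0 b1 b2 b3 b4 c2 c1 d1 d2]
    · obtain ⟨w, c1, c2, c3⟩ := h3 v q r v2 v3 hqr
      rw [A1 q s v l n n' w w' o1 o2 v1 v2 (hsym _ _ v4) a0 a2 a3 a4 a5 c2 c1 d1 d2,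
        A1 r u v l t t' w w' o3 o4 v1 v3 (hsym _ _ v5) a1 b1 b2 b3 b4 c3 c1 d1 d2]
  have ex : ∀ q, ∃ s n n', orth s q₀ ∧ orth s q ∧ n ∈ L q ∧ n ∈ L s ∧ n' ∈ L s ∧ n' ∈ L q₀ := by
    intro q
    obtain ⟨s, s1, s2, -⟩ := h4 q₀ q q q q
    obtain ⟨n, c1, c2⟩ := h3' s q s2
    obtain ⟨n', d1, d2⟩ := h3' s q₀ s1
    exact ⟨s, n, n', s1, s2, c2, c1, d1, d2⟩
  choose qq hqq using h1
  choose s n n' k1 k2 k3 k4 k5 k6 using ex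
  refine ⟨fun l => val l (n (qq l)) (n' (qq l)), ?_⟩
  intro q l hl m hm
  dsimp only
  rw [U _ _ q (s q) m _ _ (n q) (n' q) (k1 _) (k2 _) (k1 _) (k2 _) (hqq m) hm (k3 _) (k4 _) (k5 _) (k6 _)
    (k3 _) (k4 _) (k5 _) (k6 _),
    U _ _ q (s q) l _ _ (n q) (n' q) (k1 _) (k2 _) (k1 _) (k2 _) (hqq l) hl (k3 _) (k4 _) (k5 _) (k6 _)
    (k3 _) (k4 _) (k5 _) (k6 _)]
  simp only [val]
  rw [hE q m hm l hl _ (k3 q)]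
  simp only [mul_assoc]

/-- Elements of `V` representable by codes of size `n`. -/
def SV (n : ℕ) : Set V := {v | ∃ m l : Fin n → List Bool, Base m ∧ Base l ∧
  ∀ i y, v.1 (app (l i) y) = app (m i) y}

theorem bv_mem_SV {n : ℕ} {m l : Fin n → List Bool} (hm : Base m) (hl : Base l) : bv hm hl ∈ SV n :=
  ⟨m, l, hm, hl, bv_app hm hl⟩

theorem SV_finite (n : ℕ) : (SV n).Finite := by
  classical
  have h1 : {l : List Bool | l.length ≤ n}.Finite := List.finite_length_le _ n
  have h2 : {l : Fin n → List Bool | ∀ i, (l i).length ≤ n}.Finite := by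
    have := Set.Finite.pi' (fun _ : Fin n => h1)
    exact this
  let F : (Fin n → List Bool) × (Fin n → List Bool) → V := fun p =>
    if h : Base p.1 ∧ Base p.2 then bv h.1 h.2 else 1
  refine ((h2.prod h2).image F).subset ?_
  rintro v ⟨m, l, hm, hl, h⟩
  refine ⟨(m, l), ⟨hm.length_le, hl.length_le⟩, ?_⟩
  simp only [F, dif_pos (And.intro hm hl)]
  exact (eq_bv _ _ h).symm

/-- `l` has a caret with labels `i`, `j`. -/
def Caret {ι : Type} (l : ι → List Bool) (i j : ι) : Prop := ∃ w, l i = w ++ [false] ∧ l j = w ++ [true]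

/-- The merged code. -/
def mer {n : ℕ} (l : Fin (n+1) → List Bool) (i j : Fin (n+1)) : Fin n → List Bool := fun k =>
  if j.succAbove k = i then (l i).dropLast else l (j.succAbove k)

theorem Caret.ne {ι : Type} {l : ι → List Bool} {i j : ι} (h : Caret l i j) : i ≠ j := by
  rintro rfl
  obtain ⟨w, h1, h2⟩ := h
  rw [h1] at h2; simp at h2

theorem mer_base {n : ℕ} {l : Fin (n+1) → List Bool} (h : Base l) {i j : Fin (n+1)}
    (hc : Caret l i j) : Base (mer l i j) := by
  intro y
  have hne := hc.ne
  obtain ⟨w, h1, h2⟩ := hc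
  obtain ⟨k, hk, hu⟩ := h y
  have hw : Pre w y → k = i ∨ k = j := by
    intro hp
    rcases pre_snoc _ _ hp with ⟨h3, -⟩ | ⟨h3, -⟩
    · left; exact (hu i (show Pre (l i) y by rw [h1]; exact h3)).symm
    · right; exact (hu j (show Pre (l j) y by rw [h2]; exact h3)).symm
  obtain ⟨i', hi'⟩ := Fin.exists_succAbove_eq hne
  by_cases hk' : k = i ∨ k = j
  · have hp : Pre w y := by
      rcases hk' with rfl | rfl
      · rw [h1] at hk; exact pre_append hk
      · rw [h2] at hk; exact pre_append hk
    refine ⟨i', by simp [mer, hi', h1, hp], ?_⟩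
    intro r hr
    by_contra hne'
    have hri : j.succAbove r ≠ i := by
      intro h; apply hne'; exact Fin.succAbove_right_injective (h.trans hi'.symm)
    simp only [mer, if_neg hri] at hr
    have := hu _ hr
    rw [← this] at hk'
    rcases hk' with h | h
    · exact hri h
    · exact Fin.succAbove_ne _ _ h
  · have hkj : k ≠ j := fun h => hk' (Or.inr h)
    have hki : k ≠ i := fun h => hk' (Or.inl h)
    obtain ⟨k', rfl⟩ := Fin.exists_succAbove_eq hkj
    refine ⟨k', by simpa [mer, hki] using hk, ?_⟩
    intro r hr
    by_cases hri : j.succAbove r = i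
    · simp only [mer, if_pos hri, h1, List.dropLast_concat] at hr
      exact absurd (hw hr) hk'
    · simp only [mer, if_neg hri] at hr
      exact Fin.succAbove_right_injective (hu _ hr)

theorem mer_bv {n : ℕ} {m l : Fin (n+1) → List Bool} (hm : Base m) (hl : Base l) {i j : Fin (n+1)}
    (hcm : Caret m i j) (hcl : Caret l i j) :
    bv hm hl = bv (mer_base hm hcm) (mer_base hl hcl) := by
  apply eq_bv
  obtain ⟨w, h1, h2⟩ := hcl
  obtain ⟨x, g1, g2⟩ := hcm
  intro k y
  simp only [mer]
  split_ifs with hk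
  · simp only [h1, g1, List.dropLast_concat]
    obtain ⟨b, z, rfl⟩ := exists_ycons y
    have e : ∀ u : List Bool, app u (ycons b z) = app (u ++ [b]) z := fun u => by
      rw [app_append]; rfl
    rw [e, e]
    cases b
    · rw [← h1, ← g1, bv_app]
    · rw [← h2, ← g2, bv_app]
  · rw [bv_app]

theorem bv_reindex {ι κ : Type} [Finite ι] [Finite κ] {m l : ι → List Bool} (hm : Base m) (hl : Base l)
    (e : κ ≃ ι) : bv (hm.comp e) (hl.comp e) = bv hm hl :=
  (eq_bv _ _ fun i y => by
    exact bv_app hm hl (e i) y).symm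

theorem SV_of_card {ι : Type} [Fintype ι] {m l : ι → List Bool} (hm : Base m) (hl : Base l) :
    bv hm hl ∈ SV (Fintype.card ι) := by
  rw [← bv_reindex hm hl (Fintype.equivFin ι).symm]
  exact bv_mem_SV _ _

/-- Expanding a code. -/
theorem expand {ι : Type} [Fintype ι] [DecidableEq ι] {l : ι → List Bool} (h : Base l) (i₀ : ι) :
    Base (fun o : Option ι => o.elim (l i₀ ++ [true])
      (fun i => if i = i₀ then l i₀ ++ [false] else l i)) := by
  have h0 : BaseOn (Finset.univ.erase none) (fun o : Option ι => o.elim [] l) := by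
    intro y
    obtain ⟨i, hi, hu⟩ := h y
    refine ⟨some i, ⟨by simp, hi⟩, ?_⟩
    rintro (_ | r) ⟨hr1, hr⟩
    · simp at hr1
    · rw [hu r hr]
  have h1 := h0.step (i := some i₀) (j := none) (by simp) (by simp)
  rw [Finset.insert_erase (Finset.mem_univ _)] at h1
  convert h1.base using 1
  funext o
  rcases o with _ | i
  · simp
  · by_cases hi : i = i₀
    · subst hi; simp
    · simp [hi]

theorem expand_bv {n : ℕ} (hn : 0 < n) {m l : Fin n → List Bool} (hm : Base m) (hl : Base l) :
    ∃ (m' l' : Fin (n+1) → List Bool) (hm' : Base m') (hl' : Base l') (i j : Fin (n+1)),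
      Caret m' i j ∧ Caret l' i j ∧ bv hm hl = bv hm' hl' := by
  let i₀ : Fin n := ⟨0, hn⟩
  let e : Fin (n+1) ≃ Option (Fin n) := Fintype.equivOfCardEq (by simp)
  refine ⟨_, _, (expand hm i₀).comp e, (expand hl i₀).comp e, e.symm (some i₀), e.symm none, ?_, ?_, ?_⟩
  · exact ⟨m i₀, by simp, by simp⟩
  · exact ⟨l i₀, by simp, by simp⟩
  · rw [bv_reindex (expand hm i₀) (expand hl i₀)]
    apply eq_bv
    rintro (_ | i) y
    · simp only [Option.elim, app_append, bv_app]
    · simp only [Option.elim]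
      split_ifs with h
      · subst h; simp only [app_append, bv_app]
      · simp only [bv_app]

theorem three_carets {n : ℕ} (i₁ j₁ i₂ j₂ i₃ j₃ : Fin n)
    (hd : [i₁, j₁, i₂, j₂, i₃, j₃].Nodup) :
    ∃ l, Base l ∧ Caret l i₁ j₁ ∧ Caret l i₂ j₂ ∧ Caret l i₃ j₃ := by
  simp only [List.nodup_cons, List.mem_cons, not_or, List.not_mem_nil, not_false_eq_true,
    List.nodup_nil, and_true] at hd
  obtain ⟨l, hl⟩ := exists_baseOn ((((Finset.univ.erase j₁).erase j₂).erase j₃) : Finset (Fin n))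
    ⟨i₁, by simp; grind⟩
  have h1 := hl.step (i := i₃) (j := j₃) (by simp; grind) (by simp)
  rw [Finset.insert_erase (by simp; grind)] at h1
  have h2 := h1.step (i := i₂) (j := j₂) (by simp; grind) (by simp)
  rw [Finset.insert_erase (by simp; grind)] at h2
  have h3 := h2.step (i := i₁) (j := j₁) (by simp; grind) (by simp)
  rw [Finset.insert_erase (by simp)] at h3
  refine ⟨_, h3.base, ?_, ?_, ?_⟩
  · exact ⟨l i₁, by simp only [Function.update_apply]; grind, by simp only [Function.update_apply]; grind⟩
  · exact ⟨l i₂, by simp only [Function.update_apply]; grind, by simp only [Function.update_apply]; grind⟩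
  · exact ⟨l i₃, by simp only [Function.update_apply]; grind, by simp only [Function.update_apply]; grind⟩

end HE

namespace HE

/-- Partial multiplicativity of `f` on codes of size `n`. -/
def Coc {H : Type*} [Group H] (n : ℕ) (f : V → H) : Prop :=
  ∀ (c b a : Fin n → List Bool) (hc : Base c) (hb : Base b) (ha : Base a),
    f (bv hc ha) = f (bv hc hb) * f (bv hb ha)

theorem preserve {ι : Type} [Finite ι] {m l : ι → List Bool} (hl : Base l) {v : V}
    (hv : ∀ i y, v.1 (app (l i) y) = app (m i) y) (a b : List Bool)
    (hab : ∀ y, v.1 (app a y) = app b y) (i₀ : ι) (ha : a <+: l i₀) (hlt : a.length < (l i₀).length) :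
    ∃ i j, Caret l i j ∧ Caret m i j := by
  obtain ⟨i, j, w, h1, h2⟩ := hl.caret a i₀ ha hlt
  refine ⟨i, j, ⟨a ++ w, h1, h2⟩, ⟨b ++ w, ?_, ?_⟩⟩
  · apply eq_of_app_eq
    intro y
    rw [← hv, h1, List.append_assoc, List.append_assoc, app_append, hab, ← app_append]
  · apply eq_of_app_eq
    intro y
    rw [← hv, h2, List.append_assoc, List.append_assoc, app_append, hab, ← app_append]

theorem relabel_of_no_caret {n : ℕ} {m l m' l' : Fin n → List Bool} (hm : Base m) (hl : Base l)
    (hm' : Base m') (hl' : Base l') (he : bv hm hl = bv hm' hl')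
    (hno : ¬ ∃ i j, Caret l i j ∧ Caret m i j) :
    ∃ σ : Equiv.Perm (Fin n), l' = l ∘ σ ∧ m' = m ∘ σ := by
  have key : ∀ j, ∃ i, l i <+: l' j := by
    intro j
    obtain ⟨i, hi, -⟩ := hl (app (l' j) fun _ => true)
    refine ⟨i, pre_cmp hi (pre_app _ _) ?_⟩
    by_contra hc
    apply hno
    refine preserve hl (bv_app hm hl) (l' j) (m' j) ?_ i (pre_cmp (pre_app _ _) hi (by omega)) (by omega)
    intro y
    rw [he, bv_app]
  choose g hg using key
  have gs : Function.Surjective g := by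
    intro i
    obtain ⟨j, hj, -⟩ := hl' (app (l i) fun _ => true)
    exact ⟨j, (hl _).unique (pre_of_pfx (hg j) hj) (pre_app _ _)⟩
  have gi := Finite.injective_iff_surjective.2 gs
  have e1 : l' = l ∘ g := by
    funext j
    by_contra hne
    have hlt : (l (g j)).length < (l' j).length := by
      rcases (hg j).length_le.lt_or_eq with h | h
      · exact h
      · exact absurd ((hg j).eq_of_length h).symm hne
    obtain ⟨i, k, w, h1, h2⟩ := hl'.caret _ j (hg j) hlt
    have aux : ∀ r, l (g j) <+: l' r → g r = g j := fun r hr =>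
      (hl (app (l' r) fun _ => true)).unique (pre_of_pfx (hg r) (pre_app _ _))
        (pre_of_pfx hr (pre_app _ _))
    have e1 := aux i ⟨w ++ [false], by rw [h1]; simp⟩
    have e2 := aux k ⟨w ++ [true], by rw [h2]; simp⟩
    have := gi (e1.trans e2.symm)
    subst this
    rw [h1] at h2; simp at h2
  refine ⟨Equiv.ofBijective g ⟨gi, gs⟩, e1, ?_⟩
  funext j
  apply eq_of_app_eq
  intro y
  rw [← bv_app hm' hl', ← he, e1]
  exact bv_app hm hl (g j) y

theorem ext_step {H : Type*} [Group H] (n : ℕ) (hn : 12 ≤ n + 1) :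
    (∀ (m l : Fin (n+1) → List Bool) (hm : Base m) (hl : Base l),
      ∃ a ∈ SV n, ∃ b ∈ SV n, ∃ c ∈ SV n, bv hm hl = a * b * c) ∧
    ∀ (f : V → H) (hf : Coc n f), ∃ f' : V → H, Coc (n+1) f' ∧ ∀ v ∈ SV n, f' v = f v := by
  classical
  let O := {l : Fin (n+1) → List Bool // Base l}
  let Q := {q : Fin (n+1) × Fin (n+1) // q.1 ≠ q.2}
  let L : Q → Set O := fun q => {l | Caret l.1 q.1.1 q.1.2}
  let orth : Q → Q → Prop := fun q r => [q.1.1, q.1.2, r.1.1, r.1.2].Nodup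
  have hsym : ∀ q r, orth q r → orth r q := by
    rintro ⟨⟨a, b⟩, h1⟩ ⟨⟨c, d⟩, h2⟩ h
    simp only [orth, List.nodup_cons, List.mem_cons, not_or, List.not_mem_nil, not_false_eq_true,
      List.nodup_nil, and_true] at h ⊢
    grind
  have h1 : ∀ l, ∃ q, l ∈ L q := by
    rintro ⟨l, hl⟩
    have : ∃ i, 0 < (l i).length := by
      by_contra hc
      push Not at hc
      have e : l 0 = l 1 := by
        rw [List.eq_nil_of_length_eq_zero (Nat.le_zero.1 (hc 0)),
          List.eq_nil_of_length_eq_zero (Nat.le_zero.1 (hc 1))]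
      have := hl.inj e
      have := congrArg Fin.val this
      simp at this
      omega
    obtain ⟨i, hi⟩ := this
    obtain ⟨i, j, w, h1, h2⟩ := hl.caret [] i (by simp) hi
    have hc : Caret l i j := ⟨w, by simpa using h1, by simpa using h2⟩
    exact ⟨⟨(i, j), hc.ne⟩, hc⟩
  have h2 : ∀ l q r, l ∈ L q → l ∈ L r → q = r ∨ orth q r := by
    rintro ⟨l, hl⟩ ⟨⟨i, j⟩, h1⟩ ⟨⟨i', j'⟩, h2⟩ ⟨w, c1, c2⟩ ⟨w', c1', c2'⟩
    simp only at c1 c2 c1' c2' h1 h2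
    have d1 : i ≠ j' := by rintro rfl; rw [c1] at c2'; simp at c2'
    have d2 : j ≠ i' := by rintro rfl; rw [c2] at c1'; simp at c1'
    have inj := hl.inj
    by_cases hw : w = w'
    · left
      subst hw
      rw [← c1'] at c1
      rw [← c2'] at c2
      exact Subtype.ext (Prod.ext (inj c1) (inj c2))
    · right
      have d3 : i ≠ i' := by rintro rfl; rw [c1] at c1'; simp at c1'; exact hw c1'
      have d4 : j ≠ j' := by rintro rfl; rw [c2] at c2'; simp at c2'; exact hw c2'
      simp only [orth, List.nodup_cons, List.mem_cons, not_or, List.not_mem_nil, not_false_eq_true,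
        List.nodup_nil, and_true]
      exact ⟨⟨h1, d3, d1⟩, ⟨d2, d4⟩, h2⟩
  have h3 : ∀ q r s, orth q r → orth q s → orth r s → ∃ n, n ∈ L q ∧ n ∈ L r ∧ n ∈ L s := by
    rintro ⟨⟨a, b⟩, g1⟩ ⟨⟨c, d⟩, g2⟩ ⟨⟨e, f⟩, g3⟩ o1 o2 o3
    obtain ⟨l, hl, k1, k2, k3⟩ := three_carets a b c d e f (by
      simp only [orth, List.nodup_cons, List.mem_cons, not_or, List.not_mem_nil, not_false_eq_true,
        List.nodup_nil, and_true] at o1 o2 o3 ⊢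
      grind)
    exact ⟨⟨l, hl⟩, k1, k2, k3⟩
  have h4 : ∀ q r s t w, ∃ u, orth u q ∧ orth u r ∧ orth u s ∧ orth u t ∧ orth u w := by
    rintro ⟨⟨a1, b1⟩, g1⟩ ⟨⟨a2, b2⟩, g2⟩ ⟨⟨a3, b3⟩, g3⟩ ⟨⟨a4, b4⟩, g4⟩ ⟨⟨a5, b5⟩, g5⟩
    have hc : ({a1, b1, a2, b2, a3, b3, a4, b4, a5, b5} : Finset (Fin (n+1))).card ≤ 10 := by
      have := List.toFinset_card_le [a1, b1, a2, b2, a3, b3, a4, b4, a5, b5]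
      simpa using this
    have hc2 : 1 < (({a1, b1, a2, b2, a3, b3, a4, b4, a5, b5} : Finset (Fin (n+1)))ᶜ).card := by
      rw [Finset.card_compl, Fintype.card_fin]; omega
    obtain ⟨x, hx, y, hy, hxy⟩ := Finset.one_lt_card.1 hc2
    refine ⟨⟨(x, y), hxy⟩, ?_⟩
    simp only [Finset.mem_compl, Finset.mem_insert, Finset.mem_singleton, not_or] at hx hy
    simp only [orth, List.nodup_cons, List.mem_cons, not_or, List.not_mem_nil, not_false_eq_true,
        List.nodup_nil, and_true]
    simp only at g1 g2 g3 g4 g5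
    refine ⟨?_, ?_, ?_, ?_, ?_⟩ <;> grind
  have G := fun (E : O → O → H) hE => glue L orth hsym h1 h2 h3 h4 E hE
  have chain : ∀ l m, ∃ n n' q s r, l ∈ L q ∧ n ∈ L q ∧ n ∈ L s ∧ n' ∈ L s ∧ n' ∈ L r ∧ m ∈ L r :=
    (G (fun _ _ => 1) (by simp)).2
  have inS : ∀ q (m l : O), m ∈ L q → l ∈ L q → bv m.2 l.2 ∈ SV n := by
    intro q m l hm hl
    rw [mer_bv m.2 l.2 hm hl]; exact bv_mem_SV _ _
  constructor
  · intro m l hm hl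
    obtain ⟨x, x', q, s, r, c1, c2, c3, c4, c5, c6⟩ := chain ⟨l, hl⟩ ⟨m, hm⟩
    refine ⟨_, inS r ⟨m, hm⟩ x' c6 c5, _, inS s x' x c4 c3, _, inS q x ⟨l, hl⟩ c2 c1, ?_⟩
    rw [bv_mul, bv_mul]
  intro f hf
  let E : O → O → H := fun m l => f (bv m.2 l.2)
  have hE : ∀ q, ∀ n ∈ L q, ∀ m ∈ L q, ∀ l ∈ L q, E n l = E n m * E m l := by
    intro q c hc b hb a ha
    simp only [E]
    rw [mer_bv c.2 a.2 hc ha, mer_bv c.2 b.2 hc hb, mer_bv b.2 a.2 hb ha]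
    apply hf
  obtain ⟨⟨h, hh⟩, -⟩ := G E hE
  have hch : ∀ l m : O, ∃ x x' : O, h m * (h l)⁻¹ = E m x' * E x' x * E x l ∧
      ∀ σ : Equiv.Perm (Fin (n+1)), h ⟨m.1 ∘ σ, m.2.comp σ⟩ * (h ⟨l.1 ∘ σ, l.2.comp σ⟩)⁻¹ =
        E m x' * E x' x * E x l := by
    intro l m
    obtain ⟨x, x', q, s, r, c1, c2, c3, c4, c5, c6⟩ := chain l m
    refine ⟨x, x', ?_, ?_⟩
    · rw [hh r x' c5 m c6, hh s x c3 x' c4, hh q l c1 x c2]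
      simp [mul_assoc]
    · intro σ
      let R : O → O := fun l => ⟨l.1 ∘ σ, l.2.comp σ⟩
      let T : Q → Q := fun q => ⟨(σ.symm q.1.1, σ.symm q.1.2), fun h => q.2 (σ.symm.injective h)⟩
      have hT : ∀ q l, l ∈ L q → R l ∈ L (T q) := by
        rintro q l ⟨w, w1, w2⟩
        exact ⟨w, by simpa [R, T] using w1, by simpa [R, T] using w2⟩
      have hER : ∀ m l, E (R m) (R l) = E m l := by
        intro m l
        exact congrArg f (bv_reindex m.2 l.2 σ)
      change h (R m) * (h (R l))⁻¹ = _
      rw [hh (T r) (R x') (hT _ _ c5) (R m) (hT _ _ c6), hh (T s) (R x) (hT _ _ c3) (R x') (hT _ _ c4),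
        hh (T q) (R l) (hT _ _ c1) (R x) (hT _ _ c2), hER, hER, hER]
      simp [mul_assoc]
  have indep : ∀ m l m' l' : O, bv m.2 l.2 = bv m'.2 l'.2 →
      h m * (h l)⁻¹ = h m' * (h l')⁻¹ := by
    have car : ∀ m l : O, (∃ i j, Caret l.1 i j ∧ Caret m.1 i j) →
        h m * (h l)⁻¹ = f (bv m.2 l.2) := by
      rintro m l ⟨i, j, c1, c2⟩
      rw [hh ⟨(i, j), c1.ne⟩ l c1 m c2]
      simp [E]
    have nocar : ∀ m l m' l' : O, bv m.2 l.2 = bv m'.2 l'.2 →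
        (¬ ∃ i j, Caret l.1 i j ∧ Caret m.1 i j) → h m * (h l)⁻¹ = h m' * (h l')⁻¹ := by
      rintro m l ⟨m', hm'⟩ ⟨l', hl'⟩ he hno
      obtain ⟨σ, e1, e2⟩ := relabel_of_no_caret m.2 l.2 hm' hl' he hno
      subst e1; subst e2
      obtain ⟨x, x', k1, k2⟩ := hch l m
      rw [k1, k2 σ]
    intro m l m' l' he
    by_cases k1 : ∃ i j, Caret l.1 i j ∧ Caret m.1 i j
    · by_cases k2 : ∃ i j, Caret l'.1 i j ∧ Caret m'.1 i j
      · rw [car m l k1, car m' l' k2, he]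
      · exact (nocar m' l' m l he.symm k2).symm
    · exact nocar m l m' l' he k1
  let f' : V → H := fun v => if hv : ∃ m l : O, v = bv m.2 l.2 then
    h hv.choose * (h hv.choose_spec.choose)⁻¹ else 1
  have hf' : ∀ m l : O, f' (bv m.2 l.2) = h m * (h l)⁻¹ := by
    intro m l
    have hv : ∃ m' l' : O, bv m.2 l.2 = bv m'.2 l'.2 := ⟨m, l, rfl⟩
    simp only [f', dif_pos hv]
    exact (indep _ _ _ _ hv.choose_spec.choose_spec).symm
  refine ⟨f', ?_, ?_⟩
  · intro c b a hc hb ha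
    rw [hf' ⟨c, hc⟩ ⟨a, ha⟩, hf' ⟨c, hc⟩ ⟨b, hb⟩, hf' ⟨b, hb⟩ ⟨a, ha⟩]
    group
  · rintro v ⟨m, l, hm, hl, hv⟩
    rw [eq_bv hm hl hv]
    obtain ⟨m', l', hm', hl', i, j, c1, c2, e⟩ := expand_bv (by omega) hm hl
    rw [e, hf' ⟨m', hm'⟩ ⟨l', hl'⟩, hh ⟨(i, j), c1.ne⟩ ⟨l', hl'⟩ c2 ⟨m', hm'⟩ c1]
    simp [E]

end HE

namespace HE

abbrev Wd (M : ℕ) := List.Vector Bool M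

theorem full_base (M : ℕ) : Base (fun w : Wd M => w.1) := by
  intro y
  obtain ⟨α, z, h, rfl⟩ := app_split M y
  refine ⟨⟨α, h⟩, pre_app _ _, ?_⟩
  rintro ⟨β, hβ⟩ hp
  apply Subtype.ext
  exact (pre_cmp hp (pre_app _ _) (by simp [h, hβ])).eq_of_length (by simp [h, hβ])

theorem V_depth (v : V) : ∃ N, ∀ α : List Bool, N ≤ α.length → ∃ β, ∀ y, v.1 (app α y) = app β y := by
  obtain ⟨N, hN⟩ := v.2
  refine ⟨N, fun α hα => ?_⟩
  obtain ⟨β, hβ⟩ := hN (α.take N) (by simp [hα])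
  refine ⟨β ++ α.drop N, fun y => ?_⟩
  rw [app_append, ← hβ, ← app_append, List.take_append_drop]

theorem V_depth2 (v : V) (K : ℕ) : ∃ N, ∀ α : List Bool, N ≤ α.length →
    ∃ β, K ≤ β.length ∧ ∀ y, v.1 (app α y) = app β y := by
  obtain ⟨N, hN⟩ := V_depth v
  refine ⟨N + K, fun α hα => ?_⟩
  obtain ⟨β, hβ⟩ := hN (α.take N) (by simp; omega)
  refine ⟨β ++ α.drop N, by simp; omega, fun y => ?_⟩
  rw [app_append, ← hβ, ← app_append, List.take_append_drop]

theorem V_factor (a b : V) : ∃ M0, ∀ M, M0 ≤ M → ∃ (ν β : Wd M → List Bool) (hν : Base ν) (hβ : Base β),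
    b = bv hβ (full_base M) ∧ a = bv hν hβ := by
  obtain ⟨K, hK⟩ := V_depth a
  obtain ⟨N, hN⟩ := V_depth2 b K
  refine ⟨N, fun M hM => ?_⟩
  have : ∀ w : Wd M, ∃ β, K ≤ β.length ∧ ∀ y, b.1 (app w.1 y) = app β y := fun w => hN _ (by rw [w.2]; exact hM)
  choose β hβ1 hβ2 using this
  choose ν hν using fun w => hK (β w) (hβ1 w)
  have B1 := (full_base M).map b β hβ2
  have B2 := B1.map a ν hν
  exact ⟨ν, β, B2, B1, eq_bv _ _ hβ2, eq_bv _ _ hν⟩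

theorem SV_succ {n : ℕ} (hn : 0 < n) : SV n ⊆ SV (n+1) := by
  rintro v ⟨m, l, hm, hl, hv⟩
  rw [eq_bv hm hl hv]
  obtain ⟨m', l', hm', hl', i, j, c1, c2, e⟩ := expand_bv hn hm hl
  rw [e]; exact bv_mem_SV _ _

theorem SV_mono {n m : ℕ} (hn : 0 < n) (h : n ≤ m) : SV n ⊆ SV m := by
  induction m, h using Nat.le_induction with
  | base => exact subset_rfl
  | succ m h ih => exact ih.trans (SV_succ (by omega))

theorem card_Wd (M : ℕ) : Fintype.card (Wd M) = 2 ^ M := by simp [Wd, card_vector]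

theorem exists_SV (v : V) : ∃ k, v ∈ SV (12 + k) := by
  obtain ⟨M, hM⟩ := V_factor 1 v
  obtain ⟨ν, β, hν, hβ, h1, h2⟩ := hM (M + 4) (by omega)
  have := SV_of_card hβ (full_base _)
  rw [← h1, card_Wd] at this
  refine ⟨2 ^ (M+4) - 12, ?_⟩
  rwa [Nat.add_sub_cancel']
  calc 12 ≤ 2 ^ 4 := by norm_num
    _ ≤ _ := Nat.pow_le_pow_right (by norm_num) (by omega)

theorem closure_SV : Subgroup.closure (SV 12) = ⊤ := by
  have : ∀ k, SV (12 + k) ⊆ Subgroup.closure (SV 12) := by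
    intro k
    induction k with
    | zero => exact Subgroup.subset_closure
    | succ k ih =>
      rintro v ⟨m, l, hm, hl, hv⟩
      rw [eq_bv hm hl hv]
      obtain ⟨a, ha, b, hb, c, hc, e⟩ := (ext_step (H := V) (12 + k) (by omega)).1 m l hm hl
      rw [e]
      exact mul_mem (mul_mem (ih ha) (ih hb)) (ih hc)
  rw [eq_top_iff]
  intro v _
  obtain ⟨k, hk⟩ := exists_SV v
  exact this k hk

theorem V_fp : Group.IsFinitelyPresented V := by
  classical
  refine fp_of_partialHom (SV 12) (SV_finite 12) closure_SV ?_
  intro H _ f hf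
  have c0 : Coc 12 f := by
    intro c b a hc hb ha
    rw [← bv_mul hc hb ha]
    exact hf _ (bv_mem_SV _ _) _ (bv_mem_SV _ _) (by rw [bv_mul]; exact bv_mem_SV _ _)
  have step : ∀ k (g : {g : V → H // Coc (12 + k) g}), ∃ g' : {g : V → H // Coc (12 + (k+1)) g},
      ∀ v ∈ SV (12 + k), g'.1 v = g.1 v := by
    rintro k ⟨g, hg⟩
    obtain ⟨g', h1, h2⟩ := (ext_step (H := H) (12 + k) (by omega)).2 g hg
    exact ⟨⟨g', h1⟩, h2⟩
  choose st hst using step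
  let F : ∀ k, {g : V → H // Coc (12 + k) g} := fun k => Nat.rec ⟨f, c0⟩ (fun k g => st k g) k
  have hF : ∀ k, ∀ v ∈ SV (12 + k), (F (k+1)).1 v = (F k).1 v := fun k v hv => hst k (F k) v hv
  have hF2 : ∀ k j v, v ∈ SV (12 + k) → (F (k+j)).1 v = (F k).1 v := by
    intro k j v hv
    induction j with
    | zero => rfl
    | succ j ih => rw [← ih]; exact hF (k+j) v (SV_mono (by omega) (by omega) hv)
  let φ : V → H := fun v => (F (Nat.find (exists_SV v))).1 v
  have hφ : ∀ k v, v ∈ SV (12 + k) → φ v = (F k).1 v := by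
    intro k v hv
    have h1 := Nat.find_spec (exists_SV v)
    have h2 := Nat.find_min' (exists_SV v) hv
    obtain ⟨j, hj⟩ := Nat.exists_eq_add_of_le h2
    rw [hj, hF2 _ _ _ h1]
  refine ⟨MonoidHom.mk' φ ?_, fun a ha => hφ 0 a ha⟩
  intro a b
  obtain ⟨M, hM⟩ := V_factor a b
  obtain ⟨ν, β, hν, hβ, h1, h2⟩ := hM (M + 4) (by omega)
  have h12 : 12 ≤ 2 ^ (M+4) := by
    calc 12 ≤ 2 ^ 4 := by norm_num
      _ ≤ _ := Nat.pow_le_pow_right (by norm_num) (by omega)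
  obtain ⟨k, hk⟩ := Nat.exists_eq_add_of_le h12
  let e : Fin (12 + k) ≃ Wd (M+4) := Fintype.equivOfCardEq (by rw [card_Wd, Fintype.card_fin, hk])
  rw [h1, h2, bv_mul, ← bv_reindex hν hβ e, ← bv_reindex hβ (full_base _) e,
    ← bv_reindex hν (full_base _) e, hφ k _ (bv_mem_SV _ _), hφ k _ (bv_mem_SV _ _), hφ k _ (bv_mem_SV _ _)]
  exact (F k).2 _ _ _ _ _ _

end HE

namespace HE
open Classical
open scoped commutatorElement

/-- Incomparable words. -/
def Inc (α β : List Bool) : Prop := ¬ α <+: β ∧ ¬ β <+: α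

theorem Inc.symm {α β : List Bool} (h : Inc α β) : Inc β α := ⟨h.2, h.1⟩

theorem Inc.not_pre {α β : List Bool} (h : Inc α β) (y : Y) : ¬ Pre β (app α y) := by
  intro hp
  rcases le_total α.length β.length with hl | hl
  · exact h.1 (pre_cmp (pre_app _ _) hp hl)
  · exact h.2 (pre_cmp hp (pre_app _ _) hl)

theorem inc_of {α β : List Bool} (h : ∀ y z, app α y ≠ app β z) : Inc α β := by
  constructor
  · rintro ⟨γ, rfl⟩
    exact h (app γ fun _ => true) (fun _ => true) (by rw [app_append])
  · rintro ⟨γ, rfl⟩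
    exact h (fun _ => true) (app γ fun _ => true) (by rw [app_append])

theorem Inc.ne {α β : List Bool} (h : Inc α β) (y z : Y) : app α y ≠ app β z := fun e =>
  h.not_pre y ⟨z, e⟩

theorem Inc.append {α β : List Bool} (h : Inc α β) (γ γ' : List Bool) : Inc (α ++ γ) (β ++ γ') :=
  inc_of fun y z e => h.ne _ _ (by rwa [app_append, app_append] at e)

theorem Inc.prep {α β : List Bool} (h : Inc α β) (γ : List Bool) : Inc (γ ++ α) (γ ++ β) :=
  inc_of fun y z e => h.ne y z (by rw [app_append, app_append] at e; exact app_inj e)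

theorem inc_cons {b c : Bool} (h : b ≠ c) (α β : List Bool) : Inc (b :: α) (c :: β) :=
  inc_of fun y z e => h (ycons_inj e).1

theorem Inc.map {α β α' β' : List Bool} (h : Inc α β) (g : V) (h1 : ∀ y, g.1 (app α y) = app α' y)
    (h2 : ∀ y, g.1 (app β y) = app β' y) : Inc α' β' :=
  inc_of fun y z e => h.ne y z (by rw [← h1, ← h2] at e; exact g.1.injective e)

noncomputable def trf (α β : List Bool) (y : Y) : Y :=
  if h : Pre α y then app β h.choose else if h : Pre β y then app α h.choose else y

theorem trf_l (α β : List Bool) (y : Y) : trf α β (app α y) = app β y := by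
  have h : Pre α (app α y) := pre_app _ _
  rw [trf, dif_pos h, ← app_inj h.choose_spec]

theorem trf_r {α β : List Bool} (hi : Inc α β) (y : Y) : trf α β (app β y) = app α y := by
  have h : Pre β (app β y) := pre_app _ _
  rw [trf, dif_neg (hi.symm.not_pre y), dif_pos h, ← app_inj h.choose_spec]

theorem trf_o {α β : List Bool} {y : Y} (h1 : ¬ Pre α y) (h2 : ¬ Pre β y) : trf α β y = y := by
  rw [trf, dif_neg h1, dif_neg h2]

theorem trf_inv {α β : List Bool} (hi : Inc α β) : Function.Involutive (trf α β) := by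
  intro y
  by_cases h1 : Pre α y
  · obtain ⟨z, rfl⟩ := h1; rw [trf_l, trf_r hi]
  by_cases h2 : Pre β y
  · obtain ⟨z, rfl⟩ := h2; rw [trf_r hi, trf_l]
  rw [trf_o h1 h2, trf_o h1 h2]

/-- The swap of two incomparable cones. -/
noncomputable def tr (α β : List Bool) : V :=
  if hi : Inc α β then ⟨(trf_inv hi).toPerm, max α.length β.length, fun w hw => by
    change ∃ β', ∀ y, trf α β (app w y) = app β' y
    by_cases h1 : α <+: w
    · obtain ⟨γ, rfl⟩ := h1
      exact ⟨β ++ γ, fun y => by rw [app_append, trf_l, app_append]⟩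
    by_cases h2 : β <+: w
    · obtain ⟨γ, rfl⟩ := h2
      exact ⟨α ++ γ, fun y => by rw [app_append, trf_r hi, app_append]⟩
    exact ⟨w, fun y => trf_o (fun h => h1 (pre_cmp h (pre_app _ _) (by omega)))
      (fun h => h2 (pre_cmp h (pre_app _ _) (by omega)))⟩⟩ else 1

theorem tr_l {α β : List Bool} (hi : Inc α β) (y : Y) : (tr α β).1 (app α y) = app β y := by
  rw [tr, dif_pos hi]; exact trf_l _ _ _

theorem tr_r {α β : List Bool} (hi : Inc α β) (y : Y) : (tr α β).1 (app β y) = app α y := by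
  rw [tr, dif_pos hi]; exact trf_r hi _

theorem tr_o {α β : List Bool} {y : Y} (h1 : ¬ Pre α y) (h2 : ¬ Pre β y) : (tr α β).1 y = y := by
  by_cases hi : Inc α β
  · rw [tr, dif_pos hi]; exact trf_o h1 h2
  · rw [tr, dif_neg hi]; rfl

theorem eq_tr {α β : List Bool} (hi : Inc α β) {v : V} (h1 : ∀ y, v.1 (app α y) = app β y)
    (h2 : ∀ y, v.1 (app β y) = app α y) (h3 : ∀ y, ¬ Pre α y → ¬ Pre β y → v.1 y = y) : v = tr α β := by
  apply V_ext
  intro y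
  by_cases k1 : Pre α y
  · obtain ⟨z, rfl⟩ := k1; rw [h1, tr_l hi]
  by_cases k2 : Pre β y
  · obtain ⟨z, rfl⟩ := k2; rw [h2, tr_r hi]
  rw [h3 _ k1 k2, tr_o k1 k2]

theorem tr_comm (α β : List Bool) : tr α β = tr β α := by
  by_cases hi : Inc α β
  · exact eq_tr hi.symm (tr_r hi) (tr_l hi) fun y h1 h2 => tr_o h2 h1
  · rw [tr, tr, dif_neg hi, dif_neg fun h => hi h.symm]

theorem tr_mul_self (α β : List Bool) : tr α β * tr α β = 1 := by
  by_cases hi : Inc α β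
  · apply V_ext; intro y
    rw [V_mul, V_one, tr, dif_pos hi]
    exact trf_inv hi y
  · rw [tr, dif_neg hi]; simp

theorem tr_inv (α β : List Bool) : (tr α β)⁻¹ = tr α β := inv_eq_of_mul_eq_one_left (tr_mul_self _ _)

theorem tr_conj {α β α' β' : List Bool} (hi : Inc α β) (g : V) (h1 : ∀ y, g.1 (app α y) = app α' y)
    (h2 : ∀ y, g.1 (app β y) = app β' y) : g * tr α β * g⁻¹ = tr α' β' := by
  refine eq_tr (hi.map g h1 h2) ?_ ?_ ?_
  · intro y
    rw [V_mul, V_mul, V_inv_eq (h1 y), tr_l hi, h2]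
  · intro y
    rw [V_mul, V_mul, V_inv_eq (h2 y), tr_r hi, h1]
  · intro y k1 k2
    rw [V_mul, V_mul, tr_o, V_app_inv]
    · rintro ⟨z, hz⟩; exact k1 ⟨z, by rw [← h1, ← hz, V_app_inv]⟩
    · rintro ⟨z, hz⟩; exact k2 ⟨z, by rw [← h2, ← hz, V_app_inv]⟩

theorem not_pre_of_inc {α β : List Bool} (h : Inc α β) {y : Y} (hy : Pre α y) : ¬ Pre β y := by
  obtain ⟨z, rfl⟩ := hy; exact h.not_pre z

theorem tr_fix {α β γ : List Bool} (h1 : Inc γ α) (h2 : Inc γ β) (y : Y) :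
    (tr α β).1 (app γ y) = app γ y := tr_o (h1.not_pre y) (h2.not_pre y)

theorem inc_ft : Inc [false] [true] := inc_cons (by simp) _ _

theorem tr_split {α β : List Bool} (hi : Inc α β) :
    tr α β = tr (α ++ [false]) (β ++ [false]) * tr (α ++ [true]) (β ++ [true]) := by
  have i1 := hi.append [false] [false]
  have i2 := hi.append [true] [true]
  have i3 := hi.append [false] [true]
  have i4 := hi.append [true] [false]
  have i5 := inc_ft.prep α
  have i6 := inc_ft.prep β
  symm
  apply eq_tr hi
  · intro y
    obtain ⟨b, z, rfl⟩ := exists_ycons y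
    have e1 : ∀ w, app w (ycons b z) = app (w ++ [b]) z := fun w => by rw [app_append]; rfl
    rw [e1, e1, V_mul]
    cases b
    · rw [tr_fix i5 i3, tr_l i1]
    · rw [tr_l i2, tr_fix i3.symm i6.symm]
  · intro y
    obtain ⟨b, z, rfl⟩ := exists_ycons y
    have e1 : ∀ w, app w (ycons b z) = app (w ++ [b]) z := fun w => by rw [app_append]; rfl
    rw [e1, e1, V_mul]
    cases b
    · rw [tr_fix i4.symm i6, tr_r i1]
    · rw [tr_r i2, tr_fix i5.symm i4]
  · intro y h1 h2
    rw [V_mul, tr_o, tr_o] <;> first | exact fun h => h1 (pre_append h) | exact fun h => h2 (pre_append h) | skip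
    · rw [tr_o] <;> first | exact fun h => h1 (pre_append h) | exact fun h => h2 (pre_append h)
    · rw [tr_o] <;> first | exact fun h => h1 (pre_append h) | exact fun h => h2 (pre_append h)

/-! Generation by swaps. -/

def trSet : Set V := {v | ∃ α β, Inc α β ∧ v = tr α β}

theorem base_inc {ι : Type} {l : ι → List Bool} (h : Base l) {i j : ι} (hij : i ≠ j) : Inc (l i) (l j) :=
  ⟨fun hc => hij (h.eq_of_pfx hc), fun hc => hij (h.eq_of_pfx hc).symm⟩

theorem bv_swap {n : ℕ} {m : Fin n → List Bool} (hm : Base m) {i j : Fin n} (hij : i ≠ j) :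
    bv (hm.comp (Equiv.swap i j)) hm = tr (m i) (m j) := by
  have hi := base_inc hm hij
  apply eq_tr hi
  · intro y; rw [bv_app]; simp
  · intro y; rw [bv_app]; simp
  · intro y h1 h2
    obtain ⟨k, ⟨z, rfl⟩, -⟩ := hm y
    have k1 : k ≠ i := by rintro rfl; exact h1 (pre_app _ _)
    have k2 : k ≠ j := by rintro rfl; exact h2 (pre_app _ _)
    rw [bv_app]; simp [Equiv.swap_apply_of_ne_of_ne k1 k2]

theorem bv_perm_mem {n : ℕ} {m : Fin n → List Bool} (hm : Base m) (σ : Equiv.Perm (Fin n)) :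
    bv (hm.comp σ) hm ∈ Subgroup.closure trSet := by
  induction σ using Equiv.Perm.swap_induction_on with
  | one =>
    have : bv (hm.comp (1 : Equiv.Perm (Fin n))) hm = 1 := bv_self hm
    rw [this]; exact one_mem _
  | swap_mul f x y hxy ih =>
    have : bv (hm.comp (Equiv.swap x y * f)) hm =
        bv (hm.comp (Equiv.swap x y)) hm * bv (hm.comp f) hm := by
      rw [← bv_reindex (hm.comp (Equiv.swap x y)) hm f, bv_mul]; rfl
    rw [this]
    refine mul_mem (Subgroup.subset_closure ?_) ih
    rw [bv_swap hm hxy]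
    exact ⟨_, _, base_inc hm hxy, rfl⟩

theorem exists_caret {n : ℕ} (hn : 2 ≤ n) {l : Fin n → List Bool} (hl : Base l) : ∃ i j, Caret l i j := by
  have : ∃ i, 0 < (l i).length := by
    by_contra hc
    push Not at hc
    have e : l ⟨0, by omega⟩ = l ⟨1, by omega⟩ := by
      rw [List.eq_nil_of_length_eq_zero (Nat.le_zero.1 (hc _)),
        List.eq_nil_of_length_eq_zero (Nat.le_zero.1 (hc _))]
    have := congrArg Fin.val (hl.inj e)
    simp at this
  obtain ⟨i, hi⟩ := this
  obtain ⟨i, j, w, h1, h2⟩ := hl.caret [] i (by simp) hi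
  exact ⟨i, j, w, by simpa using h1, by simpa using h2⟩

theorem bv_mem_closure {n : ℕ} {m l : Fin n → List Bool} (hm : Base m) (hl : Base l) :
    bv hm hl ∈ Subgroup.closure trSet := by
  induction n with
  | zero => obtain ⟨i, -⟩ := hm (fun _ => true); exact i.elim0
  | succ n ih =>
    rcases Nat.eq_zero_or_pos n with h0 | hpos
    · subst h0
      have key : ∀ l : Fin 1 → List Bool, Base l → l = fun _ => [] := by
        intro l hl
        by_contra hc
        have : 0 < (l 0).length := by
          rw [List.length_pos_iff]; intro h; apply hc; funext i; rw [Subsingleton.elim i 0, h]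
        obtain ⟨i, j, w, h1, h2⟩ := hl.caret [] 0 (by simp) this
        rw [Subsingleton.elim i j, h2] at h1; simp at h1
      obtain rfl := key m hm
      obtain rfl := key l hl
      rw [bv_self]; exact one_mem _
    obtain ⟨i, j, hc⟩ := exists_caret (by omega) hl
    obtain ⟨p, q, hd⟩ := exists_caret (by omega) hm
    let σ : Equiv.Perm (Fin (n+1)) := Equiv.swap (Equiv.swap i p j) q * Equiv.swap i p
    have hij := hc.ne
    have hpq := hd.ne
    have s1 : σ j = q := by simp [σ]
    have s2 : σ i = p := by
      simp only [σ, Equiv.Perm.mul_apply, Equiv.swap_apply_left]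
      apply Equiv.swap_apply_of_ne_of_ne
      · intro h
        have : Equiv.swap i p i = Equiv.swap i p j := by rw [Equiv.swap_apply_left]; exact h
        exact hij ((Equiv.swap i p).injective this)
      · exact hpq
    have e1 : bv hm hl = bv hm (hm.comp σ) * bv (hm.comp σ) hl := (bv_mul _ _ _).symm
    have hcd : Caret (m ∘ σ) i j := by
      obtain ⟨w, w1, w2⟩ := hd
      exact ⟨w, by simp [s2, w1], by simp [s1, w2]⟩
    rw [e1, mer_bv (hm.comp σ) hl hcd hc]
    refine mul_mem ?_ (ih _ _)
    have e2 : bv hm (hm.comp σ) = (bv (hm.comp σ) hm)⁻¹ := by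
      rw [eq_inv_iff_mul_eq_one, bv_mul, bv_self]
    rw [e2]
    exact inv_mem (bv_perm_mem hm σ)

theorem closure_tr : Subgroup.closure trSet = ⊤ := by
  rw [eq_top_iff]
  intro v _
  obtain ⟨k, m, l, hm, hl, hv⟩ := exists_SV v
  rw [eq_bv hm hl hv]
  exact bv_mem_closure hm hl

/-- Induction: a subgroup containing all swaps of long words is everything. -/
theorem top_of_tr (H : Subgroup V)
    (h : ∀ α β, Inc α β → 2 ≤ α.length → 2 ≤ β.length → tr α β ∈ H) : H = ⊤ := by
  have split : ∀ α β, Inc α β → tr (α ++ [false]) (β ++ [false]) ∈ H → tr (α ++ [true]) (β ++ [true]) ∈ H →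
      tr α β ∈ H := fun α β hi h1 h2 => by rw [tr_split hi]; exact mul_mem h1 h2
  have h1 : ∀ α β, Inc α β → 1 ≤ α.length → 1 ≤ β.length → tr α β ∈ H := fun α β hi k1 k2 =>
    split α β hi (h _ _ (hi.append _ _) (by simp [k1]) (by simp [k2]))
      (h _ _ (hi.append _ _) (by simp [k1]) (by simp [k2]))
  have h0 : ∀ α β, Inc α β → tr α β ∈ H := fun α β hi =>
    split α β hi (h1 _ _ (hi.append _ _) (by simp) (by simp))
      (h1 _ _ (hi.append _ _) (by simp) (by simp))
  rw [eq_top_iff, ← closure_tr, Subgroup.closure_le]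
  rintro _ ⟨α, β, hi, rfl⟩
  exact h0 α β hi

theorem V_perfect : commutator V = ⊤ := by
  apply top_of_tr
  intro α β hi _ _
  have i1 := hi.append [false] [false]
  have i3 := hi.append [false] [true]
  have i4 := hi.append [true] [false]
  have i5 := inc_ft.prep α
  have i6 := inc_ft.prep β
  let x := tr (α ++ [false]) (β ++ [false])
  let n := tr (α ++ [false]) (α ++ [true]) * tr (β ++ [false]) (β ++ [true])
  have e : n * x * n⁻¹ = tr (α ++ [true]) (β ++ [true]) := by
    apply tr_conj i1
    · intro y; rw [V_mul, tr_fix i1 i3, tr_l i5]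
    · intro y; rw [V_mul, tr_l i6, tr_fix i3.symm (hi.append [true] [true]).symm]
  have : tr α β = ⁅x, n⁆ := by
    rw [tr_split hi, ← e, commutatorElement_def]
    have : x⁻¹ = x := tr_inv _ _
    rw [this]; simp [x, mul_assoc]
  rw [this]
  exact Subgroup.commutator_mem_commutator (Subgroup.mem_top _) (Subgroup.mem_top _)

/-! Corners. -/

noncomputable def cf (w : List Bool) (f : Y → Y) (y : Y) : Y :=
  if h : Pre w y then app w (f h.choose) else y

theorem cf_app (w : List Bool) (f : Y → Y) (y : Y) : cf w f (app w y) = app w (f y) := by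
  have h : Pre w (app w y) := pre_app _ _
  rw [cf, dif_pos h, ← app_inj h.choose_spec]

theorem cf_o {w : List Bool} {f : Y → Y} {y : Y} (h : ¬ Pre w y) : cf w f y = y := by
  rw [cf, dif_neg h]

theorem cf_cf (w : List Bool) (f g : Y → Y) (y : Y) : cf w f (cf w g y) = cf w (f ∘ g) y := by
  by_cases h : Pre w y
  · obtain ⟨z, rfl⟩ := h; rw [cf_app, cf_app, cf_app]; rfl
  · rw [cf_o h, cf_o h, cf_o h]

theorem cf_id (w : List Bool) (y : Y) : cf w id y = y := by
  by_cases h : Pre w y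
  · obtain ⟨z, rfl⟩ := h; rw [cf_app]; rfl
  · rw [cf_o h]

/-- The corner homomorphism. -/
noncomputable def cor (w : List Bool) : V →* V where
  toFun v := ⟨⟨cf w v.1, cf w (v⁻¹).1, fun y => by
      rw [cf_cf]; convert cf_id w y using 2; funext z; exact V_inv_app v z, fun y => by
      rw [cf_cf]; convert cf_id w y using 2; funext z; exact V_app_inv v z⟩, by
    obtain ⟨N, hN⟩ := V_depth v
    refine ⟨w.length + N, fun α hα => ?_⟩
    change ∃ β, ∀ y, cf w v.1 (app α y) = app β y
    by_cases h : w <+: α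
    · obtain ⟨γ, rfl⟩ := h
      obtain ⟨β, hβ⟩ := hN γ (by simp at hα; omega)
      exact ⟨w ++ β, fun y => by rw [app_append, cf_app, hβ, app_append]⟩
    · exact ⟨α, fun y => cf_o fun hp => h (pre_cmp hp (pre_app _ _) (by omega))⟩⟩
  map_one' := V_ext fun y => cf_id w y
  map_mul' v v' := V_ext fun y => (cf_cf w v.1 v'.1 y).symm

theorem cor_app (w : List Bool) (v : V) (y : Y) : (cor w v).1 (app w y) = app w (v.1 y) := cf_app _ _ _
theorem cor_o {w : List Bool} {v : V} {y : Y} (h : ¬ Pre w y) : (cor w v).1 y = y := cf_o h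

theorem cor_fix {w γ : List Bool} (h : Inc w γ) (v : V) (y : Y) : (cor w v).1 (app γ y) = app γ y :=
  cor_o (h.symm.not_pre y)

theorem eq_cor {w : List Bool} {v u : V} (h1 : ∀ y, u.1 (app w y) = app w (v.1 y))
    (h2 : ∀ y, ¬ Pre w y → u.1 y = y) : u = cor w v := by
  apply V_ext; intro y
  by_cases h : Pre w y
  · obtain ⟨z, rfl⟩ := h; rw [h1, cor_app]
  · rw [h2 _ h, cor_o h]

theorem cor_conj {α β : List Bool} {g : V} (hg : ∀ y, g.1 (app α y) = app β y) (v : V) :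
    g * cor α v * g⁻¹ = cor β v := by
  apply eq_cor
  · intro y; rw [V_mul, V_mul, V_inv_eq (hg y), cor_app, hg]
  · intro y h
    rw [V_mul, V_mul, cor_o, V_app_inv]
    rintro ⟨z, hz⟩; exact h ⟨z, by rw [← hg, ← hz, V_app_inv]⟩

theorem cor_cor (α β : List Bool) (v : V) : cor α (cor β v) = cor (α ++ β) v := by
  apply eq_cor
  · intro y; rw [app_append, cor_app, cor_app, app_append]
  · intro y h
    by_cases h1 : Pre α y
    · obtain ⟨z, rfl⟩ := h1
      rw [cor_app, cor_o]
      rintro ⟨x, rfl⟩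
      exact h ⟨x, by rw [app_append]⟩
    · rw [cor_o h1]

theorem cor_tr (w α β : List Bool) (h : Inc α β) : cor w (tr α β) = tr (w ++ α) (w ++ β) := by
  apply eq_tr (h.prep w)
  · intro y; rw [app_append, cor_app, tr_l h, app_append]
  · intro y; rw [app_append, cor_app, tr_r h, app_append]
  · intro y h1 h2
    by_cases h3 : Pre w y
    · obtain ⟨z, rfl⟩ := h3
      rw [cor_app, tr_o]
      · rintro ⟨x, rfl⟩
        exact h1 ⟨x, by rw [app_append]⟩
      · rintro ⟨x, rfl⟩
        exact h2 ⟨x, by rw [app_append]⟩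
    · rw [cor_o h3]

theorem cor_inj (w : List Bool) : Function.Injective (cor w) := by
  intro v v' h
  apply V_ext; intro y
  have := cor_app w v y
  rw [h, cor_app] at this
  exact (app_inj this).symm

theorem cor_comm {α β : List Bool} (h : Inc α β) (v w : V) : Commute (cor α v) (cor β w) := by
  apply V_ext; intro y
  rw [V_mul, V_mul]
  by_cases h1 : Pre α y
  · obtain ⟨z, rfl⟩ := h1
    rw [cor_fix h.symm, cor_app, cor_fix h.symm]
  by_cases h2 : Pre β y
  · obtain ⟨z, rfl⟩ := h2
    rw [cor_app, cor_fix h, cor_fix h, cor_app]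
  rw [cor_o h2, cor_o h1, cor_o h2]

theorem mover {α β : List Bool} (hα : α ≠ []) (hβ : β ≠ []) : ∃ v : V, ∀ y, v.1 (app α y) = app β y := by
  obtain ⟨a, α, rfl⟩ := List.exists_cons_of_ne_nil hα
  obtain ⟨b, β, rfl⟩ := List.exists_cons_of_ne_nil hβ
  by_cases h : a = b
  · subst h
    refine ⟨tr [!a] (a :: β) * tr (a :: α) [!a], fun y => ?_⟩
    rw [V_mul, tr_l (inc_cons (by simp) _ _), tr_l (inc_cons (by simp) _ _)]
  · exact ⟨tr (a :: α) (b :: β), fun y => tr_l (inc_cons h _ _) y⟩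

/-- Normal subgroups containing one corner are everything. -/
theorem normal_top {N : Subgroup V} [N.Normal] {w : List Bool} (h : ∀ v, cor w v ∈ N) : N = ⊤ := by
  have h' : ∃ w : List Bool, w ≠ [] ∧ ∀ v, cor w v ∈ N :=
    ⟨w ++ [true], by simp, fun v => by rw [← cor_cor]; exact h _⟩
  obtain ⟨w, hw, h⟩ := h'
  have key : ∀ w', w' ≠ [] → ∀ v, cor w' v ∈ N := by
    intro w' hw' v
    obtain ⟨g, hg⟩ := mover hw hw'
    rw [← cor_conj hg]
    exact Subgroup.Normal.conj_mem inferInstance _ (h v) _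
  have same : ∀ a α β, Inc α β → tr (a :: α) (a :: β) ∈ N := by
    intro a α β hi
    have := cor_tr [a] α β hi
    simp only [List.cons_append, List.nil_append] at this
    rw [← this]; exact key _ (by simp) _
  apply top_of_tr
  intro α β hi hα hβ
  match α, β with
  | a :: b :: α, c :: β =>
    by_cases hac : a = c
    · subst hac
      refine same _ _ _ (inc_of fun y z e => hi.ne y z ?_)
      rw [app_cons, e, ← app_cons]
    have i1 : Inc [a, !b] (c :: β) := inc_cons hac _ _
    have i2 : Inc (a :: b :: α) [a, !b] := (inc_cons (b := b) (c := !b) (by simp) α []).prep [a]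
    have := tr_conj i2 (tr [a, !b] (c :: β)) (α' := a :: b :: α) (β' := c :: β)
      (fun y => tr_fix i2 hi y) (fun y => tr_l i1 y)
    rw [← this]
    exact Subgroup.Normal.conj_mem inferInstance _ (same a (b :: α) [!b] (inc_cons (by simp) _ _)) _

theorem V_gen {H : Subgroup V} (h1 : ∀ v, cor [true] v ∈ H) (h2 : tr [false] [true, false] ∈ H) : H = ⊤ := by
  have it : Inc [false] [true, false] := inc_cons (by simp) _ _
  have ii : ∀ α β, Inc α β → tr (true :: α) (true :: β) ∈ H := by
    intro α β hi
    have := cor_tr [true] α β hi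
    simp only [List.cons_append, List.nil_append] at this
    rw [← this]; exact h1 _
  have conj : ∀ α β α' β' g, Inc α β → g ∈ H → (∀ y, g.1 (app α y) = app α' y) →
      (∀ y, g.1 (app β y) = app β' y) → tr α' β' ∈ H → tr α β ∈ H := by
    intro α β α' β' g hi hg k1 k2 h
    rw [← tr_conj hi g k1 k2] at h
    have := mul_mem (mul_mem (inv_mem hg) h) hg
    simpa [mul_assoc] using this
  have t0 : ∀ α y, (tr [false] [true, false]).1 (app (false :: α) y) = app (true :: false :: α) y := by
    intro α y
    exact tr_l it (app α y)
  have tail : ∀ {a α β}, Inc (a :: α) (a :: β) → Inc α β := fun hi => inc_of fun y z e => hi.ne y z (by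
    rw [app_cons, e, ← app_cons])
  have mix1 : ∀ α β, tr (false :: α) (true :: true :: β) ∈ H := by
    intro α β
    refine conj _ _ (true :: false :: α) (true :: true :: β) _ (inc_cons (by simp) _ _) h2 (t0 α)
      (fun y => tr_fix (inc_cons (by simp) _ _) ((inc_cons (b := true) (c := false) (by simp) β []).prep [true]) _) ?_
    exact ii _ _ (inc_cons (by simp) _ _)
  have mix : ∀ α b β, tr (false :: α) (true :: b :: β) ∈ H := by
    intro α b β
    cases b
    · refine conj _ _ (false :: α) (true :: true :: β) (cor [true] (tr [false] [true])) (inc_cons (by simp) _ _) (h1 _) ?_ ?_ (mix1 α β)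
      · intro y; exact cor_fix (inc_cons (by simp) _ _) _ _
      · intro y
        exact (cor_app [true] _ _).trans (congrArg (app [true]) (tr_l inc_ft (app β y)))
    · exact mix1 α β
  apply top_of_tr
  intro α β hi hα hβ
  match α, β with
  | a :: b :: α, c :: d :: β =>
    cases a <;> cases c
    · refine conj _ _ _ _ _ hi h2 (t0 _) (t0 _) (ii _ _ (inc_of fun y z e => hi.ne y z ?_))
      exact e
    · exact mix _ _ _
    · rw [tr_comm]; exact mix _ _ _
    · exact ii _ _ (tail hi)

end HE

namespace HE
open Classical

section
variable (G : Type) [Group G]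

abbrev C2 := Multiplicative (ZMod 2)
abbrev Gam := Monoid.Coprod G C2

abbrev Lt := {g : G // g ≠ 1}

/-- The space on which `G * C2` acts. -/
structure XX where
  hd : G
  tl : ℕ → Lt G

variable {G}

theorem XX.ext' {x y : XX G} (h1 : x.hd = y.hd) (h2 : x.tl = y.tl) : x = y := by
  cases x; cases y; simp_all

def scons {A : Type} (a : A) (τ : ℕ → A) : ℕ → A := fun n => Nat.casesOn n a τ

@[simp] theorem scons_tail {A : Type} (a : A) (τ : ℕ → A) : (fun n => scons a τ (n+1)) = τ := rfl
@[simp] theorem scons_zero {A : Type} (a : A) (τ : ℕ → A) : scons a τ 0 = a := rfl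
@[simp] theorem scons_self {A : Type} (τ : ℕ → A) : scons (τ 0) (fun n => τ (n+1)) = τ := by
  funext n; cases n <;> rfl

def sh (x : XX G) : XX G := ⟨(x.tl 0).1, fun n => x.tl (n+1)⟩

theorem sh_ne (x : XX G) : (sh x).hd ≠ 1 := (x.tl 0).2

def actG : G →* Equiv.Perm (XX G) where
  toFun g := ⟨fun x => ⟨g * x.hd, x.tl⟩, fun x => ⟨g⁻¹ * x.hd, x.tl⟩, fun x => by simp, fun x => by simp⟩
  map_one' := by ext x <;> simp
  map_mul' g h := by ext x <;> simp [mul_assoc]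

noncomputable def tf (x : XX G) : XX G := if h : x.hd = 1 then sh x else ⟨1, scons ⟨x.hd, h⟩ x.tl⟩

theorem tf_one {x : XX G} (h : x.hd = 1) : tf x = sh x := dif_pos h
theorem tf_ne {x : XX G} (h : x.hd ≠ 1) : tf x = ⟨1, scons ⟨x.hd, h⟩ x.tl⟩ := dif_neg h

theorem tf_inv : Function.Involutive (tf : XX G → XX G) := by
  intro x
  by_cases h : x.hd = 1
  · rw [tf_one h, tf_ne (sh_ne x)]
    exact XX.ext' h.symm (scons_self x.tl)
  · rw [tf_ne h, tf_one rfl]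
    rfl

/-- Homomorphism out of `C2`. -/
def homC2 {H : Type*} [Group H] (h : H) (hh : h * h = 1) : C2 →* H where
  toFun x := if x = 1 then 1 else h
  map_one' := by simp
  map_mul' x y := by
    have hx : x = 1 ∨ x = Multiplicative.ofAdd 1 := by revert x; decide
    have hy : y = 1 ∨ y = Multiplicative.ofAdd 1 := by revert y; decide
    have h1 : (Multiplicative.ofAdd 1 : C2) ≠ 1 := by decide
    have h2 : (Multiplicative.ofAdd 1 : C2) * Multiplicative.ofAdd 1 = 1 := by decide
    rcases hx with rfl | rfl <;> rcases hy with rfl | rfl <;> simp [h1, h2, hh]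

def gen2 : C2 := Multiplicative.ofAdd 1

theorem homC2_gen {H : Type*} [Group H] (h : H) (hh : h * h = 1) : homC2 h hh gen2 = h := by
  have h1 : gen2 ≠ 1 := by decide
  simp [homC2, h1]

def gG : G →* Gam G := Monoid.Coprod.inl
def gT : Gam G := Monoid.Coprod.inr gen2

theorem gT_sq : (gT : Gam G) * gT = 1 := by
  rw [gT, ← map_mul]
  have : gen2 * gen2 = 1 := by decide
  rw [this, map_one]

theorem gT_inv : (gT : Gam G)⁻¹ = gT := inv_eq_of_mul_eq_one_left gT_sq

noncomputable def act : Gam G →* Equiv.Perm (XX G) :=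
  Monoid.Coprod.lift actG (homC2 tf_inv.toPerm (by ext1 x; exact tf_inv x))

theorem act_G (g : G) (x : XX G) : act (gG g) x = ⟨g * x.hd, x.tl⟩ := by
  rw [act, gG, Monoid.Coprod.lift_apply_inl]; rfl

theorem act_T (x : XX G) : act gT x = tf x := by
  rw [act, gT, Monoid.Coprod.lift_apply_inr, homC2_gen]; rfl

theorem act_mul (γ η : Gam G) (x : XX G) : act (γ * η) x = act γ (act η x) := by rw [map_mul]; rfl
theorem act_one (x : XX G) : act 1 x = x := by rw [map_one]; rfl
theorem act_inv_act (γ : Gam G) (x : XX G) : act γ⁻¹ (act γ x) = x := by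
  rw [← act_mul]; simp [act_one]
theorem act_act_inv (γ : Gam G) (x : XX G) : act γ (act γ⁻¹ x) = x := by
  rw [← act_mul]; simp [act_one]

theorem act_GT_sh (x : XX G) : act (gG x.hd * gT) (sh x) = x := by
  rw [act_mul, act_T, act_G, tf_ne (sh_ne x)]
  exact XX.ext' (mul_one _) (scons_self x.tl)

theorem act_GT {g : G} {x : XX G} (h : x.hd ≠ 1) : act (gG g * gT) x = ⟨g, scons ⟨x.hd, h⟩ x.tl⟩ := by
  rw [act_mul, act_T, act_G, tf_ne h]; simp

theorem sh_GT {g : G} {x : XX G} (h : x.hd ≠ 1) : sh (act (gG g * gT) x) = x := by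
  rw [act_GT h]; rfl

/-- Induction on `Γ`. -/
theorem gam_induct {p : Gam G → Prop} (h1 : p 1) (hG : ∀ g γ, p γ → p (gG g * γ))
    (hT : ∀ γ, p γ → p (gT * γ)) (γ : Gam G) : p γ := by
  have key : ∀ γ η : Gam G, p η → p (γ * η) := by
    intro γ
    induction γ using Monoid.Coprod.induction_on with
    | inl g => exact fun η h => hG g η h
    | inr c =>
      intro η h
      have hx : c = 1 ∨ c = gen2 := by revert c; decide
      rcases hx with rfl | rfl
      · simpa using h
      · exact hT η h
    | mul x y hx hy => intro η h; rw [mul_assoc]; exact hx _ (hy _ h)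
  simpa using key γ 1 h1

/-- The group element of a finite initial segment. -/
def uu : G → List (Lt G) → Gam G
  | h, [] => gG h
  | h, a :: l => gG h * gT * uu a.1 l

def slist {A : Type} : List A → (ℕ → A) → (ℕ → A)
  | [], τ => τ
  | a :: l, τ => scons a (slist l τ)

theorem act_uu (h : G) (l : List (Lt G)) (σ : ℕ → Lt G) :
    act (uu h l) ⟨1, σ⟩ = ⟨h, slist l σ⟩ := by
  induction l generalizing h with
  | nil => rw [uu, act_G]; simp [slist]
  | cons a l ih =>
    rw [uu, act_mul, ih, act_GT (g := h) a.2]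
    rfl

theorem gG_uu (g h : G) (l : List (Lt G)) : gG g * uu h l = uu (g * h) l := by
  cases l <;> simp [uu, mul_assoc]

theorem gam_uu (γ : Gam G) : ∃ N, ∀ h (l : List (Lt G)), N ≤ l.length → ∃ h' l', γ * uu h l = uu h' l' := by
  have : ∃ N, ∀ K h (l : List (Lt G)), K + N ≤ l.length → ∃ h' l', K ≤ l'.length ∧ γ * uu h l = uu h' l' := by
    induction γ using gam_induct with
    | h1 => exact ⟨0, fun K h l hl => ⟨h, l, hl, one_mul _⟩⟩
    | hG g γ ih =>
      obtain ⟨N, hN⟩ := ih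
      refine ⟨N, fun K h l hl => ?_⟩
      obtain ⟨h', l', k, e⟩ := hN K h l hl
      exact ⟨g * h', l', k, by rw [mul_assoc, e, gG_uu]⟩
    | hT γ ih =>
      obtain ⟨N, hN⟩ := ih
      refine ⟨N + 1, fun K h l hl => ?_⟩
      obtain ⟨h', l', k, e⟩ := hN (K+1) h l (by omega)
      rw [mul_assoc, e]
      by_cases hh : h' = 1
      · subst hh
        cases l' with
        | nil => simp at k
        | cons a l' => 
          refine ⟨a.1, l', by simpa using k, ?_⟩
          rw [uu, map_one, one_mul, ← mul_assoc, gT_sq, one_mul]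
      · refine ⟨1, ⟨h', hh⟩ :: l', by simp; omega, ?_⟩
        rw [uu, map_one, one_mul]
  obtain ⟨N, hN⟩ := this
  refine ⟨N, fun h l hl => ?_⟩
  obtain ⟨h', l', -, e⟩ := hN 0 h l (by omega)
  exact ⟨h', l', e⟩

theorem slist_det {A : Type} [Nontrivial A] {l l' : List A}
    (h : ∀ σ, slist l σ = slist l' σ) : l = l' := by
  induction l generalizing l' with
  | nil =>
    cases l' with
    | nil => rfl
    | cons a l' =>
      obtain ⟨b, hb⟩ := exists_ne a
      exact absurd (congrFun (h fun _ => b) 0) hb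
  | cons a l ih =>
    cases l' with
    | nil => 
      obtain ⟨b, hb⟩ := exists_ne a
      exact absurd (congrFun (h fun _ => b) 0) hb.symm
    | cons b l' =>
      have e : a = b := congrFun (h fun _ => a) 0
      subst e
      rw [ih fun σ => ?_]
      funext n
      exact congrFun (h σ) (n+1)

/-- Topological freeness. -/
theorem top_free [Nontrivial (Lt G)] (γ : Gam G) (h : G) (l : List (Lt G))
    (hf : ∀ σ, act γ ⟨h, slist l σ⟩ = ⟨h, slist l σ⟩) : γ = 1 := by
  obtain ⟨N, hN⟩ := gam_uu γ
  obtain ⟨a⟩ : Nonempty (Lt G) := inferInstance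
  have hl : ∀ (l l' : List (Lt G)) σ, slist (l ++ l') σ = slist l (slist l' σ) := by
    intro l l' σ
    induction l with
    | nil => rfl
    | cons b l ih => simp [slist, ih]
  obtain ⟨h', l', e⟩ := hN h (l ++ List.replicate N a) (by simp)
  have key : ∀ σ, (⟨h', slist l' σ⟩ : XX G) = ⟨h, slist (l ++ List.replicate N a) σ⟩ := by
    intro σ
    rw [← act_uu, ← e, act_mul, act_uu, hl, hf]
  have e1 : h' = h := congrArg XX.hd (key fun _ => a)
  have e2 : l' = l ++ List.replicate N a := slist_det fun σ => congrArg XX.tl (key σ)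
  rw [e1, e2] at e
  simpa using e

end
end HE

namespace HE
open Classical

section
variable {Z : Type}

/-- Indicator homomorphism. -/
noncomputable def ind (A : Set Z) : V →* (Z → V) where
  toFun v := fun z => if z ∈ A then v else 1
  map_one' := by funext z; simp
  map_mul' v w := by funext z; by_cases h : z ∈ A <;> simp [h]

theorem ind_apply (A : Set Z) (v : V) (z : Z) : ind A v z = if z ∈ A then v else 1 := rfl
theorem ind_pos {A : Set Z} {z : Z} (h : z ∈ A) (v : V) : ind A v z = v := if_pos h
theorem ind_neg {A : Set Z} {z : Z} (h : z ∉ A) (v : V) : ind A v z = 1 := if_neg h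

theorem ind_compl (A : Set Z) (v : V) : ind A v * ind Aᶜ v = fun _ => v := by
  funext z
  by_cases h : z ∈ A <;> simp [ind_apply, h]

theorem ind_univ (v : V) : ind (Set.univ : Set Z) v = fun _ => v := by
  funext z; simp [ind_apply]

theorem ind_single [DecidableEq Z] (z : Z) (v : V) : ind {z} v = Pi.mulSingle z v := by
  funext w
  by_cases h : w = z
  · subst h; simp [ind_apply]
  · simp [ind_apply, h, Pi.mulSingle_eq_of_ne h]

theorem commute_disj {f g : Z → V} (h : ∀ z, f z = 1 ∨ g z = 1) : Commute f g := by
  funext z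
  rcases h z with h | h <;> simp [h]

theorem ind_disj {A B : Set Z} (h : ∀ z, z ∈ A → z ∉ B) (v w : V) : Commute (ind A v) (ind B w) := by
  apply commute_disj
  intro z
  by_cases hz : z ∈ A
  · exact Or.inr (ind_neg (h z hz) _)
  · exact Or.inl (ind_neg hz _)

theorem conj_ind (A : Set Z) (κ v : V) :
    (fun _ => κ) * ind A v * (fun _ => κ)⁻¹ = ind A (κ * v * κ⁻¹) := by
  funext z
  by_cases h : z ∈ A <;> simp [ind_apply, h]

/-- Functions invariant under a setoid. -/
def LS (R : Setoid Z) : Subgroup (Z → V) where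
  carrier := {f | ∀ x y, R x y → f x = f y}
  one_mem' := fun _ _ _ => rfl
  mul_mem' := fun hf hg x y h => by simp [hf x y h, hg x y h]
  inv_mem' := fun hf x y h => by simp [hf x y h]

theorem LS_mem {R : Setoid Z} {f : Z → V} : f ∈ LS R ↔ ∀ x y, R x y → f x = f y := Iff.rfl

theorem LS_ind {R : Setoid Z} {A : Set Z} (h : ∀ x y, R x y → x ∈ A → y ∈ A) (v : V) : ind A v ∈ LS R := by
  intro x y hxy
  have : x ∈ A ↔ y ∈ A := ⟨h x y hxy, h y x (R.symm hxy)⟩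
  simp [ind_apply, this]

theorem LS_induct (R : Setoid Z) [Finite (Quotient R)] (H : Subgroup (Z → V)) {f : Z → V} (hf : f ∈ LS R)
    (h : ∀ z, ind {z' | R z' z} (f z) ∈ H) : f ∈ H := by
  haveI := Fintype.ofFinite (Quotient R)
  let pull : (Quotient R → V) →* (Z → V) :=
    { toFun := fun u z => u (Quotient.mk R z), map_one' := rfl, map_mul' := fun _ _ => rfl }
  let u : Quotient R → V := fun c => Quotient.liftOn c f (fun x y hxy => hf x y hxy)
  have hu : u ∈ H.comap pull := by
    apply Subgroup.pi_mem_of_mulSingle_mem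
    intro c
    induction c using Quotient.inductionOn with
    | h z =>
      have : pull (Pi.mulSingle (Quotient.mk R z) (u (Quotient.mk R z))) = ind {z' | R z' z} (f z) := by
        funext w
        show (Pi.mulSingle (Quotient.mk R z) (u (Quotient.mk R z)) : Quotient R → V) (Quotient.mk R w) = _
        by_cases hw : R w z
        · have : Quotient.mk R w = Quotient.mk R z := Quotient.sound hw
          rw [this, Pi.mulSingle_eq_same]
          exact (ind_pos hw _).symm
        · have : Quotient.mk R w ≠ Quotient.mk R z := fun h => hw (Quotient.exact h)
          rw [Pi.mulSingle_eq_of_ne this]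
          exact (ind_neg hw _).symm
      rw [Subgroup.mem_comap, this]
      exact h z
  exact hu
end

section
variable {P : Type} [Group P]

/-- Elementwise commuting homomorphisms. -/
def Perp (Φ Ψ : V →* P) : Prop := ∀ v w, Commute (Φ v) (Ψ w)

theorem Perp.symm {Φ Ψ : V →* P} (h : Perp Φ Ψ) : Perp Ψ Φ := fun v w => (h w v).symm

structure Tame (δ : V →* P) (P0 P1 : Subgroup P) (Φ : V →* P) : Prop where
  conj : ∀ κ v, δ κ * Φ v * (δ κ)⁻¹ = Φ (κ * v * κ⁻¹)
  m0 : ∀ v, Φ (cor [false] v) ∈ P0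
  m1 : ∀ v, Φ (cor [true] v) ∈ P1

theorem perp_trans {δ Φ Ψ Ψc Χ : V →* P} {P0 P1 : Subgroup P}
    (hP : ∀ p ∈ P0, ∀ q ∈ P1, Commute p q)
    (hΦ : Tame δ P0 P1 Φ) (hΧ : Tame δ P0 P1 Χ) (hδ : ∀ v, δ v = Ψ v * Ψc v)
    (h1 : Perp Φ Ψc) (h2 : Perp Ψ Χ) : Perp Φ Χ := by
  -- the set of `v` such that `Φ v` commutes with a given `Χ w` is normal
  have hconj : ∀ p v, Ψ p * Φ v * (Ψ p)⁻¹ = Φ (p * v * p⁻¹) := by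
    intro p v
    rw [← hΦ.conj p v, hδ]
    have := (h1 v p).eq
    calc Ψ p * Φ v * (Ψ p)⁻¹ = Ψ p * (Φ v * Ψc p) * (Ψc p)⁻¹ * (Ψ p)⁻¹ := by group
      _ = _ := by rw [this]; group
  let N (w : V) : Subgroup V := (Subgroup.centralizer {Χ w}).comap Φ
  have memN : ∀ w v, v ∈ N w ↔ Commute (Φ v) (Χ w) := by
    intro w v
    rw [Subgroup.mem_comap, Subgroup.mem_centralizer_singleton_iff]
    exact ⟨fun h => h, fun h => h⟩
  have hN : ∀ w, (N w).Normal := by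
    intro w
    constructor
    intro v hv p
    rw [memN] at hv ⊢
    rw [← hconj]
    have h3 := h2 p w
    exact ((h3.mul_left hv).mul_left h3.inv_left)
  let M : Subgroup V := (Subgroup.centralizer (Set.range Φ)).comap Χ
  have memM : ∀ w, w ∈ M ↔ ∀ v, Commute (Φ v) (Χ w) := by
    intro w
    rw [Subgroup.mem_comap, Subgroup.mem_centralizer_iff]
    constructor
    · intro h v; exact h _ ⟨v, rfl⟩
    · rintro h _ ⟨v, rfl⟩; exact h v
  have hM : M.Normal := by
    constructor
    intro w hw κ
    rw [memM] at hw ⊢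
    intro v
    have h3 := hw (κ⁻¹ * v * κ⁻¹⁻¹)
    rw [← hΦ.conj] at h3
    rw [← hΧ.conj]
    rw [map_inv] at h3
    have h4 : Commute ((MulAut.conj (δ κ)) ((δ κ)⁻¹ * Φ v * (δ κ)⁻¹⁻¹)) ((MulAut.conj (δ κ)) (Χ w)) :=
      h3.map (MulAut.conj (δ κ))
    simp only [MulAut.conj_apply] at h4
    convert h4 using 1
    group
  have hMt : M = ⊤ := by
    apply normal_top (w := [true])
    intro u
    rw [memM]
    have : N (cor [true] u) = ⊤ := by
      haveI := hN (cor [true] u)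
      apply normal_top (w := [false])
      intro v
      rw [memN]
      exact hP _ (hΦ.m0 v) _ (hΧ.m1 u)
    intro v
    rw [← memN, this]; trivial
  intro v w
  have : w ∈ M := by rw [hMt]; trivial
  exact (memM w).1 this v

theorem perp_uniq {δ Φ Φc Ψ Ψc : V →* P} (hΦ : ∀ v, δ v = Φ v * Φc v) (hΨ : ∀ v, δ v = Ψ v * Ψc v)
    (h1 : Perp Φ Φc) (h2 : Perp Ψ Ψc) (h3 : Perp Φ Ψc) (h4 : Perp Ψ Φc) : Φ = Ψ := by
  have e1 : ∀ v, (Φ v)⁻¹ * Ψ v = Φc v * (Ψc v)⁻¹ := by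
    intro v
    have := hΦ v
    rw [hΨ v, (h2 v v).eq] at this
    rw [eq_mul_inv_iff_mul_eq, mul_assoc, inv_mul_eq_iff_eq_mul, (h2 v v).eq, this]
  have c1 : ∀ v w, Commute ((Φ v)⁻¹ * Ψ v) (Φ w) := by
    intro v w
    rw [e1]
    exact ((h1 w v).symm).mul_left (h3 w v).symm.inv_left
  have c2 : ∀ v w, Commute ((Φ v)⁻¹ * Ψ v) (Ψ w) := by
    intro v w
    rw [e1]
    exact ((h4 w v).symm).mul_left (h2 w v).symm.inv_left
  let z : V →* P :=
    { toFun := fun v => (Φ v)⁻¹ * Ψ v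
      map_one' := by simp
      map_mul' := fun v w => by
        have := (c1 v w).inv_right.eq
        rw [map_mul, map_mul, mul_inv_rev]
        calc _ = (Φ w)⁻¹ * ((Φ v)⁻¹ * Ψ v) * Ψ w := by group
          _ = _ := by rw [← this]; group }
  have hz : commutator V ≤ z.ker := by
    rw [commutator_def, Subgroup.commutator_le]
    intro v _ w _
    rw [MonoidHom.mem_ker, map_commutatorElement, commutatorElement_eq_one_iff_commute]
    exact ((c1 v w).inv_right).mul_right (c2 v w)
  ext v
  have : v ∈ z.ker := hz (by rw [V_perfect]; trivial)
  exact inv_mul_eq_one.1 this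
end

/-- Data and relations. -/
structure Sys {G : Type} [Group G] (S : Star G) (P : Type) [Group P] where
  I : (Fin S.k → V) →* P
  U : Gam G →* P
  P0 : Subgroup P
  P1 : Subgroup P
  P_comm : ∀ p ∈ P0, ∀ q ∈ P1, Commute p q
  P0_U : ∀ γ, ∀ p ∈ P0, U γ * p * (U γ)⁻¹ ∈ P0
  P1_U : ∀ γ, ∀ p ∈ P1, U γ * p * (U γ)⁻¹ ∈ P1
  I0 : ∀ α v, I (Pi.mulSingle α (cor [false] v)) ∈ P0
  I1 : ∀ α v, I (Pi.mulSingle α (cor [true] v)) ∈ P1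
  Uδ : ∀ γ v, Commute (U γ) (I (fun _ => v))
  rel6 : ∀ α β g, S.ℓ g ≤ S.D → (∀ p, ¬ (S.a p = α ∧ S.a (g⁻¹ * p) = β)) → ∀ v w,
    Commute (I (Pi.mulSingle α v)) (U (gG g) * I (Pi.mulSingle β w) * (U (gG g))⁻¹)
  rel7 : ∀ v, U gT * I (Pi.mulSingle (S.a 1) v) * (U gT)⁻¹ = I (fun _ => v) * (I (Pi.mulSingle (S.a 1) v))⁻¹

end HE

namespace HE
open Classical

section
variable {Z : Type} {P : Type} [Group P]

def cls (R : Setoid Z) (z : Z) : Set Z := {z' | R z' z}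

theorem cls_mem (R : Setoid Z) (z : Z) (v : V) : ind (cls R z) v ∈ LS R :=
  LS_ind (fun x y hxy hx => R.trans (R.symm hxy) hx) v

theorem cls_eq {R : Setoid Z} {z w : Z} (h : R z w) : cls R z = cls R w := by
  ext x; exact ⟨fun hx => R.trans hx h, fun hx => R.trans hx (R.symm h)⟩

/-- Homomorphism out of the invariant functions. -/
theorem exists_lsHom (R : Setoid Z) [Finite (Quotient R)] (φ : Z → (V →* P))
    (hφ : ∀ z w, R z w → φ z = φ w) (hc : ∀ z w, ¬ R z w → Perp (φ z) (φ w)) :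
    ∃ h : LS R →* P, ∀ z v, h ⟨ind (cls R z) v, cls_mem R z v⟩ = φ z v := by
  haveI := Fintype.ofFinite (Quotient R)
  let ψ : Quotient R → (V →* P) := fun c => Quotient.liftOn c φ (fun x y hxy => hφ x y hxy)
  have hψ : Pairwise fun c d => ∀ x y, Commute (ψ c x) (ψ d y) := by
    intro c d
    induction c, d using Quotient.inductionOn₂ with
    | h z w =>
      intro hne x y
      exact hc z w (fun h => hne (Quotient.sound h)) x y
  let desc : LS R →* (Quotient R → V) :=
    { toFun := fun f c => Quotient.liftOn c f.1 (fun x y hxy => f.2 x y hxy)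
      map_one' := by funext c; induction c using Quotient.inductionOn; rfl
      map_mul' := fun f g => by funext c; induction c using Quotient.inductionOn; rfl }
  refine ⟨(MonoidHom.noncommPiCoprod ψ hψ).comp desc, fun z v => ?_⟩
  have : desc ⟨ind (cls R z) v, cls_mem R z v⟩ = Pi.mulSingle (Quotient.mk R z) v := by
    funext c
    induction c using Quotient.inductionOn with
    | h w =>
      show ind (cls R z) v w = _
      by_cases hw : R w z
      · have : Quotient.mk R w = Quotient.mk R z := Quotient.sound hw
        rw [this, Pi.mulSingle_eq_same]
        exact ind_pos hw _
      · have : Quotient.mk R w ≠ Quotient.mk R z := fun h => hw (Quotient.exact h)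
        rw [Pi.mulSingle_eq_of_ne this]
        exact ind_neg hw _
  rw [MonoidHom.comp_apply, this, MonoidHom.noncommPiCoprod_mulSingle]
  rfl

theorem ls_union (L : ℕ → Subgroup (Z → V)) (mono : ∀ n, L n ≤ L (n+1)) (h : ∀ n, L n →* P)
    (compat : ∀ n f (hf : f ∈ L n), h (n+1) ⟨f, mono n hf⟩ = h n ⟨f, hf⟩)
    (T : Subgroup (Z → V)) (hT : ∀ f, f ∈ T ↔ ∃ n, f ∈ L n) :
    ∃ Λ : T →* P, ∀ n f (hf : f ∈ L n), Λ ⟨f, (hT f).2 ⟨n, hf⟩⟩ = h n ⟨f, hf⟩ := by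
  have hm : Monotone L := monotone_nat_of_le_succ mono
  have c2 : ∀ n m f (hf : f ∈ L n) (hg : f ∈ L m), n ≤ m → h m ⟨f, hg⟩ = h n ⟨f, hf⟩ := by
    intro n m f hf hg hnm
    induction m, hnm using Nat.le_induction with
    | base => rfl
    | succ m hnm ih => rw [← ih (hm hnm hf), ← compat m f (hm hnm hf)]
  have c3 : ∀ n m f (hf : f ∈ L n) (hg : f ∈ L m), h m ⟨f, hg⟩ = h n ⟨f, hf⟩ := by
    intro n m f hf hg
    rcases le_total n m with hnm | hnm
    · exact c2 _ _ _ _ _ hnm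
    · exact (c2 _ _ _ _ _ hnm).symm
  choose N hN using fun f : T => (hT f.1).1 f.2
  refine ⟨⟨⟨fun f => h (N f) ⟨f.1, hN f⟩, ?_⟩, ?_⟩, ?_⟩
  · exact map_one (h _)
  · intro f g
    have hf := hm (le_max_left (N f) (N g)) (hN f)
    have hg := hm (le_max_right (N f) (N g)) (hN g)
    show h (N (f * g)) ⟨f.1 * g.1, _⟩ = h (N f) ⟨f.1, hN f⟩ * h (N g) ⟨g.1, hN g⟩
    rw [← c3 (N f) _ f.1 (hN f) hf, ← c3 (N g) _ g.1 (hN g) hg, ← map_mul]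
    exact c3 _ _ _ _ _
  · intro n f hf
    exact c3 _ _ _ _ _
end

namespace Sys
variable {G : Type} [Group G] {S : Star G} {P : Type} [Group P] (Y : Sys S P)

def δ : V →* P :=
  Y.I.comp { toFun := fun v _ => v, map_one' := rfl, map_mul' := fun _ _ => rfl }

theorem δ_apply (v : V) : Y.δ v = Y.I (fun _ => v) := rfl

theorem δ_U (γ : Gam G) (v : V) : Commute (Y.U γ) (Y.δ v) := Y.Uδ γ v

theorem U_δ_conj (γ : Gam G) (v : V) : Y.U γ * Y.δ v * (Y.U γ)⁻¹ = Y.δ v := by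
  rw [(Y.δ_U γ v).eq]; group

def L (x : G) : (Fin S.k → V) →* P := (MulAut.conj (Y.U (gG x))).toMonoidHom.comp Y.I

theorem L_apply (x : G) (F : Fin S.k → V) : Y.L x F = Y.U (gG x) * Y.I F * (Y.U (gG x))⁻¹ := rfl

theorem L_mul (x y : G) (F : Fin S.k → V) : Y.L (x * y) F = Y.U (gG x) * Y.L y F * (Y.U (gG x))⁻¹ := by
  simp only [L_apply, map_mul]; group

theorem L_one (F : Fin S.k → V) : Y.L 1 F = Y.I F := by simp [L_apply]

theorem L_const (x : G) (v : V) : Y.L x (fun _ => v) = Y.δ v := Y.U_δ_conj _ v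

noncomputable def Ph (x : G) (A : Set (Fin S.k)) : V →* P := (Y.L x).comp (ind A)

theorem Ph_apply (x : G) (A : Set (Fin S.k)) (v : V) : Y.Ph x A v = Y.L x (ind A v) := rfl

theorem Ph_compl (x : G) (A : Set (Fin S.k)) (v : V) : Y.δ v = Y.Ph x A v * Y.Ph x Aᶜ v := by
  rw [Ph_apply, Ph_apply, ← map_mul, ind_compl, L_const]

theorem I_mem0 {f : Fin S.k → V} (hf : ∀ α, ∃ v, f α = cor [false] v) : Y.I f ∈ Y.P0 := by
  have : f ∈ Y.P0.comap Y.I := by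
    apply Subgroup.pi_mem_of_mulSingle_mem
    intro α
    obtain ⟨v, hv⟩ := hf α
    rw [hv]; exact Y.I0 α v
  exact this

theorem I_mem1 {f : Fin S.k → V} (hf : ∀ α, ∃ v, f α = cor [true] v) : Y.I f ∈ Y.P1 := by
  have : f ∈ Y.P1.comap Y.I := by
    apply Subgroup.pi_mem_of_mulSingle_mem
    intro α
    obtain ⟨v, hv⟩ := hf α
    rw [hv]; exact Y.I1 α v
  exact this

theorem ind_cor {Z : Type} (A : Set Z) (w : List Bool) (v : V) (z : Z) : ∃ u, ind A (cor w v) z = cor w u := by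
  by_cases h : z ∈ A
  · exact ⟨v, ind_pos h _⟩
  · exact ⟨1, by rw [ind_neg h, map_one]⟩

theorem Ph_tame (x : G) (A : Set (Fin S.k)) : Tame Y.δ Y.P0 Y.P1 (Y.Ph x A) where
  conj κ v := by
    rw [← Y.L_const x, Ph_apply, Ph_apply, ← map_inv, ← map_mul, ← map_mul, conj_ind]
  m0 v := Y.P0_U _ _ (Y.I_mem0 (ind_cor A _ v))
  m1 v := Y.P1_U _ _ (Y.I_mem1 (ind_cor A _ v))

def reg (S : Star G) (x : G) (A : Set (Fin S.k)) : Set G := {p | S.a (x⁻¹ * p) ∈ A}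

theorem conj_commute {p q r : P} (h : Commute p q) : Commute (r * p * r⁻¹) (r * q * r⁻¹) :=
  h.map (MulAut.conj r)

theorem orth (n : ℕ) : ∀ (y : G), S.ℓ y < n → ∀ (x : G) (A B : Set (Fin S.k)),
    (∀ p, p ∈ reg S x A → p ∉ reg S (x * y) B) → Perp (Y.Ph x A) (Y.Ph (x * y) B) := by
  induction n with
  | zero => intro y hy; omega
  | succ n ih =>
    intro y hy x A B hAB
    have hAB' : ∀ p, S.a p ∈ A → S.a (y⁻¹ * p) ∉ B := by
      intro p h1 h2
      apply hAB (x * p)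
      · show S.a _ ∈ A
        simpa using h1
      · show S.a _ ∈ B
        convert h2 using 2; group
    suffices h : Perp (Y.Ph 1 A) (Y.Ph y B) by
      intro v w
      have h1 := conj_commute (r := Y.U (gG x)) (h v w)
      rw [Ph_apply, Ph_apply, ← L_mul, ← L_mul, mul_one] at h1
      exact h1
    by_cases hD : S.ℓ y ≤ S.D
    · intro v w
      rw [Ph_apply, Ph_apply, L_one]
      have h1 : ∀ α ∈ A, Commute (Y.I (Pi.mulSingle α v)) (Y.L y (ind B w)) := by
        intro α hα
        have : ind B w ∈ (Subgroup.centralizer {Y.I (Pi.mulSingle α v)}).comap (Y.L y) := by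
          apply Subgroup.pi_mem_of_mulSingle_mem
          intro β
          by_cases hβ : β ∈ B
          · rw [Subgroup.mem_comap, Subgroup.mem_centralizer_singleton_iff]
            refine (Y.rel6 α β y hD ?_ v _).symm
            rintro p ⟨rfl, rfl⟩
            exact hAB' p hα hβ
          · rw [ind_neg hβ, Pi.mulSingle_one]; exact one_mem _
        rw [Subgroup.mem_comap, Subgroup.mem_centralizer_singleton_iff] at this
        exact Commute.symm this
      have : ind A v ∈ (Subgroup.centralizer {Y.L y (ind B w)}).comap Y.I := by
        apply Subgroup.pi_mem_of_mulSingle_mem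
        intro α
        by_cases hα : α ∈ A
        · rw [Subgroup.mem_comap, Subgroup.mem_centralizer_singleton_iff, ind_pos hα]
          exact h1 α hα
        · rw [ind_neg hα, Pi.mulSingle_one]; exact one_mem _
      rw [Subgroup.mem_comap, Subgroup.mem_centralizer_singleton_iff] at this
      exact this
    · obtain ⟨z, hz1, hz2, hz3⟩ := S.markov y (by omega)
      let C : Set (Fin S.k) := {c | ∃ p, S.a p ∈ A ∧ S.a (z⁻¹ * p) = c}
      refine perp_trans Y.P_comm (Y.Ph_tame 1 A) (Y.Ph_tame y B) (Y.Ph_compl z C) ?_ ?_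
      · have := ih z (by omega) 1 A Cᶜ
        rw [one_mul] at this
        apply this
        intro p hp hp'
        apply hp'
        exact ⟨p, by simpa [reg] using hp, rfl⟩
      · have := ih (z⁻¹ * y) (by omega) z C B
        rw [mul_inv_cancel_left] at this
        apply this
        rintro p ⟨p', hp', he⟩ hp
        rcases hz3 p' p he with h | h
        · exact hAB' p (by rw [← h]; exact hp') hp
        · exact hAB' p' hp' (by rw [h]; exact hp)

theorem orth' {x y : G} {A B : Set (Fin S.k)} (h : ∀ p, p ∈ reg S x A → p ∉ reg S y B) :
    Perp (Y.Ph x A) (Y.Ph y B) := by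
  have := Y.orth _ (x⁻¹ * y) (Nat.lt_succ_self _) x A B
  rw [mul_inv_cancel_left] at this
  exact this h

theorem reg_compl (x : G) (A : Set (Fin S.k)) : reg S x Aᶜ = (reg S x A)ᶜ := rfl

theorem Ph_uniq {x y : G} {A B : Set (Fin S.k)} (h : reg S x A = reg S y B) : Y.Ph x A = Y.Ph y B := by
  apply perp_uniq (Y.Ph_compl x A) (Y.Ph_compl y B) <;> apply orth' <;> intro p hp hq
  · exact hq hp
  · exact hq hp
  · rw [reg_compl, ← h] at hq; exact hq hp
  · rw [reg_compl, h] at hq; exact hq hp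

end Sys
end HE

namespace HE
open Classical

section
variable {G : Type} [Group G] (S : Star G)

theorem Star.ρ_le {n m : ℕ} (h : n ≤ m) {p p' : G} (hp : (S.ρ m) p p') : (S.ρ n) p p' := by
  induction m, h using Nat.le_induction with
  | base => exact hp
  | succ m _ ih => exact ih (S.ρ_mono m _ _ hp)

theorem Star.cls_reg (n : ℕ) (z : G) : ∃ x A, cls (S.ρ n) z = Sys.reg S x A := by
  cases n with
  | zero =>
    refine ⟨1, Set.univ, ?_⟩
    ext p; exact ⟨fun _ => trivial, fun _ => S.ρ_zero _ _⟩
  | succ n =>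
    obtain ⟨x, hx⟩ := S.ρ_step n z
    refine ⟨x, (fun p => S.a (x⁻¹ * p)) '' (cls (S.ρ (n+1)) z), ?_⟩
    ext p
    constructor
    · exact fun hp => ⟨p, hp, rfl⟩
    · rintro ⟨q, hq, he⟩
      have := hx q p (S.ρ_mono n _ _ hq) he
      exact (S.ρ (n+1)).trans ((S.ρ (n+1)).symm this) hq

/-- Locally constant functions on `G`. -/
def LCG : Subgroup (G → V) where
  carrier := {f | ∃ n, f ∈ LS (S.ρ n)}
  one_mem' := ⟨0, one_mem _⟩
  mul_mem' := by
    rintro f g ⟨n, hn⟩ ⟨m, hm⟩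
    exact ⟨max n m, fun x y h => by
      simp only [Pi.mul_apply]
      rw [hn x y (S.ρ_le (le_max_left _ _) h), hm x y (S.ρ_le (le_max_right _ _) h)]⟩
  inv_mem' := by
    rintro f ⟨n, hn⟩
    exact ⟨n, inv_mem hn⟩

theorem LCG_induct (H : Subgroup (G → V)) {f : G → V} (hf : f ∈ LCG S)
    (h : ∀ x A z, ind (Sys.reg S x A) (f z) ∈ H) : f ∈ H := by
  obtain ⟨n, hn⟩ := hf
  haveI := S.ρ_fin n
  apply LS_induct (S.ρ n) H hn
  intro z
  obtain ⟨x, A, hA⟩ := S.cls_reg n z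
  have := h x A z
  rw [← hA] at this
  exact this

theorem reg_LCG' (y : G) : ∃ n, ∀ F : Fin S.k → V, (fun p => F (S.a (y⁻¹ * p))) ∈ LS (S.ρ n) := by
  obtain ⟨n, hn⟩ := S.ρ_fine y
  exact ⟨n, fun F x x' hx => congrArg F (hn x x' hx)⟩

theorem reg_LCG (y : G) (F : Fin S.k → V) : (fun p => F (S.a (y⁻¹ * p))) ∈ LCG S := by
  obtain ⟨n, hn⟩ := reg_LCG' S y
  exact ⟨n, hn F⟩

theorem ind_reg (y : G) (A : Set (Fin S.k)) (v : V) :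
    ind (Sys.reg S y A) v = fun p => ind A v (S.a (y⁻¹ * p)) := rfl

theorem ind_reg_LCG (y : G) (A : Set (Fin S.k)) (v : V) : ind (Sys.reg S y A) v ∈ LCG S := by
  rw [ind_reg]; exact reg_LCG S y _

/-- Translation of functions. -/
def trn (g : G) : (G → V) →* (G → V) where
  toFun f := fun p => f (g⁻¹ * p)
  map_one' := rfl
  map_mul' _ _ := rfl

theorem trn_ind_reg (g y : G) (A : Set (Fin S.k)) (v : V) :
    trn g (ind (Sys.reg S y A) v) = ind (Sys.reg S (g * y) A) v := by
  funext p
  simp only [ind_reg, trn, MonoidHom.coe_mk, OneHom.coe_mk]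
  congr 2; group

theorem trn_LCG (g : G) {f : G → V} (hf : f ∈ LCG S) : trn g f ∈ LCG S := by
  have : f ∈ (LCG S).comap (trn g) := by
    apply LCG_induct S _ hf
    intro x A z
    rw [Subgroup.mem_comap, trn_ind_reg]
    exact ind_reg_LCG S _ _ _
  exact this

end

/-- Homomorphism pulled to a subgroup of the ambient group as an inductive device. -/
def agree {A P : Type} [Group A] [Group P] {T : Subgroup A} (h k : T →* P) : Subgroup A :=
  (MonoidHom.eqLocus h k).map T.subtype

theorem mem_agree {A P : Type} [Group A] [Group P] {T : Subgroup A} {h k : T →* P} {a : A} :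
    a ∈ agree h k ↔ ∃ ha : a ∈ T, h ⟨a, ha⟩ = k ⟨a, ha⟩ := by
  constructor
  · rintro ⟨⟨b, hb⟩, hb', rfl⟩
    exact ⟨hb, hb'⟩
  · rintro ⟨ha, he⟩
    exact ⟨⟨a, ha⟩, he, rfl⟩

/-- Preimage of a subgroup, in the ambient group. -/
def preim {A P : Type} [Group A] [Group P] {T : Subgroup A} (h : T →* P) (K : Subgroup P) : Subgroup A :=
  (K.comap h).map T.subtype

theorem mem_preim {A P : Type} [Group A] [Group P] {T : Subgroup A} {h : T →* P} {K : Subgroup P} {a : A} :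
    a ∈ preim h K ↔ ∃ ha : a ∈ T, h ⟨a, ha⟩ ∈ K := by
  constructor
  · rintro ⟨⟨b, hb⟩, hb', rfl⟩
    exact ⟨hb, hb'⟩
  · rintro ⟨ha, he⟩
    exact ⟨⟨a, ha⟩, he, rfl⟩

namespace Sys
variable {G : Type} [Group G] {S : Star G} {P : Type} [Group P] (Y : Sys S P)

theorem exists_hn (n : ℕ) : ∃ h : LS (S.ρ n) →* P, ∀ z v x A, cls (S.ρ n) z = reg S x A →
    h ⟨ind (cls (S.ρ n) z) v, cls_mem _ z v⟩ = Y.Ph x A v := by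
  choose x A hA using S.cls_reg n
  haveI := S.ρ_fin n
  obtain ⟨h, hh⟩ := exists_lsHom (S.ρ n) (fun z => Y.Ph (x z) (A z))
    (fun z w hzw => Y.Ph_uniq (by rw [← hA, ← hA, cls_eq hzw]))
    (fun z w hzw => Y.orth' (fun p hp hq => by
      rw [← hA] at hp hq
      exact hzw ((S.ρ n).trans ((S.ρ n).symm hp) hq)))
  refine ⟨h, fun z v x' A' he => ?_⟩
  rw [hh]
  have : reg S (x z) (A z) = reg S x' A' := by rw [← hA, he]
  rw [Y.Ph_uniq this]

noncomputable def hn (n : ℕ) : LS (S.ρ n) →* P := (Y.exists_hn n).choose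
theorem hn_spec (n : ℕ) (z : G) (v : V) (x : G) (A : Set (Fin S.k)) (h : cls (S.ρ n) z = reg S x A)
    (hm : ind (cls (S.ρ n) z) v ∈ LS (S.ρ n)) :
    Y.hn n ⟨ind (cls (S.ρ n) z) v, hm⟩ = Y.Ph x A v := (Y.exists_hn n).choose_spec z v x A h

theorem LS_mono (n : ℕ) : LS (S.ρ n) ≤ LS (S.ρ (n+1)) := fun f hf x y h => hf x y (S.ρ_mono n _ _ h)

theorem surj_mul (x : G) : Function.Surjective fun p => S.a (x⁻¹ * p) := by
  intro α
  obtain ⟨p, hp⟩ := S.surj α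
  exact ⟨x * p, by simpa using hp⟩

theorem hn_compat (n : ℕ) (f : G → V) (hf : f ∈ LS (S.ρ n)) :
    Y.hn (n+1) ⟨f, LS_mono n hf⟩ = Y.hn n ⟨f, hf⟩ := by
  haveI := S.ρ_fin n
  haveI := S.ρ_fin (n+1)
  have : f ∈ agree ((Y.hn (n+1)).comp (Subgroup.inclusion (LS_mono n))) (Y.hn n) := by
    apply LS_induct (S.ρ n) _ hf
    intro z
    rw [mem_agree]
    refine ⟨cls_mem _ _ _, ?_⟩
    obtain ⟨x, hx⟩ := S.ρ_step n z
    generalize f z = v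
    -- the region of the class
    have hreg : ∀ D : Set G, D ⊆ cls (S.ρ n) z → (∀ p q, (S.ρ (n+1)) p q → p ∈ D → q ∈ D) →
        D = reg S x ((fun p => S.a (x⁻¹ * p)) '' D) := by
      intro D hD hD'
      ext p
      constructor
      · exact fun hp => ⟨p, hp, rfl⟩
      · rintro ⟨q, hq, he⟩
        exact hD' q p (hx q p (hD hq) he) hq
    have hA := hreg _ subset_rfl (fun p q hpq hp => (S.ρ n).trans ((S.ρ n).symm (S.ρ_mono n _ _ hpq)) hp)
    set A := (fun p => S.a (x⁻¹ * p)) '' (cls (S.ρ n) z)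
    refine Eq.trans ?_ (Y.hn_spec n z v x A hA (cls_mem _ _ _)).symm
    let H : Subgroup (G → V) :=
      { carrier := {f | ∃ hf : f ∈ LS (S.ρ (n+1)), ∃ F : Fin S.k → V,
          f = (fun p => F (S.a (x⁻¹ * p))) ∧ Y.hn (n+1) ⟨f, hf⟩ = Y.L x F}
        one_mem' := ⟨one_mem _, 1, rfl, by rw [map_one]; exact map_one _⟩
        mul_mem' := by
          rintro f g ⟨hf, F, hF, hF'⟩ ⟨hg, F2, hG, hG'⟩
          refine ⟨mul_mem hf hg, F * F2, ?_, ?_⟩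
          · rw [hF, hG]; rfl
          · rw [map_mul, ← hF', ← hG', ← map_mul]; rfl
        inv_mem' := by
          rintro f ⟨hf, F, hF, hF'⟩
          refine ⟨inv_mem hf, F⁻¹, ?_, ?_⟩
          · rw [hF]; rfl
          · rw [map_inv, ← hF', ← map_inv]; rfl }
    have : ind (cls (S.ρ n) z) v ∈ H := by
      apply LS_induct (S.ρ (n+1)) H (LS_mono n (cls_mem _ _ _))
      intro z'
      by_cases hz' : z' ∈ cls (S.ρ n) z
      · rw [ind_pos hz']
        have hA' := hreg (cls (S.ρ (n+1)) z')
          (fun p hp => (S.ρ n).trans (S.ρ_mono n _ _ hp) hz')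
          (fun p q hpq hp => (S.ρ (n+1)).trans ((S.ρ (n+1)).symm hpq) hp)
        set A' := (fun p => S.a (x⁻¹ * p)) '' (cls (S.ρ (n+1)) z')
        refine ⟨cls_mem _ _ _, ind A' v, ?_, Y.hn_spec (n+1) z' v x A' hA' (cls_mem _ _ _)⟩
        show ind (cls (S.ρ (n+1)) z') v = _
        rw [hA', ind_reg]
      · rw [ind_neg hz', map_one]
        exact one_mem _
    obtain ⟨_, F, hF, hF'⟩ := this
    have hFA : F = ind A v := by
      funext α
      obtain ⟨p, rfl⟩ := surj_mul x α
      have := congrFun hF p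
      rw [hA, ind_reg] at this
      exact this.symm
    refine Eq.trans hF' ?_
    rw [hFA]; rfl
  obtain ⟨_, h⟩ := mem_agree.1 this
  exact h

theorem hn_const (n : ℕ) (v : V) (hv : (fun _ => v) ∈ LS (S.ρ n)) : Y.hn n ⟨fun _ => v, hv⟩ = Y.δ v := by
  induction n with
  | zero =>
    have h0 : cls (S.ρ 0) 1 = Set.univ := by
      ext p; exact ⟨fun _ => trivial, fun _ => S.ρ_zero _ _⟩
    have := Y.hn_spec 0 1 v 1 Set.univ h0
    rw [h0, ind_univ] at this
    rw [this hv, Ph_apply, ind_univ, L_const]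
  | succ n ih =>
    rw [← ih (fun _ _ _ => rfl)]
    exact Y.hn_compat n _ _

theorem hn_loc (n : ℕ) (y : G) (hny : ∀ p p', (S.ρ n) p p' → S.a (y⁻¹ * p) = S.a (y⁻¹ * p'))
    (F : Fin S.k → V) (hF : (fun p => F (S.a (y⁻¹ * p))) ∈ LS (S.ρ n)) :
    Y.hn n ⟨_, hF⟩ = Y.L y F := by
  haveI := S.ρ_fin n
  have mem : ∀ F : Fin S.k → V, (fun p => F (S.a (y⁻¹ * p))) ∈ LS (S.ρ n) :=
    fun F x x' hx => congrArg F (hny x x' hx)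
  let Q : (Fin S.k → V) →* P := (Y.hn n).comp
    { toFun := fun F => ⟨_, mem F⟩, map_one' := rfl, map_mul' := fun _ _ => rfl }
  have Qc : ∀ v, Q (fun _ => v) = Y.δ v := fun v => Y.hn_const n v _
  have Qd : ∀ A v, Y.δ v = (Q.comp (ind A)) v * (Q.comp (ind Aᶜ)) v := by
    intro A v
    have h1 := Q.map_mul (ind A v) (ind Aᶜ v)
    rw [ind_compl, Qc] at h1
    exact h1
  have Qo : ∀ A B : Set (Fin S.k), (∀ α, α ∈ A → α ∉ B) → Perp (Q.comp (ind A)) (Y.Ph y B) := by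
    intro A B hAB v w
    have : ind (reg S y A) v ∈ preim (Y.hn n) (Subgroup.centralizer {Y.Ph y B w}) := by
      apply LS_induct (S.ρ n) _ (mem (ind A v))
      intro z
      by_cases hz : z ∈ reg S y A
      · obtain ⟨x, A', hA'⟩ := S.cls_reg n z
        rw [mem_preim]
        refine ⟨cls_mem _ _ _, ?_⟩
        rw [Subgroup.mem_centralizer_singleton_iff]
        have := Y.hn_spec n z (ind (reg S y A) v z) x A' hA' (cls_mem _ _ _)
        refine (congrArg (fun t => t * Y.Ph y B w) this).trans
          (Eq.trans ?_ (congrArg (fun t => Y.Ph y B w * t) this).symm)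
        refine (Y.orth' ?_ _ _ : Commute (Y.Ph x A' _) (Y.Ph y B w))
        intro p hp hq
        rw [← hA'] at hp
        have h1 := hny p z hp
        have hz' : S.a (y⁻¹ * z) ∈ A := hz
        rw [← h1] at hz'
        exact hAB _ hz' hq
      · have h1 : ind A v (S.a (y⁻¹ * z)) = 1 := ind_neg hz v
        rw [h1, map_one]
        exact one_mem _
    obtain ⟨_, h⟩ := mem_preim.1 this
    rw [Subgroup.mem_centralizer_singleton_iff] at h
    exact h
  have key : ∀ A, Q.comp (ind A) = Y.Ph y A := by
    intro A
    refine perp_uniq (Qd A) (Y.Ph_compl y A) ?_ ?_ (Qo A Aᶜ (fun α h h' => h' h)) ?_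
    · intro v w
      exact (ind_disj (A := A) (B := Aᶜ) (fun z h h' => h' h) v w).map Q
    · exact Y.orth' (fun p h h' => h' h)
    · exact (Qo Aᶜ A (fun α h h' => h h')).symm
  have : F ∈ MonoidHom.eqLocus Q (Y.L y) := by
    apply Subgroup.pi_mem_of_mulSingle_mem
    intro α
    rw [← ind_single]
    exact DFunLike.congr_fun (key {α}) (F α)
  exact this

theorem exists_LamG : ∃ Λ : LCG S →* P, ∀ y F, Λ ⟨_, reg_LCG S y F⟩ = Y.L y F := by
  obtain ⟨Λ, h⟩ := ls_union (fun n => LS (S.ρ n)) LS_mono Y.hn (fun n f hf => Y.hn_compat n f hf) (LCG S)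
    (fun f => Iff.rfl)
  refine ⟨Λ, fun y F => ?_⟩
  obtain ⟨n, hn⟩ := S.ρ_fine y
  rw [h n _ (fun x x' hx => congrArg F (hn x x' hx) : (fun p => F (S.a (y⁻¹ * p))) ∈ LS (S.ρ n))]
  exact Y.hn_loc n y hn F _

noncomputable def LamG : LCG S →* P := Y.exists_LamG.choose
theorem LamG_loc (y : G) (F : Fin S.k → V) (hF) : Y.LamG ⟨fun p => F (S.a (y⁻¹ * p)), hF⟩ = Y.L y F :=
  Y.exists_LamG.choose_spec y F

theorem LamG_reg (y : G) (A : Set (Fin S.k)) (v : V) (h) :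
    Y.LamG ⟨ind (reg S y A) v, h⟩ = Y.Ph y A v := Y.LamG_loc y (ind A v) h

theorem LamG_const (v : V) (h) : Y.LamG ⟨fun _ => v, h⟩ = Y.δ v := by
  rw [← Y.L_const 1]; exact Y.LamG_loc 1 (fun _ => v) h

theorem LamG_one (v : V) (h) : Y.LamG ⟨ind {1} v, h⟩ = Y.I (Pi.mulSingle (S.a 1) v) := by
  have h1 : ({1} : Set G) = reg S 1 {S.a 1} := by
    ext p
    simp only [Set.mem_singleton_iff, reg, inv_one, one_mul, Set.mem_ofPred_eq]
    exact ⟨fun h => by rw [h], S.isol p⟩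
  rw [← L_one, ← ind_single, ← Ph_apply, ← Y.LamG_reg 1 {S.a 1} v (by rw [← h1]; exact h)]
  congr 2
  rw [h1]

theorem LamG_mem {f : G → V} (hf : f ∈ LCG S) (w : List Bool) (K : Subgroup P)
    (hK : ∀ x A v, Y.Ph x A (cor w v) ∈ K)
    (h : ∀ p, ∃ v, f p = cor w v) : Y.LamG ⟨f, hf⟩ ∈ K := by
  have : f ∈ preim Y.LamG K := by
    apply LCG_induct S _ hf
    intro x A z
    obtain ⟨v, hv⟩ := h z
    rw [hv, mem_preim]
    exact ⟨ind_reg_LCG S _ _ _, by rw [LamG_reg]; exact hK x A v⟩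
  exact (mem_preim.1 this).2

theorem LamG_equiv (g : G) {f : G → V} (hf : f ∈ LCG S) :
    Y.LamG ⟨trn g f, trn_LCG S g hf⟩ = Y.U (gG g) * Y.LamG ⟨f, hf⟩ * (Y.U (gG g))⁻¹ := by
  have : f ∈ agree (Y.LamG.comp (((trn g).comp (LCG S).subtype).codRestrict (LCG S) (fun f => trn_LCG S g f.2)))
      ((MulAut.conj (Y.U (gG g))).toMonoidHom.comp Y.LamG) := by
    apply LCG_induct S _ hf
    intro x A z
    generalize f z = v
    rw [mem_agree]
    refine ⟨ind_reg_LCG S _ _ _, ?_⟩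
    show Y.LamG ⟨trn g (ind (reg S x A) v), _⟩ = Y.U (gG g) * Y.LamG ⟨ind (reg S x A) v, _⟩ * (Y.U (gG g))⁻¹
    rw [LamG_reg, Ph_apply, ← L_mul, ← Ph_apply, ← LamG_reg _ _ _ _ (ind_reg_LCG S _ _ _)]
    congr 2
    exact trn_ind_reg S g x A v
  exact (mem_agree.1 this).2

end Sys
end HE

namespace HE
open Classical

section
variable {G : Type} [Group G] (S : Star G)

theorem Star.exists_sing (g : G) : ∃ n, ∀ p, (S.ρ n) p g → p = g := by
  obtain ⟨n, hn⟩ := S.ρ_fine g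
  refine ⟨n, fun p hp => ?_⟩
  have := hn p g hp
  rw [inv_mul_cancel] at this
  exact (inv_mul_eq_one.1 (S.isol _ this)).symm

noncomputable def Star.n0 : ℕ := (S.exists_sing 1).choose
theorem Star.n0_spec (p : G) (h : (S.ρ S.n0) p 1) : p = 1 := (S.exists_sing 1).choose_spec p h

/-- The shifted sequence of partitions. -/
noncomputable def Star.r (n : ℕ) : Setoid G := S.ρ (S.n0 + n)

theorem Star.r_le {n m : ℕ} (h : n ≤ m) {p p' : G} (hp : (S.r m) p p') : (S.r n) p p' :=
  S.ρ_le (by omega) hp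

def Star.Sing (n : ℕ) (g : G) : Prop := ∀ p, (S.r n) p g → p = g

theorem Star.sing_one (n : ℕ) : S.Sing n 1 := fun p hp => S.n0_spec p (S.ρ_le (by omega) hp)

theorem Star.sing_mono {n m : ℕ} (h : n ≤ m) {g : G} (hg : S.Sing n g) : S.Sing m g :=
  fun p hp => hg p (S.r_le h hp)

theorem Star.sing_ex (g : G) : ∃ n, S.Sing n g := by
  obtain ⟨n, hn⟩ := S.exists_sing g
  exact ⟨n, fun p hp => hn p (S.ρ_le (by omega) hp)⟩

theorem Star.sing_rel {n : ℕ} {p q : G} (h : (S.r n) p q) (hp : S.Sing n p) : q = p :=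
  hp q ((S.r n).symm h)

def RRr : ℕ → XX G → XX G → Prop
  | 0, x, x' => (S.r 0) x.hd x'.hd
  | n+1, x, x' => (S.r (n+1)) x.hd x'.hd ∧ (S.Sing (n+1) x.hd → RRr n (sh x) (sh x'))

theorem RRr_hd {n : ℕ} {x x' : XX G} (h : RRr S n x x') : (S.r n) x.hd x'.hd := by
  cases n with
  | zero => exact h
  | succ n => exact h.1

theorem RRr_equiv (n : ℕ) : Equivalence (RRr S n) := by
  induction n with
  | zero => exact ⟨fun x => (S.r 0).refl _, fun h => (S.r 0).symm h, fun h h' => (S.r 0).trans h h'⟩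
  | succ n ih =>
    refine ⟨fun x => ⟨(S.r (n+1)).refl _, fun _ => ih.refl _⟩, ?_, ?_⟩
    · rintro x y ⟨h1, h2⟩
      refine ⟨(S.r (n+1)).symm h1, fun hs => ih.symm (h2 ?_)⟩
      rw [hs _ h1]; exact hs
    · rintro x y z ⟨h1, h2⟩ ⟨h3, h4⟩
      refine ⟨(S.r (n+1)).trans h1 h3, fun hs => ih.trans (h2 hs) (h4 ?_)⟩
      rw [S.sing_rel h1 hs]; exact hs

/-- The partitions of `XX G`. -/
def RR (n : ℕ) : Setoid (XX G) := ⟨RRr S n, RRr_equiv S n⟩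

theorem RR_hd {n : ℕ} {x x' : XX G} (h : (RR S n) x x') : (S.r n) x.hd x'.hd := RRr_hd S h

theorem RR_succ {n : ℕ} {x x' : XX G} : (RR S (n+1)) x x' ↔
    (S.r (n+1)) x.hd x'.hd ∧ (S.Sing (n+1) x.hd → (RR S n) (sh x) (sh x')) := Iff.rfl

theorem RR_U {n : ℕ} {x x' : XX G} (h : (RR S n) x x') (hx : x.hd = 1) : x'.hd = 1 := by
  have h1 := RR_hd S h
  rw [hx] at h1
  exact S.sing_rel h1 (S.sing_one n)

theorem RR_mono (n : ℕ) {x x' : XX G} (h : (RR S (n+1)) x x') : (RR S n) x x' := by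
  induction n generalizing x x' with
  | zero => exact S.r_le (by omega) (RR_hd S h)
  | succ n ih =>
    refine ⟨S.r_le (by omega) (RR_hd S h), fun hs => ih (h.2 (S.sing_mono (by omega) hs))⟩

theorem RR_le {n m : ℕ} (h : n ≤ m) {x x' : XX G} (hp : (RR S m) x x') : (RR S n) x x' := by
  induction m, h using Nat.le_induction with
  | base => exact hp
  | succ m _ ih => exact ih (RR_mono S m hp)

theorem finite_of_map {Z : Type} {F : Type} [Finite F] (R : Setoid Z) (c : Z → F) (h : ∀ x y, c x = c y → R x y) :
    Finite (Quotient R) := by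
  apply Finite.of_injective (fun q : Quotient R => c q.out)
  intro q q' hq
  have := Quotient.sound (s := R) (h _ _ hq)
  simpa using this

theorem RR_fin (n : ℕ) : Finite (Quotient (RR S n)) := by
  induction n with
  | zero =>
    haveI : Finite (Quotient (S.r 0)) := S.ρ_fin _
    exact finite_of_map _ (fun x => Quotient.mk (S.r 0) x.hd) (fun x y h => (Quotient.exact h : (S.r 0) x.hd y.hd))
  | succ n ih =>
    haveI : Finite (Quotient (S.r (n+1))) := S.ρ_fin _
    refine finite_of_map _ (fun x => (Quotient.mk (S.r (n+1)) x.hd, Quotient.mk (RR S n) (sh x))) ?_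
    intro x y h
    exact ⟨Quotient.exact (Prod.ext_iff.1 h).1, fun _ => Quotient.exact (Prod.ext_iff.1 h).2⟩

theorem LSR_mono (n : ℕ) : LS (RR S n) ≤ LS (RR S (n+1)) := fun f hf x y h => hf x y (RR_mono S n h)

/-- Locally constant functions on `XX G`. -/
def LCX : Subgroup (XX G → V) where
  carrier := {f | ∃ n, f ∈ LS (RR S n)}
  one_mem' := ⟨0, one_mem _⟩
  mul_mem' := by
    rintro f g ⟨n, hn⟩ ⟨m, hm⟩
    exact ⟨max n m, fun x y h => by
      simp only [Pi.mul_apply]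
      rw [hn x y (RR_le S (le_max_left _ _) h), hm x y (RR_le S (le_max_right _ _) h)]⟩
  inv_mem' := by
    rintro f ⟨n, hn⟩
    exact ⟨n, inv_mem hn⟩

variable {S}

/-- Action on functions. -/
noncomputable def actF (γ : Gam G) : (XX G → V) →* (XX G → V) where
  toFun f := fun x => f (act γ⁻¹ x)
  map_one' := rfl
  map_mul' _ _ := rfl

theorem actF_apply (γ : Gam G) (f : XX G → V) (x : XX G) : actF γ f x = f (act γ⁻¹ x) := rfl
theorem actF_act (γ : Gam G) (f : XX G → V) (x : XX G) : actF γ f (act γ x) = f x := by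
  rw [actF_apply, act_inv_act]
theorem actF_mul (γ η : Gam G) (f : XX G → V) : actF (γ * η) f = actF γ (actF η f) := by
  funext x; simp only [actF_apply, mul_inv_rev, act_mul]
theorem actF_one (f : XX G → V) : actF 1 f = f := by
  funext x; simp only [actF_apply, inv_one, act_one]

theorem act_inv_GT {g : G} {x : XX G} (h : x.hd = g) : act (gG g * gT)⁻¹ x = sh x := by
  have := act_inv_act (gG g * gT) (sh x)
  subst h
  rwa [act_GT_sh] at this

theorem hd_inv_GT {g : G} {x : XX G} (h : x.hd ≠ g) : (act (gG g * gT)⁻¹ x).hd = 1 := by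
  rw [mul_inv_rev, gT_inv, act_mul, ← map_inv, act_G, act_T, tf_ne]
  intro h'
  apply h
  exact (inv_mul_eq_one.1 h').symm

/-- support in the complement of `U`. -/
def OffU (f : XX G → V) : Prop := ∀ x, x.hd = 1 → f x = 1

theorem actF_GT_one {g : G} {f : XX G → V} (hf : OffU f) {x : XX G} (h : x.hd ≠ g) :
    actF (gG g * gT) f x = 1 := hf _ (hd_inv_GT h)
theorem actF_GT {g : G} {f : XX G → V} {x : XX G} (h : x.hd = g) :
    actF (gG g * gT) f x = f (sh x) := by rw [actF_apply, act_inv_GT h]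

variable (S)

theorem actF_GT_mem {n : ℕ} {g : G} (hg : S.Sing (n+1) g) {f : XX G → V} (hf : f ∈ LS (RR S n)) (h1 : OffU f) :
    actF (gG g * gT) f ∈ LS (RR S (n+1)) := by
  intro x x' hx
  by_cases h : x.hd = g
  · have h2 : x'.hd = x.hd := S.sing_rel hx.1 (by rw [h]; exact hg)
    rw [actF_GT h, actF_GT (h2.trans h)]
    exact hf _ _ (hx.2 (by rw [h]; exact hg))
  · have h2 : x'.hd ≠ g := by
      intro h2
      apply h
      have := hx.1
      rw [h2] at this
      exact hg _ this
    rw [actF_GT_one h1 h, actF_GT_one h1 h2]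

/-- Pull back by `gt`, cut off at `U`. -/
noncomputable def pb (g : G) : (XX G → V) →* (XX G → V) where
  toFun f := fun x => if x.hd = 1 then 1 else f (act (gG g * gT) x)
  map_one' := by funext x; simp
  map_mul' f f' := by funext x; by_cases h : x.hd = 1 <;> simp [h]

theorem pb_off (g : G) (f : XX G → V) : OffU (pb g f) := fun x hx => if_pos hx
theorem pb_ne {g : G} {f : XX G → V} {x : XX G} (h : x.hd ≠ 1) : pb g f x = f (act (gG g * gT) x) := if_neg h

theorem hd_GT {g : G} {x : XX G} (h : x.hd ≠ 1) : (act (gG g * gT) x).hd = g := by rw [act_GT h]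

theorem pb_mem {n : ℕ} {g : G} {f : XX G → V} (hf : f ∈ LS (RR S (n+1))) :
    pb g f ∈ LS (RR S n) := by
  intro x x' hx
  by_cases h : x.hd = 1
  · rw [pb_off g f x h, pb_off g f x' (RR_U S hx h)]
  · have h' : x'.hd ≠ 1 := fun h' => h (RR_U S ((RR S n).symm hx) h')
    rw [pb_ne h, pb_ne h']
    apply hf
    refine ⟨?_, fun _ => ?_⟩
    · rw [hd_GT h, hd_GT h']
    · rw [sh_GT h, sh_GT h']; exact hx

theorem pb_actF {g : G} {f : XX G → V} (h1 : OffU f) : pb g (actF (gG g * gT) f) = f := by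
  funext x
  by_cases h : x.hd = 1
  · rw [pb_off _ _ _ h, h1 x h]
  · rw [pb_ne h, actF_act]

/-- Pull back along `hd`. -/
def hdF : (G → V) →* (XX G → V) where
  toFun u := fun x => u x.hd
  map_one' := rfl
  map_mul' _ _ := rfl

theorem hdF_apply (u : G → V) (x : XX G) : hdF u x = u x.hd := rfl

theorem hdF_mem {n : ℕ} {u : G → V} (hu : u ∈ LS (S.r n)) : hdF u ∈ LS (RR S n) :=
  fun x x' hx => hu _ _ (RR_hd S hx)

theorem r_LCG {n : ℕ} {u : G → V} (hu : u ∈ LS (S.r n)) : u ∈ LCG S := ⟨_, hu⟩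

theorem LCG_r {u : G → V} (hu : u ∈ LCG S) : ∃ n, u ∈ LS (S.r n) := by
  obtain ⟨n, hn⟩ := hu
  exact ⟨n, fun x y h => hn x y (S.ρ_le (by omega) h)⟩

/-- The non-singular part. -/
noncomputable def ns (σ : ℕ → Lt G) (n : ℕ) : (XX G → V) →* (G → V) where
  toFun f := fun p => if S.Sing n p then 1 else f ⟨p, σ⟩
  map_one' := by funext x; simp
  map_mul' f f' := by funext x; by_cases h : S.Sing n x <;> simp [h]

theorem ns_pos {σ : ℕ → Lt G} {n : ℕ} {f : XX G → V} {p : G} (h : S.Sing n p) : ns S σ n f p = 1 := if_pos h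
theorem ns_neg {σ : ℕ → Lt G} {n : ℕ} {f : XX G → V} {p : G} (h : ¬ S.Sing n p) : ns S σ n f p = f ⟨p, σ⟩ := if_neg h

theorem ns_mem {σ : ℕ → Lt G} {n : ℕ} {f : XX G → V} (hf : f ∈ LS (RR S (n+1))) :
    ns S σ (n+1) f ∈ LS (S.r (n+1)) := by
  intro p p' hp
  by_cases h : S.Sing (n+1) p
  · rw [S.sing_rel hp h]
  · have h' : ¬ S.Sing (n+1) p' := by
      intro h'
      have := h' _ hp
      rw [this] at h
      exact h h'
    rw [ns_neg S h, ns_neg S h']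
    exact hf _ _ ⟨hp, fun hs => absurd hs h⟩

theorem sing_finite (n : ℕ) : Finite {g // S.Sing n g} := by
  haveI : Finite (Quotient (S.r n)) := S.ρ_fin _
  apply Finite.of_injective (fun g : {g // S.Sing n g} => Quotient.mk (S.r n) g.1)
  intro g g' h
  exact Subtype.ext (g'.2 _ (Quotient.exact h))

end

section
theorem exists_prodHom {A P ι : Type} [Group A] [Group P] [Finite ι] (θ : ι → A →* P)
    (hc : ∀ i j, i ≠ j → ∀ a b, Commute (θ i a) (θ j b)) :
    ∃ Θ : A →* P, (∀ i a, (∀ j, j ≠ i → θ j a = 1) → Θ a = θ i a) ∧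
      (∀ (K : Subgroup P) a, (∀ i, θ i a ∈ K) → Θ a ∈ K) := by
  haveI := Fintype.ofFinite ι
  have hc' : Pairwise fun i j => ∀ (x : A) (y : A), Commute (θ i x) (θ j y) := fun i j h => hc i j h
  refine ⟨(MonoidHom.noncommPiCoprod θ hc').comp (MonoidHom.pi (fun _ => MonoidHom.id A)), ?_, ?_⟩
  · intro i a h
    rw [MonoidHom.comp_apply, ← MonoidHom.noncommPiCoprod_mulSingle (ϕ := θ) (hcomm := hc') i a,
      MonoidHom.noncommPiCoprod_apply, MonoidHom.noncommPiCoprod_apply]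
    apply Finset.noncommProd_congr rfl
    intro j _
    by_cases hj : j = i
    · subst hj; simp
    · rw [Pi.mulSingle_eq_of_ne hj, map_one]
      exact h j hj
  · intro K a h
    rw [MonoidHom.comp_apply, MonoidHom.noncommPiCoprod_apply]
    apply Subgroup.noncommProd_mem
    intro i _
    exact h i
end
end HE

namespace HE
open Classical

namespace Sys
variable {G : Type} [Group G] {S : Star G} {P : Type} [Group P] (Y : Sys S P)

theorem mem_sing {n : ℕ} {g : G} (hg : S.Sing n g) (v : V) : ind {g} v ∈ LS (S.r n) := by
  apply LS_ind
  intro x y h hx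
  have hx' : x = g := hx
  subst hx'
  exact S.sing_rel h hg

theorem mem_sing_compl {n : ℕ} {g : G} (hg : S.Sing n g) (v : V) : ind {g}ᶜ v ∈ LS (S.r n) := by
  apply LS_ind
  intro x y h hx hy
  apply hx
  have hy' : y = g := hy
  subst hy'
  exact hg _ h

theorem ex_sing (g : G) (v : V) : ind {g} v ∈ LCG S := by
  obtain ⟨n, hn⟩ := S.sing_ex g
  exact r_LCG S (mem_sing hn v)

theorem ex_sing_compl (g : G) (v : V) : ind {g}ᶜ v ∈ LCG S := by
  obtain ⟨n, hn⟩ := S.sing_ex g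
  exact r_LCG S (mem_sing_compl hn v)

theorem const_LCG (v : V) : (fun _ => v) ∈ LCG S := ⟨0, fun _ _ _ => rfl⟩

theorem LamG_mul {f g : G → V} (hf : f ∈ LCG S) (hg : g ∈ LCG S) (h) :
    Y.LamG ⟨f * g, h⟩ = Y.LamG ⟨f, hf⟩ * Y.LamG ⟨g, hg⟩ := by rw [← map_mul]; rfl

theorem LamG_congr {f g : G → V} (hf : f ∈ LCG S) (h : f = g) : Y.LamG ⟨f, hf⟩ = Y.LamG ⟨g, h ▸ hf⟩ := by
  subst h; rfl

theorem LamG_split (g : G) (v : V) :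
    Y.δ v = Y.LamG ⟨ind {g} v, ex_sing g v⟩ * Y.LamG ⟨ind {g}ᶜ v, ex_sing_compl g v⟩ := by
  rw [← LamG_const Y v (const_LCG v), ← LamG_mul Y _ _ (by rw [ind_compl]; exact const_LCG v)]
  exact Y.LamG_congr _ (ind_compl _ _).symm

theorem trn_sing (g : G) (v : V) : trn g (ind {1} v) = ind {g} v := by
  funext p
  show ind {1} v (g⁻¹ * p) = ind {g} v p
  by_cases h : p = g
  · subst h; simp [ind_apply]
  · rw [ind_neg, ind_neg]
    · exact h
    · intro h'
      exact h (inv_mul_eq_one.1 h').symm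

theorem LamG_t (v : V) : Y.U gT * Y.LamG ⟨ind {1} v, ex_sing 1 v⟩ * (Y.U gT)⁻¹ =
    Y.LamG ⟨ind {1}ᶜ v, ex_sing_compl 1 v⟩ := by
  have h0 := (ind_disj (A := ({1} : Set G)) (B := {1}ᶜ) (fun z h h' => h' h) v v)
  have h1 : Commute (Y.LamG ⟨ind {1} v, ex_sing 1 v⟩) (Y.LamG ⟨ind {1}ᶜ v, ex_sing_compl 1 v⟩) :=
    Commute.map (Subtype.ext h0 : Commute (⟨ind {1} v, ex_sing 1 v⟩ : LCG S) ⟨ind {1}ᶜ v, ex_sing_compl 1 v⟩) Y.LamG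
  have h2 := Y.LamG_split 1 v
  rw [LamG_one, rel7, ← δ_apply, ← Y.LamG_one v (ex_sing 1 v), h2, h1.eq]
  group

theorem LamG_g (g : G) (v : V) : Y.U (gG g) * Y.LamG ⟨ind {1} v, ex_sing 1 v⟩ * (Y.U (gG g))⁻¹ =
    Y.LamG ⟨ind {g} v, ex_sing g v⟩ := by
  rw [← Y.LamG_equiv]
  exact Y.LamG_congr _ (trn_sing g v)

theorem LamG_gc (g : G) (v : V) : Y.U (gG g) * Y.LamG ⟨ind {1}ᶜ v, ex_sing_compl 1 v⟩ * (Y.U (gG g))⁻¹ =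
    Y.LamG ⟨ind {g}ᶜ v, ex_sing_compl g v⟩ := by
  have h1 := Y.LamG_split 1 v
  have h2 := Y.LamG_split g v
  rw [← LamG_g, ← Y.U_δ_conj (gG g), h1] at h2
  have h3 : Y.U (gG g) * (Y.LamG ⟨ind {1} v, ex_sing 1 v⟩ * Y.LamG ⟨ind {1}ᶜ v, ex_sing_compl 1 v⟩) * (Y.U (gG g))⁻¹
    = (Y.U (gG g) * Y.LamG ⟨ind {1} v, ex_sing 1 v⟩ * (Y.U (gG g))⁻¹) *
      (Y.U (gG g) * Y.LamG ⟨ind {1}ᶜ v, ex_sing_compl 1 v⟩ * (Y.U (gG g))⁻¹) := by group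
  rw [h3] at h2
  exact mul_left_cancel h2

theorem LamG_gt (g : G) (v : V) : Y.U (gG g * gT) * Y.LamG ⟨ind {1} v, ex_sing 1 v⟩ * (Y.U (gG g * gT))⁻¹ =
    Y.LamG ⟨ind {g}ᶜ v, ex_sing_compl g v⟩ := by
  rw [← LamG_gc, ← LamG_t, map_mul]; group

theorem LamG_gtc (g : G) (v : V) : Y.U (gG g * gT) * Y.LamG ⟨ind {1}ᶜ v, ex_sing_compl 1 v⟩ * (Y.U (gG g * gT))⁻¹ =
    Y.LamG ⟨ind {g} v, ex_sing g v⟩ := by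
  have h1 : (Y.U gT) * Y.U gT = 1 := by rw [← map_mul, gT_sq, map_one]
  have h2 : (Y.U gT)⁻¹ = Y.U gT := inv_eq_of_mul_eq_one_left h1
  rw [← LamG_t, ← Y.LamG_g g, map_mul]
  generalize Y.LamG ⟨ind {1} v, ex_sing 1 v⟩ = q
  calc Y.U (gG g) * Y.U gT * (Y.U gT * q * (Y.U gT)⁻¹) * (Y.U (gG g) * Y.U gT)⁻¹
      = Y.U (gG g) * (Y.U gT * Y.U gT) * q * ((Y.U gT)⁻¹ * (Y.U gT)⁻¹) * (Y.U (gG g))⁻¹ := by group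
    _ = _ := by rw [h2, h1]; group

/-- A homomorphism on the functions of level `n`. -/
structure Stg (n : ℕ) where
  h : LS (RR S n) →* P
  hu : ∀ u (hu : u ∈ LS (S.r n)), h ⟨hdF u, hdF_mem S hu⟩ = Y.LamG ⟨u, r_LCG S hu⟩
  m0 : ∀ f (hf : f ∈ LS (RR S n)), (∀ x, ∃ v, f x = cor [false] v) → h ⟨f, hf⟩ ∈ Y.P0
  m1 : ∀ f (hf : f ∈ LS (RR S n)), (∀ x, ∃ v, f x = cor [true] v) → h ⟨f, hf⟩ ∈ Y.P1

namespace Stg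
variable {Y} {n : ℕ} (T : Y.Stg n)

/-- conjugated homomorphism -/
noncomputable def tw (g : G) : LS (RR S n) →* P := (MulAut.conj (Y.U (gG g * gT))).toMonoidHom.comp T.h

theorem tw_apply (g : G) (f : LS (RR S n)) : T.tw g f = Y.U (gG g * gT) * T.h f * (Y.U (gG g * gT))⁻¹ := rfl

theorem h_const (v : V) : T.h ⟨fun _ => v, fun _ _ _ => rfl⟩ = Y.δ v := by
  rw [← Y.LamG_const v (const_LCG v)]
  exact T.hu (fun _ => v) (fun _ _ _ => rfl)

theorem tw_const (g : G) (v : V) : T.tw g ⟨fun _ => v, fun _ _ _ => rfl⟩ = Y.δ v := by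
  rw [tw_apply, h_const, U_δ_conj]

/-- classes -/
noncomputable def TT (g : G) (z : XX G) : V →* P :=
  (T.tw g).comp { toFun := fun v => ⟨ind (cls (RR S n) z) v, cls_mem _ _ _⟩
                  map_one' := by apply Subtype.ext; exact map_one _
                  map_mul' := fun v w => by apply Subtype.ext; exact map_mul _ _ _ }

theorem TT_apply (g : G) (z : XX G) (v : V) : T.TT g z v = T.tw g ⟨ind (cls (RR S n) z) v, cls_mem _ _ _⟩ := rfl

theorem TT_tame (g : G) (z : XX G) : Tame Y.δ Y.P0 Y.P1 (T.TT g z) where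
  conj κ v := by
    rw [← T.tw_const g, TT_apply, TT_apply, ← map_inv, ← map_mul, ← map_mul]
    congr 1
    apply Subtype.ext
    exact conj_ind _ _ _
  m0 v := Y.P0_U _ _ (T.m0 _ _ (ind_cor _ _ v))
  m1 v := Y.P1_U _ _ (T.m1 _ _ (ind_cor _ _ v))

/-- the homomorphisms of `LamG` -/
noncomputable def GG (Y : Sys S P) (E : Set G) (hE : ∀ v, ind E v ∈ LCG S) : V →* P :=
  Y.LamG.comp { toFun := fun v => ⟨ind E v, hE v⟩
                map_one' := by apply Subtype.ext; exact map_one _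
                map_mul' := fun v w => by apply Subtype.ext; exact map_mul _ _ _ }

theorem GG_apply (E : Set G) (hE : ∀ v, ind E v ∈ LCG S) (v : V) : GG Y E hE v = Y.LamG ⟨ind E v, hE v⟩ := rfl

theorem GG_tame (E : Set G) (hE : ∀ v, ind E v ∈ LCG S) : Tame Y.δ Y.P0 Y.P1 (GG Y E hE) where
  conj κ v := by
    rw [← Y.LamG_const κ (const_LCG κ), GG_apply, GG_apply, ← map_inv, ← map_mul, ← map_mul]
    congr 1
    apply Subtype.ext
    exact conj_ind _ _ _
  m0 v := Y.LamG_mem _ [false] _ (fun x A v => (Y.Ph_tame x A).m0 v) (ind_cor _ _ v)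
  m1 v := Y.LamG_mem _ [true] _ (fun x A v => (Y.Ph_tame x A).m1 v) (ind_cor _ _ v)

theorem GG_disj {E E' : Set G} {hE : ∀ v, ind E v ∈ LCG S} {hE' : ∀ v, ind E' v ∈ LCG S}
    (h : ∀ z, z ∈ E → z ∉ E') : Perp (GG Y E hE) (GG Y E' hE') := fun v w =>
  Commute.map (Subtype.ext (ind_disj h v w) : Commute (⟨ind E v, hE v⟩ : LCG S) ⟨ind E' w, hE' w⟩) Y.LamG

theorem TT_perp0 (g : G) {z : XX G} (hz : z.hd ≠ 1) : Perp (T.TT g z) (GG Y {g}ᶜ (ex_sing_compl g)) := by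
  intro v w
  rw [TT_apply, GG_apply, tw_apply, ← Y.LamG_gt]
  apply conj_commute
  rw [← T.hu (ind {1} w) (mem_sing (S.sing_one n) w)]
  refine Commute.map (Subtype.ext (commute_disj (fun x => ?_)) :
    Commute (⟨ind (cls (RR S n) z) v, cls_mem _ _ _⟩ : LS (RR S n))
     ⟨hdF (ind {1} w), hdF_mem S (mem_sing (S.sing_one n) w)⟩) T.h
  by_cases hx : x.hd = 1
  · left
    apply ind_neg
    intro h
    exact hz (RR_U S h hx)
  · right
    exact ind_neg hx _

theorem TT_perpE (g : G) {z : XX G} (hz : z.hd ≠ 1) {E : Set G} (hE : ∀ v, ind E v ∈ LCG S) (hg : g ∉ E) :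
    Perp (T.TT g z) (GG Y E hE) :=
  perp_trans Y.P_comm (T.TT_tame g z) (GG_tame E hE) (Y.LamG_split g) (Ψ := GG Y {g} (ex_sing g))
    (T.TT_perp0 g hz) (GG_disj (fun x hx hx' => hg (by rw [← (hx : x = g)]; exact hx')))

theorem TT_perp {g g' : G} (hgg : g ≠ g') {z z' : XX G} (hz : z.hd ≠ 1) (hz' : z'.hd ≠ 1) :
    Perp (T.TT g z) (T.TT g' z') :=
  perp_trans Y.P_comm (T.TT_tame g z) (T.TT_tame g' z') (Y.LamG_split g) (Ψ := GG Y {g} (ex_sing g))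
    (T.TT_perp0 g hz) (T.TT_perpE g' hz' _ (fun h => hgg h.symm)).symm

theorem tw_comm (g : G) (q : P) (h : ∀ z, z.hd ≠ 1 → ∀ v, Commute (T.TT g z v) q)
    {f : XX G → V} (hf : f ∈ LS (RR S n)) (h1 : OffU f) : Commute (T.tw g ⟨f, hf⟩) q := by
  haveI := RR_fin S n
  have : f ∈ preim (T.tw g) (Subgroup.centralizer {q}) := by
    apply LS_induct (RR S n) _ hf
    intro z
    by_cases hz : z.hd = 1
    · rw [h1 z hz, map_one]; exact one_mem _
    · rw [mem_preim]
      refine ⟨cls_mem _ _ _, ?_⟩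
      rw [Subgroup.mem_centralizer_singleton_iff]
      exact h z hz _
  obtain ⟨_, h2⟩ := mem_preim.1 this
  rw [Subgroup.mem_centralizer_singleton_iff] at h2
  exact h2

theorem tw_tw {g g' : G} (hgg : g ≠ g') {f f' : XX G → V} (hf : f ∈ LS (RR S n)) (h1 : OffU f)
    (hf' : f' ∈ LS (RR S n)) (h1' : OffU f') : Commute (T.tw g ⟨f, hf⟩) (T.tw g' ⟨f', hf'⟩) := by
  apply T.tw_comm g _ _ hf h1
  intro z hz v
  apply Commute.symm
  apply T.tw_comm g' _ _ hf' h1'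
  intro z' hz' v'
  exact T.TT_perp hgg.symm hz' hz v' v

theorem tw_G {g : G} {f : XX G → V} (hf : f ∈ LS (RR S n)) (h1 : OffU f)
    {m : ℕ} {u : G → V} (hu : u ∈ LS (S.r m)) (hg : u g = 1) : Commute (T.tw g ⟨f, hf⟩) (Y.LamG ⟨u, r_LCG S hu⟩) := by
  haveI : Finite (Quotient (S.r m)) := S.ρ_fin _
  apply T.tw_comm g _ _ hf h1
  intro z hz v
  have : u ∈ preim Y.LamG (Subgroup.centralizer {T.TT g z v}) := by
    apply LS_induct (S.r m) _ hu
    intro p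
    by_cases hp : (S.r m) g p
    · rw [← hu _ _ hp, hg, map_one]; exact one_mem _
    · rw [mem_preim]
      refine ⟨r_LCG S (cls_mem _ _ _), ?_⟩
      rw [Subgroup.mem_centralizer_singleton_iff]
      exact ((T.TT_perpE g hz (E := cls (S.r m) p) (fun v => r_LCG S (cls_mem _ _ _)) hp) v _).symm
  obtain ⟨_, h2⟩ := mem_preim.1 this
  rw [Subgroup.mem_centralizer_singleton_iff] at h2
  exact Commute.symm h2

end Stg
end Sys
end HE

namespace HE
open Classical

section
variable {G : Type} [Group G] (S : Star G)

theorem LSR_gen (n : ℕ) (H : Subgroup (XX G → V)) {f : XX G → V} (hf : f ∈ LS (RR S (n+1)))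
    (hG : ∀ u ∈ LS (S.r (n+1)), hdF u ∈ H)
    (hT : ∀ g, S.Sing (n+1) g → ∀ f ∈ LS (RR S n), OffU f → actF (gG g * gT) f ∈ H) : f ∈ H := by
  haveI := RR_fin S (n+1)
  apply LS_induct (RR S (n+1)) H hf
  intro z
  generalize f z = v
  by_cases hz : S.Sing (n+1) z.hd
  · have hoff : OffU (ind (cls (RR S n) (sh z)) v) := by
      intro x hx
      apply ind_neg
      intro h
      exact sh_ne z (RR_U S h hx)
    convert hT z.hd hz (ind (cls (RR S n) (sh z)) v) (cls_mem _ _ _) hoff using 1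
    funext x
    by_cases hx : x.hd = z.hd
    · rw [actF_GT hx]
      have : x ∈ {z' | (RR S (n+1)) z' z} ↔ sh x ∈ cls (RR S n) (sh z) := by
        constructor
        · intro h; exact h.2 (by rw [hx]; exact hz)
        · intro h; exact ⟨by rw [hx], fun _ => h⟩
      rw [ind_apply, ind_apply]
      simp only [this]
    · rw [actF_GT_one hoff hx]
      apply ind_neg
      intro h
      exact hx (hz _ (RR_hd S h))
  · convert hG (ind (cls (S.r (n+1)) z.hd) v) (cls_mem _ _ _) using 1
    funext x
    rw [hdF_apply, ind_apply, ind_apply]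
    have : x ∈ {z' | (RR S (n+1)) z' z} ↔ x.hd ∈ cls (S.r (n+1)) z.hd := by
      constructor
      · intro h; exact h.1
      · intro h
        refine ⟨h, fun hs => absurd ?_ hz⟩
        rw [S.sing_rel h hs]; exact hs
    simp only [this]

theorem LSR_gen0 (H : Subgroup (XX G → V)) {f : XX G → V} (hf : f ∈ LS (RR S 0))
    (hG : ∀ u ∈ LS (S.r 0), hdF u ∈ H) : f ∈ H := by
  haveI := RR_fin S 0
  apply LS_induct (RR S 0) H hf
  intro z
  exact hG (ind (cls (S.r 0) z.hd) (f z)) (cls_mem _ _ _)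

theorem LCX_gen (H : Subgroup (XX G → V)) {f : XX G → V} (hf : f ∈ LCX S)
    (hG : ∀ u ∈ LCG S, hdF u ∈ H)
    (hT : ∀ g, ∀ f ∈ LCX S, OffU f → f ∈ H → actF (gG g * gT) f ∈ H) : f ∈ H := by
  obtain ⟨n, hn⟩ := hf
  induction n generalizing f with
  | zero => exact LSR_gen0 S H hn (fun u hu => hG u (r_LCG S hu))
  | succ n ih =>
    exact LSR_gen S n H hn (fun u hu => hG u (r_LCG S hu))
      (fun g _ f hf h1 => hT g f ⟨n, hf⟩ h1 (ih hf))

theorem LSR_le {n m : ℕ} (h : n ≤ m) : LS (RR S n) ≤ LS (RR S m) :=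
  fun f hf x y hxy => hf x y (RR_le S h hxy)

theorem actF_GT_LCX (g : G) {f : XX G → V} (hf : f ∈ LCX S) (h1 : OffU f) : actF (gG g * gT) f ∈ LCX S := by
  obtain ⟨n, hn⟩ := hf
  obtain ⟨m, hm⟩ := S.sing_ex g
  exact ⟨max n m + 1, actF_GT_mem S (S.sing_mono (by omega) hm) (LSR_le S (le_max_left n m) hn) h1⟩

theorem hdF_LCX {u : G → V} (hu : u ∈ LCG S) : hdF u ∈ LCX S := by
  obtain ⟨n, hn⟩ := LCG_r S hu
  exact ⟨n, hdF_mem S hn⟩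

theorem actF_hdF (g : G) (u : G → V) : actF (gG g) (hdF u) = hdF (trn g u) := by
  funext x
  rw [actF_apply, ← map_inv, act_G]; rfl

theorem actF_G_LCX (g : G) {f : XX G → V} (hf : f ∈ LCX S) : actF (gG g) f ∈ LCX S := by
  have : f ∈ (LCX S).comap (actF (gG g)) := by
    apply LCX_gen S _ hf
    · intro u hu
      rw [Subgroup.mem_comap, actF_hdF]
      exact hdF_LCX S (trn_LCG S g hu)
    · intro g' f hf h1 _
      rw [Subgroup.mem_comap, ← actF_mul, ← mul_assoc, ← map_mul]
      exact actF_GT_LCX S _ hf h1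
  exact this

/-- cut off `U` -/
noncomputable def cutU (f : XX G → V) : XX G → V := fun x => if x.hd = 1 then 1 else f x

theorem cutU_off (f : XX G → V) : OffU (cutU f) := fun x hx => if_pos hx

theorem cutU_LCX {f : XX G → V} (hf : f ∈ LCX S) : cutU f ∈ LCX S := by
  obtain ⟨n, hn⟩ := hf
  refine ⟨n, fun x y h => ?_⟩
  by_cases hx : x.hd = 1
  · rw [cutU_off f x hx, cutU_off f y (RR_U S h hx)]
  · have hy : y.hd ≠ 1 := fun hy => hx (RR_U S ((RR S n).symm h) hy)
    show (if _ then _ else _) = (if _ then _ else _)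
    rw [if_neg hx, if_neg hy, hn x y h]

theorem pb_LCX (g : G) {f : XX G → V} (hf : f ∈ LCX S) : pb g f ∈ LCX S := by
  obtain ⟨n, hn⟩ := hf
  exact ⟨n, pb_mem S (LSR_mono S n hn)⟩

theorem gT_eq : (gG (1:G) * gT : Gam G) = gT := by rw [map_one, one_mul]

theorem split_U (f : XX G → V) : f = actF gT (pb 1 f) * cutU f := by
  funext x
  rw [Pi.mul_apply]
  by_cases hx : x.hd = 1
  · rw [cutU_off f x hx, mul_one, ← gT_eq, actF_GT hx, pb_ne (sh_ne x)]
    rw [← hx, act_GT_sh]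
  · rw [← gT_eq, actF_GT_one (pb_off 1 f) hx, one_mul]
    exact (if_neg hx).symm

theorem actF_TT (f : XX G → V) : actF gT (actF gT f) = f := by
  rw [← actF_mul, gT_sq, actF_one]

theorem actF_T_LCX {f : XX G → V} (hf : f ∈ LCX S) : actF gT f ∈ LCX S := by
  rw [split_U f, map_mul, actF_TT]
  have := actF_GT_LCX S 1 (cutU_LCX S hf) (cutU_off f)
  rw [gT_eq] at this
  exact mul_mem (pb_LCX S 1 hf) this

theorem actF_LCX (γ : Gam G) {f : XX G → V} (hf : f ∈ LCX S) : actF γ f ∈ LCX S := by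
  revert f
  refine gam_induct (p := fun γ => ∀ {f : XX G → V}, f ∈ LCX S → actF γ f ∈ LCX S) ?_ ?_ ?_ γ
  · intro f hf; rwa [actF_one]
  · intro g γ ih f hf
    rw [actF_mul]; exact actF_G_LCX S g (ih hf)
  · intro γ ih f hf
    rw [actF_mul]; exact actF_T_LCX S (ih hf)

/-- `LCX` is the smallest invariant subgroup containing the basic functions. -/
theorem LCX_min (H : Subgroup (XX G → V)) (h0 : ∀ α v, hdF (ind {p | S.a p = α} v) ∈ H)
    (hH : ∀ γ f, f ∈ H → actF γ f ∈ H) {f : XX G → V} (hf : f ∈ LCX S) : f ∈ H := by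
  have key : ∀ F : Fin S.k → V, hdF (fun p => F (S.a p)) ∈ H := by
    intro F
    let Q : (Fin S.k → V) →* (XX G → V) :=
      { toFun := fun F x => F (S.a x.hd), map_one' := rfl, map_mul' := fun _ _ => rfl }
    have : F ∈ H.comap Q := by
      apply Subgroup.pi_mem_of_mulSingle_mem
      intro α
      rw [← ind_single]
      exact h0 α (F α)
    exact this
  apply LCX_gen S H hf
  · intro u hu
    have : u ∈ H.comap hdF := by
      apply LCG_induct S _ hu
      intro x A z
      have h1 := hH (gG x) _ (key (ind A (u z)))
      rw [actF_hdF] at h1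
      exact h1
    exact this
  · intro g f _ _ hf
    exact hH _ _ hf
end

namespace Sys
variable {G : Type} [Group G] {S : Star G} {P : Type} [Group P] (Y : Sys S P)

theorem Stg.next {n : ℕ} (T : Y.Stg n) (σ : ℕ → Lt G) : ∃ T' : Y.Stg (n+1), ∀ g (hg : S.Sing (n+1) g),
    ∀ f (hf : f ∈ LS (RR S n)) (h1 : OffU f), T'.h ⟨actF (gG g * gT) f, actF_GT_mem S hg hf h1⟩ = T.tw g ⟨f, hf⟩ := by
  let θ0 : LS (RR S (n+1)) →* P := Y.LamG.comp
    (((ns S σ (n+1)).comp (LS (RR S (n+1))).subtype).codRestrict (LCG S) (fun f => r_LCG S (ns_mem S f.2)))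
  let θ1 (g : G) : LS (RR S (n+1)) →* P := (T.tw g).comp
    (((pb g).comp (LS (RR S (n+1))).subtype).codRestrict (LS (RR S n)) (fun f => pb_mem S f.2))
  let θ : Option {g // S.Sing (n+1) g} → (LS (RR S (n+1)) →* P) := fun o => Option.casesOn o θ0 (fun g => θ1 g.1)
  haveI := sing_finite S (n+1)
  have c0 : ∀ g, S.Sing (n+1) g → ∀ a b, Commute (θ1 g a) (θ0 b) := fun g hg a b =>
    T.tw_G (pb_mem S a.2) (pb_off _ _) (ns_mem S b.2) (ns_pos S hg)
  have c1 : ∀ g g', g ≠ g' → ∀ a b, Commute (θ1 g a) (θ1 g' b) := fun g g' hg a b =>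
    T.tw_tw hg (pb_mem S a.2) (pb_off _ _) (pb_mem S b.2) (pb_off _ _)
  obtain ⟨Θ, hΘ1, hΘ2⟩ := exists_prodHom θ (by
    intro i j hij a b
    rcases i with _ | ⟨g, hg⟩ <;> rcases j with _ | ⟨g', hg'⟩
    · exact absurd rfl hij
    · exact (c0 g' hg' b a).symm
    · exact c0 g hg a b
    · exact c1 g g' (fun h => hij (by subst h; rfl)) a b)
  have θ1_one : ∀ g (f : LS (RR S (n+1))), (∀ x, x.hd = g → f.1 x = 1) → θ1 g f = 1 := by
    intro g f h
    have : (⟨pb g f.1, pb_mem S f.2⟩ : LS (RR S n)) = 1 := by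
      apply Subtype.ext
      funext x
      by_cases hx : x.hd = 1
      · exact pb_off g f.1 x hx
      · show pb g f.1 x = 1
        rw [pb_ne hx]
        exact h _ (hd_GT hx)
    show T.tw g ⟨pb g f.1, pb_mem S f.2⟩ = 1
    rw [this, map_one]
  have θ0_one : ∀ (f : LS (RR S (n+1))), (∀ x, ¬ S.Sing (n+1) x.hd → f.1 x = 1) → θ0 f = 1 := by
    intro f h
    have : (⟨ns S σ (n+1) f.1, r_LCG S (ns_mem S f.2)⟩ : LCG S) = 1 := by
      apply Subtype.ext
      funext p
      by_cases hp : S.Sing (n+1) p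
      · exact ns_pos S hp
      · show ns S σ (n+1) f.1 p = 1
        rw [ns_neg S hp]
        exact h _ hp
    show Y.LamG ⟨ns S σ (n+1) f.1, r_LCG S (ns_mem S f.2)⟩ = 1
    rw [this, map_one]
  have Θg : ∀ g, S.Sing (n+1) g → ∀ f : LS (RR S (n+1)), (∀ x, x.hd ≠ g → f.1 x = 1) → Θ f = θ1 g f := by
    intro g hg f hf
    refine hΘ1 (some ⟨g, hg⟩) f ?_
    rintro (_ | ⟨g', hg'⟩) hne
    · apply θ0_one
      intro x hx
      apply hf
      rintro rfl
      exact hx hg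
    · apply θ1_one
      rintro x rfl
      apply hf
      rintro rfl
      exact hne rfl
  have Θ0 : ∀ f : LS (RR S (n+1)), (∀ x, S.Sing (n+1) x.hd → f.1 x = 1) → Θ f = θ0 f := by
    intro f hf
    refine hΘ1 none f ?_
    rintro (_ | ⟨g', hg'⟩) hne
    · exact absurd rfl hne
    · apply θ1_one
      rintro x rfl
      exact hf _ hg'
  have main : ∀ g (hg : S.Sing (n+1) g), ∀ f (hf : f ∈ LS (RR S n)) (h1 : OffU f),
      Θ ⟨actF (gG g * gT) f, actF_GT_mem S hg hf h1⟩ = T.tw g ⟨f, hf⟩ := by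
    intro g hg f hf h1
    rw [Θg g hg _ (fun x hx => actF_GT_one h1 hx)]
    have : (⟨pb g (actF (gG g * gT) f), pb_mem S (actF_GT_mem S hg hf h1)⟩ : LS (RR S n)) = ⟨f, hf⟩ :=
      Subtype.ext (pb_actF h1)
    show T.tw g ⟨pb g (actF (gG g * gT) f), pb_mem S (actF_GT_mem S hg hf h1)⟩ = _
    rw [this]
  refine ⟨⟨Θ, ?_, ?_, ?_⟩, main⟩
  · intro u hu
    haveI : Finite (Quotient (S.r (n+1))) := S.ρ_fin _
    let e1 : LS (S.r (n+1)) →* P := Θ.comp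
      ((hdF.comp (LS (S.r (n+1))).subtype).codRestrict (LS (RR S (n+1))) (fun f => hdF_mem S f.2))
    let e2 : LS (S.r (n+1)) →* P := Y.LamG.comp
      ((LS (S.r (n+1))).subtype.codRestrict (LCG S) (fun f => r_LCG S f.2))
    have : u ∈ agree e1 e2 := by
      apply LS_induct (S.r (n+1)) _ hu
      intro z
      generalize u z = v
      rw [mem_agree]
      refine ⟨cls_mem _ _ _, ?_⟩
      show Θ ⟨hdF (ind (cls (S.r (n+1)) z) v), hdF_mem S (cls_mem _ _ _)⟩ =
        Y.LamG ⟨ind (cls (S.r (n+1)) z) v, r_LCG S (cls_mem _ _ _)⟩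
      by_cases hz : S.Sing (n+1) z
      · have hc : cls (S.r (n+1)) z = {z} := by
          ext p
          constructor
          · exact fun hp => hz p hp
          · rintro rfl; exact (S.r (n+1)).refl _
        have hoff : OffU (hdF (ind ({1}ᶜ : Set G) v)) := by
          intro x hx; exact ind_neg (A := ({1}ᶜ : Set G)) (z := x.hd) (fun h => h hx) v
        have h1 := main z hz (hdF (ind {1}ᶜ v)) (hdF_mem S (mem_sing_compl (S.sing_one n) v)) hoff
        rw [T.tw_apply, T.hu _ (mem_sing_compl (S.sing_one n) v), Y.LamG_gtc] at h1
        have e3 : ind (cls (S.r (n+1)) z) v = ind {z} v := by rw [hc]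
        have e4 : hdF (ind (cls (S.r (n+1)) z) v) = actF (gG z * gT) (hdF (ind {1}ᶜ v)) := by
          rw [e3]
          funext x
          by_cases hx : x.hd = z
          · rw [actF_GT hx, hdF_apply, hdF_apply, ind_pos (A := {z}) (show x.hd ∈ ({z}:Set G) from hx), ind_pos (A := {1}ᶜ) (sh_ne x)]
          · rw [hdF_apply, ind_neg (A := {z}) hx, actF_GT_one hoff hx]
        rw [Y.LamG_congr _ e3]
        rw [← h1]
        congr 1
        exact Subtype.ext e4
      · have hzz : ∀ p, S.Sing (n+1) p → ind (cls (S.r (n+1)) z) v p = 1 := by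
          intro p hp
          apply ind_neg
          intro h
          apply hz
          rw [S.sing_rel h hp]; exact hp
        rw [Θ0 _ (fun x hx => hzz _ hx)]
        show Y.LamG ⟨ns S σ (n+1) (hdF (ind (cls (S.r (n+1)) z) v)), r_LCG S (ns_mem S (hdF_mem S (cls_mem _ _ _)))⟩ = _
        apply LamG_congr
        funext p
        by_cases hp : S.Sing (n+1) p
        · rw [ns_pos S hp, hzz p hp]
        · rw [ns_neg S hp]; rfl
    exact (mem_agree.1 this).2
  · intro f hf h
    apply hΘ2
    rintro (_ | ⟨g, hg⟩)
    · refine Y.LamG_mem _ [false] _ (fun x A v => (Y.Ph_tame x A).m0 v) ?_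
      intro p
      by_cases hp : S.Sing (n+1) p
      · exact ⟨1, by rw [map_one]; exact ns_pos S hp⟩
      · obtain ⟨v, hv⟩ := h ⟨p, σ⟩
        exact ⟨v, by rw [← hv]; exact ns_neg S hp⟩
    · refine Y.P0_U _ _ (T.m0 _ _ ?_)
      intro x
      by_cases hx : x.hd = 1
      · exact ⟨1, by rw [map_one]; exact pb_off _ _ _ hx⟩
      · obtain ⟨v, hv⟩ := h (act (gG g * gT) x)
        exact ⟨v, by rw [← hv]; exact pb_ne hx⟩
  · intro f hf h
    apply hΘ2
    rintro (_ | ⟨g, hg⟩)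
    · refine Y.LamG_mem _ [true] _ (fun x A v => (Y.Ph_tame x A).m1 v) ?_
      intro p
      by_cases hp : S.Sing (n+1) p
      · exact ⟨1, by rw [map_one]; exact ns_pos S hp⟩
      · obtain ⟨v, hv⟩ := h ⟨p, σ⟩
        exact ⟨v, by rw [← hv]; exact ns_neg S hp⟩
    · refine Y.P1_U _ _ (T.m1 _ _ ?_)
      intro x
      by_cases hx : x.hd = 1
      · exact ⟨1, by rw [map_one]; exact pb_off _ _ _ hx⟩
      · obtain ⟨v, hv⟩ := h (act (gG g * gT) x)
        exact ⟨v, by rw [← hv]; exact pb_ne hx⟩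

theorem Stg.zero (σ : ℕ → Lt G) : Nonempty (Y.Stg 0) := by
  let s : (XX G → V) →* (G → V) := { toFun := fun f p => f ⟨p, σ⟩, map_one' := rfl, map_mul' := fun _ _ => rfl }
  have hs : ∀ f ∈ LS (RR S 0), s f ∈ LS (S.r 0) := fun f hf p q h => hf _ _ h
  refine ⟨⟨Y.LamG.comp ((s.comp (LS (RR S 0)).subtype).codRestrict (LCG S) (fun f => r_LCG S (hs _ f.2))), ?_, ?_, ?_⟩⟩
  · intro u hu; rfl
  · intro f hf h
    exact Y.LamG_mem _ [false] _ (fun x A v => (Y.Ph_tame x A).m0 v) (fun p => h _)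
  · intro f hf h
    exact Y.LamG_mem _ [true] _ (fun x A v => (Y.Ph_tame x A).m1 v) (fun p => h _)

noncomputable def stg (σ : ℕ → Lt G) : (n : ℕ) → Y.Stg n
  | 0 => Classical.choice (Stg.zero Y σ)
  | n+1 => (Stg.next Y (stg σ n) σ).choose

theorem stg_spec (σ : ℕ → Lt G) (n : ℕ) : ∀ g (hg : S.Sing (n+1) g),
    ∀ f (hf : f ∈ LS (RR S n)) (h1 : OffU f),
    (Y.stg σ (n+1)).h ⟨actF (gG g * gT) f, actF_GT_mem S hg hf h1⟩ = (Y.stg σ n).tw g ⟨f, hf⟩ :=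
  (Stg.next Y (Y.stg σ n) σ).choose_spec

theorem stg_compat (σ : ℕ → Lt G) (n : ℕ) (f : XX G → V) (hf : f ∈ LS (RR S n)) :
    (Y.stg σ (n+1)).h ⟨f, LSR_mono S n hf⟩ = (Y.stg σ n).h ⟨f, hf⟩ := by
  have hGG : ∀ n u, u ∈ LS (S.r n) →
      hdF u ∈ agree ((Y.stg σ (n+1)).h.comp (Subgroup.inclusion (LSR_mono S n))) (Y.stg σ n).h := by
    intro n u hu
    rw [mem_agree]
    refine ⟨hdF_mem S hu, ?_⟩
    have h1 := (Y.stg σ n).hu u hu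
    have h2 := (Y.stg σ (n+1)).hu u (fun x y h => hu x y (S.r_le (Nat.le_succ n) h))
    rw [h1]; exact h2
  induction n generalizing f with
  | zero => exact (mem_agree.1 (LSR_gen0 S _ hf (hGG 0))).2
  | succ n ih =>
    refine (mem_agree.1 (LSR_gen S n _ hf (hGG (n+1)) ?_)).2
    intro g hg f hf h1
    rw [mem_agree]
    refine ⟨actF_GT_mem S hg hf h1, ?_⟩
    have e1 := Y.stg_spec σ (n+1) g (S.sing_mono (by omega) hg) f (LSR_mono S n hf) h1
    have e2 := Y.stg_spec σ n g hg f hf h1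
    rw [e2, Stg.tw_apply, ← ih f hf]
    exact e1

theorem exists_Lam [Nonempty (Lt G)] : ∃ Λ : LCX S →* P,
    (∀ u (hu : u ∈ LCG S), Λ ⟨hdF u, hdF_LCX S hu⟩ = Y.LamG ⟨u, hu⟩) ∧
    (∀ g f (hf : f ∈ LCX S) (h1 : OffU f), Λ ⟨actF (gG g * gT) f, actF_GT_LCX S g hf h1⟩ =
      Y.U (gG g * gT) * Λ ⟨f, hf⟩ * (Y.U (gG g * gT))⁻¹) ∧
    (∀ f (hf : f ∈ LCX S), (∀ x, ∃ v, f x = cor [false] v) → Λ ⟨f, hf⟩ ∈ Y.P0) ∧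
    (∀ f (hf : f ∈ LCX S), (∀ x, ∃ v, f x = cor [true] v) → Λ ⟨f, hf⟩ ∈ Y.P1) := by
  let σ : ℕ → Lt G := fun _ => Classical.arbitrary _
  obtain ⟨Λ, hΛ⟩ := ls_union (fun n => LS (RR S n)) (LSR_mono S) (fun n => (Y.stg σ n).h)
    (Y.stg_compat σ) (LCX S) (fun f => Iff.rfl)
  refine ⟨Λ, ?_, ?_, ?_, ?_⟩
  · intro u hu
    obtain ⟨n, hn⟩ := LCG_r S hu
    rw [hΛ n _ (hdF_mem S hn)]
    exact (Y.stg σ n).hu u hn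
  · intro g f hf h1
    obtain ⟨n, hn⟩ := hf
    obtain ⟨m, hm⟩ := S.sing_ex g
    have hn' := LSR_le S (le_max_left n m) hn
    have hg := S.sing_mono (n := m) (m := max n m + 1) (by omega) hm
    rw [hΛ _ _ (actF_GT_mem S hg hn' h1), hΛ _ _ hn', ← Stg.tw_apply]
    exact Y.stg_spec σ _ g hg f hn' h1
  · rintro f ⟨n, hn⟩ h
    rw [hΛ n f hn]
    exact (Y.stg σ n).m0 f hn h
  · rintro f ⟨n, hn⟩ h
    rw [hΛ n f hn]
    exact (Y.stg σ n).m1 f hn h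

variable [Nonempty (Lt G)]

noncomputable def Lm : LCX S →* P := Y.exists_Lam.choose

theorem Lm_hd (u : G → V) (hu : u ∈ LCG S) : Y.Lm ⟨hdF u, hdF_LCX S hu⟩ = Y.LamG ⟨u, hu⟩ :=
  Y.exists_Lam.choose_spec.1 u hu
theorem Lm_GT (g : G) (f : XX G → V) (hf : f ∈ LCX S) (h1 : OffU f) :
    Y.Lm ⟨actF (gG g * gT) f, actF_GT_LCX S g hf h1⟩ =
      Y.U (gG g * gT) * Y.Lm ⟨f, hf⟩ * (Y.U (gG g * gT))⁻¹ := Y.exists_Lam.choose_spec.2.1 g f hf h1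

theorem Lm_congr {f f' : XX G → V} (hf : f ∈ LCX S) (hf' : f' ∈ LCX S) (h : f = f') :
    Y.Lm ⟨f, hf⟩ = Y.Lm ⟨f', hf'⟩ := by subst h; rfl

theorem Lm_G (g : G) {f : XX G → V} (hf : f ∈ LCX S) :
    Y.Lm ⟨actF (gG g) f, actF_G_LCX S g hf⟩ = Y.U (gG g) * Y.Lm ⟨f, hf⟩ * (Y.U (gG g))⁻¹ := by
  have : f ∈ agree (Y.Lm.comp (((actF (gG g)).comp (LCX S).subtype).codRestrict (LCX S) (fun f => actF_G_LCX S g f.2)))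
      ((MulAut.conj (Y.U (gG g))).toMonoidHom.comp Y.Lm) := by
    apply LCX_gen S _ hf
    · intro u hu
      rw [mem_agree]
      refine ⟨hdF_LCX S hu, ?_⟩
      show Y.Lm ⟨actF (gG g) (hdF u), _⟩ = Y.U (gG g) * Y.Lm ⟨hdF u, _⟩ * (Y.U (gG g))⁻¹
      rw [Y.Lm_hd u hu, ← Y.LamG_equiv g hu, ← Y.Lm_hd]
      exact Y.Lm_congr _ _ (actF_hdF g u)
    · intro g' f hf h1 _
      rw [mem_agree]
      refine ⟨actF_GT_LCX S _ hf h1, ?_⟩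
      show Y.Lm ⟨actF (gG g) (actF (gG g' * gT) f), _⟩ = Y.U (gG g) * Y.Lm ⟨actF (gG g' * gT) f, _⟩ * (Y.U (gG g))⁻¹
      have e : actF (gG g) (actF (gG g' * gT) f) = actF (gG (g * g') * gT) f := by
        rw [← actF_mul, map_mul, mul_assoc]
      rw [Y.Lm_congr _ (actF_GT_LCX S _ hf h1) e, Y.Lm_GT _ _ hf h1, Y.Lm_GT _ _ hf h1]
      simp only [map_mul]; group
  exact (mem_agree.1 this).2

theorem Lm_mul {f f' : XX G → V} (hf : f ∈ LCX S) (hf' : f' ∈ LCX S) (h) :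
    Y.Lm ⟨f * f', h⟩ = Y.Lm ⟨f, hf⟩ * Y.Lm ⟨f', hf'⟩ := by rw [← map_mul]; rfl

theorem Lm_T {f : XX G → V} (hf : f ∈ LCX S) :
    Y.Lm ⟨actF gT f, actF_T_LCX S hf⟩ = Y.U gT * Y.Lm ⟨f, hf⟩ * (Y.U gT)⁻¹ := by
  have hT : ∀ f (hf : f ∈ LCX S), OffU f → Y.Lm ⟨actF gT f, actF_T_LCX S hf⟩ = Y.U gT * Y.Lm ⟨f, hf⟩ * (Y.U gT)⁻¹ := by
    intro f hf h1
    have := Y.Lm_GT 1 f hf h1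
    simp only [gT_eq] at this
    exact this
  have h1 : (Y.U gT) * Y.U gT = 1 := by rw [← map_mul, gT_sq, map_one]
  have h2 : (Y.U gT)⁻¹ = Y.U gT := inv_eq_of_mul_eq_one_left h1
  have hk := pb_LCX S 1 hf
  have hc := cutU_LCX S hf
  have e : actF gT f = pb 1 f * actF gT (cutU f) := by
    conv_lhs => rw [split_U f]
    rw [map_mul, actF_TT]
  rw [Y.Lm_congr hf (mul_mem (actF_T_LCX S hk) hc) (split_U f), Y.Lm_mul (actF_T_LCX S hk) hc,
    Y.Lm_congr (actF_T_LCX S hf) (mul_mem hk (actF_T_LCX S hc)) e, Y.Lm_mul hk (actF_T_LCX S hc),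
    hT _ hk (pb_off _ _), hT _ hc (cutU_off _)]
  generalize Y.Lm ⟨pb 1 f, hk⟩ = a
  generalize Y.Lm ⟨cutU f, hc⟩ = b
  calc a * (Y.U gT * b * (Y.U gT)⁻¹) = (1 * a * 1) * (Y.U gT * b * (Y.U gT)⁻¹) := by group
    _ = ((Y.U gT * Y.U gT) * a * ((Y.U gT)⁻¹ * (Y.U gT)⁻¹)) * (Y.U gT) * b * (Y.U gT)⁻¹ := by
        rw [h2, h1]; group
    _ = _ := by group

theorem Lm_act (γ : Gam G) {f : XX G → V} (hf : f ∈ LCX S) :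
    Y.Lm ⟨actF γ f, actF_LCX S γ hf⟩ = Y.U γ * Y.Lm ⟨f, hf⟩ * (Y.U γ)⁻¹ := by
  refine gam_induct (p := fun γ => Y.Lm ⟨actF γ f, actF_LCX S γ hf⟩ = Y.U γ * Y.Lm ⟨f, hf⟩ * (Y.U γ)⁻¹) ?_ ?_ ?_ γ
  · rw [Y.Lm_congr _ hf (actF_one f)]; simp
  · intro g γ ih
    rw [Y.Lm_congr _ (actF_G_LCX S g (actF_LCX S γ hf)) (actF_mul _ _ f), Lm_G Y g (actF_LCX S γ hf), ih, map_mul]; group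
  · intro γ ih
    rw [Y.Lm_congr _ (actF_T_LCX S (actF_LCX S γ hf)) (actF_mul _ _ f), Lm_T Y (actF_LCX S γ hf), ih, map_mul]; group

theorem ind_a_LCG (α : Fin S.k) (v : V) : ind {p | S.a p = α} v ∈ LCG S := by
  have := reg_LCG S 1 (ind {α} v)
  simp only [inv_one, one_mul] at this
  exact this

theorem Lm_gen (α : Fin S.k) (v : V) (h) : Y.Lm ⟨hdF (ind {p | S.a p = α} v), h⟩ = Y.I (Pi.mulSingle α v) := by
  rw [Y.Lm_hd _ (ind_a_LCG α v), ← ind_single, ← L_one, ← Y.LamG_loc 1 _ (reg_LCG S 1 _)]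
  apply LamG_congr
  simp only [inv_one, one_mul]
  rfl

theorem Lm_const (v : V) (h) : Y.Lm ⟨fun _ => v, h⟩ = Y.δ v := by
  rw [← Y.LamG_const v (const_LCG v), ← Y.Lm_hd]; rfl

theorem Lm_m0 {f : XX G → V} (hf : f ∈ LCX S) (h : ∀ x, ∃ v, f x = cor [false] v) : Y.Lm ⟨f, hf⟩ ∈ Y.P0 :=
  Y.exists_Lam.choose_spec.2.2.1 f hf h

theorem Lm_m1 {f : XX G → V} (hf : f ∈ LCX S) (h : ∀ x, ∃ v, f x = cor [true] v) : Y.Lm ⟨f, hf⟩ ∈ Y.P1 :=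
  Y.exists_Lam.choose_spec.2.2.2 f hf h

end Sys
end HE

namespace HE
open Classical commutatorElement

theorem commute_gens {A B P : Type} [Group A] [Group B] [Group P] (f : A →* P) (g : B →* P) {SA : Set A} {SB : Set B}
    (hA : Subgroup.closure SA = ⊤) (hB : Subgroup.closure SB = ⊤)
    (h : ∀ a ∈ SA, ∀ b ∈ SB, Commute (f a) (g b)) (a : A) (b : B) : Commute (f a) (g b) := by
  have h1 : ∀ a ∈ SA, ∀ b, Commute (f a) (g b) := by
    intro a ha b
    have hb : b ∈ Subgroup.closure SB := by rw [hB]; trivial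
    induction hb using Subgroup.closure_induction with
    | mem b hb => exact h a ha b hb
    | one => rw [map_one]; exact Commute.one_right _
    | mul x y _ _ hx hy => rw [map_mul]; exact hx.mul_right hy
    | inv x _ hx => rw [map_inv]; exact hx.inv_right
  have ha : a ∈ Subgroup.closure SA := by rw [hA]; trivial
  induction ha using Subgroup.closure_induction with
  | mem a ha => exact h1 a ha b
  | one => rw [map_one]; exact Commute.one_left _
  | mul x y _ _ hx hy => rw [map_mul]; exact hx.mul_left hy
  | inv x _ hx => rw [map_inv]; exact hx.inv_left

theorem fp_pi (n : ℕ) : Group.IsFinitelyPresented (Fin n → V) := by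
  haveI := V_fp
  haveI := fp_coprodI V n
  let W := Monoid.CoprodI (fun _ : Fin n => V)
  let o : ∀ i : Fin n, V →* W := fun i => Monoid.CoprodI.of (M := fun _ : Fin n => V) (i := i)
  haveI : Finite (SV 12) := SV_finite 12
  let rel : (Fin n × Fin n) × (SV 12 × SV 12) → W := fun p =>
    if p.1.1 = p.1.2 then 1 else ⁅o p.1.1 p.2.1, o p.1.2 p.2.2⁆
  let N : Subgroup W := Subgroup.normalClosure (Set.range rel)
  haveI := Group.IsFinitelyPresented.quotient N ⟨Set.range rel, Set.finite_range rel, rfl⟩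
  let q : W →* W ⧸ N := QuotientGroup.mk' N
  have hc : Pairwise fun i j => ∀ x y, Commute ((q.comp (o i)) x) ((q.comp (o j)) y) := by
    intro i j hij x y
    refine commute_gens (q.comp (o i)) (q.comp (o j)) closure_SV closure_SV ?_ x y
    intro a ha b hb
    have : rel ((i, j), (⟨a, ha⟩, ⟨b, hb⟩)) ∈ N := Subgroup.subset_normalClosure ⟨_, rfl⟩
    simp only [rel, if_neg hij] at this
    have h2 : q ⁅o i a, o j b⁆ = 1 := (QuotientGroup.eq_one_iff _).2 this
    rw [map_commutatorElement, commutatorElement_eq_one_iff_commute] at h2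
    exact h2
  let A : (Fin n → V) →* W ⧸ N := MonoidHom.noncommPiCoprod (fun i => q.comp (o i)) hc
  let B0 : W →* (Fin n → V) := Monoid.CoprodI.lift (fun i => MonoidHom.mulSingle (fun _ => V) i)
  have hB0 : N ≤ B0.ker := by
    apply Subgroup.normalClosure_le_normal
    rintro _ ⟨⟨⟨i, j⟩, a, b⟩, rfl⟩
    show B0 _ = 1
    simp only [rel]
    split_ifs with h
    · exact map_one _
    · rw [map_commutatorElement, commutatorElement_eq_one_iff_commute]
      simp only [B0, o, Monoid.CoprodI.lift_of]
      exact Pi.mulSingle_commute h _ _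
  let B : W ⧸ N →* (Fin n → V) := QuotientGroup.lift N B0 hB0
  refine Group.IsFinitelyPresented.equiv (MonoidHom.toMulEquiv B A ?_ ?_)
  · apply QuotientGroup.monoidHom_ext
    apply Monoid.CoprodI.ext_hom
    intro i
    ext v
    show A (B (q (o i v))) = q (o i v)
    have : B (q (o i v)) = Pi.mulSingle i v := by
      show B0 (o i v) = _
      simp only [B0, o, Monoid.CoprodI.lift_of]; rfl
    rw [this]
    exact MonoidHom.noncommPiCoprod_mulSingle _ _ _
  · apply MonoidHom.pi_ext
    intro i v
    show B (A (Pi.mulSingle i v)) = Pi.mulSingle i v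
    have : A (Pi.mulSingle i v) = q (o i v) := MonoidHom.noncommPiCoprod_mulSingle _ _ _
    rw [this]
    show B0 (o i v) = _
    simp only [B0, o, Monoid.CoprodI.lift_of]; rfl

noncomputable def k0 : V := (mover (α := [false]) (β := [false, false]) (by simp) (by simp)).choose
noncomputable def k1 : V := (mover (α := [false]) (β := [false, true]) (by simp) (by simp)).choose
noncomputable def sw : V := tr [false] [true]
theorem k0_app (y : Y) : k0.1 (app [false] y) = app [false, false] y :=
  (mover (α := [false]) (β := [false, false]) (by simp) (by simp)).choose_spec y
theorem k1_app (y : Y) : k1.1 (app [false] y) = app [false, true] y :=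
  (mover (α := [false]) (β := [false, true]) (by simp) (by simp)).choose_spec y
theorem sw_app (y : Y) : sw.1 (app [false] y) = app [true] y := tr_l inc_ft y
theorem sw_app' (y : Y) : sw.1 (app [true] y) = app [false] y := tr_r inc_ft y

/-- Concrete generators and relations. -/
structure Dat {G : Type} [Group G] (S : Star G) (P : Type) [Group P] where
  I : (Fin S.k → V) →* P
  φ : Gam G →* P
  r2 : ∀ γ α v, Commute (φ γ) (I (Pi.mulSingle α (cor [true] v)))
  r3 : ∀ γ γ', Commute (I (fun _ => k0) * φ γ * (I (fun _ => k0))⁻¹) (I (fun _ => k1) * φ γ' * (I (fun _ => k1))⁻¹)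
  r3b : ∀ γ γ', Commute (φ γ) (I (fun _ => sw) * φ γ' * (I (fun _ => sw))⁻¹)
  r4 : ∀ γ, φ γ = (I (fun _ => k0) * φ γ * (I (fun _ => k0))⁻¹) * (I (fun _ => k1) * φ γ * (I (fun _ => k1))⁻¹)
  r5 : ∀ γ v, Commute (φ γ * (I (fun _ => sw) * φ γ * (I (fun _ => sw))⁻¹)) (I (fun _ => v))
  r6 : ∀ α β g, S.ℓ g ≤ S.D → (∀ p, ¬ (S.a p = α ∧ S.a (g⁻¹ * p) = β)) → ∀ v w,
    Commute (I (Pi.mulSingle α v))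
      ((φ (gG g) * (I (fun _ => sw) * φ (gG g) * (I (fun _ => sw))⁻¹)) * I (Pi.mulSingle β w) *
        (φ (gG g) * (I (fun _ => sw) * φ (gG g) * (I (fun _ => sw))⁻¹))⁻¹)
  r7 : ∀ v, (φ gT * (I (fun _ => sw) * φ gT * (I (fun _ => sw))⁻¹)) * I (Pi.mulSingle (S.a 1) v) *
      (φ gT * (I (fun _ => sw) * φ gT * (I (fun _ => sw))⁻¹))⁻¹ = I (ind {S.a 1}ᶜ v)

/-- pointwise product of commuting homs -/
def mulHom {A P : Type} [Group A] [Group P] (f g : A →* P) (h : ∀ a b, Commute (f a) (g b)) : A →* P where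
  toFun a := f a * g a
  map_one' := by simp
  map_mul' a b := by
    rw [map_mul, map_mul]
    have := (h b a).eq
    calc f a * f b * (g a * g b) = f a * (f b * g a) * g b := by group
      _ = _ := by rw [this]; group

def cj {P : Type} [Group P] (a : P) : P →* P := (MulAut.conj a).toMonoidHom
theorem cj_apply {P : Type} [Group P] (a b : P) : cj a b = a * b * a⁻¹ := rfl

noncomputable def sgl {k : ℕ} (α : Fin k) : V →* (Fin k → V) := MonoidHom.mulSingle (fun _ => V) α
def cst (k : ℕ) : V →* (Fin k → V) := Pi.constMonoidHom (Fin k) V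

theorem exists_univ {G : Type} [Group G] [Group.IsFinitelyPresented G] (S : Star G) :
    ∃ (P : Type) (_ : Group P) (D : Dat S P), Group.IsFinitelyPresented P ∧
      (∀ (Q : Type) [Group Q] (E : Dat S Q), ∃ h : P →* Q, (∀ F, h (D.I F) = E.I F) ∧ ∀ γ, h (D.φ γ) = E.φ γ) ∧
      ∀ H : Subgroup P, (∀ F, D.I F ∈ H) → (∀ γ, D.φ γ ∈ H) → H = ⊤ := by
  haveI := fp_pi S.k
  have hfg : Group.FG (Gam G) := by
    obtain ⟨n, f, hf, -⟩ := (inferInstance : Group.IsFinitelyPresented (Gam G)).out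
    exact Group.fg_of_surjective hf
  obtain ⟨SΓ, hΓ, hΓf⟩ := Group.fg_iff.1 hfg
  haveI : Finite SΓ := hΓf
  haveI : Finite (SV 12) := SV_finite 12
  let Bd := {g | S.ℓ g ≤ S.D}
  haveI : Finite Bd := S.fin
  let W := Monoid.Coprod (Fin S.k → V) (Gam G)
  let I : (Fin S.k → V) →* W := Monoid.Coprod.inl
  let φ : Gam G →* W := Monoid.Coprod.inr
  let c : V → W → W := fun v w => I (fun _ => v) * w * (I (fun _ => v))⁻¹
  let U : Gam G → W := fun γ => φ γ * c sw (φ γ)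
  let R2 : SΓ × Fin S.k × SV 12 → W := fun p => ⁅φ p.1.1, I (Pi.mulSingle p.2.1 (cor [true] p.2.2.1))⁆
  let R3 : SΓ × SΓ → W := fun p => ⁅c k0 (φ p.1.1), c k1 (φ p.2.1)⁆
  let R3b : SΓ × SΓ → W := fun p => ⁅φ p.1.1, c sw (φ p.2.1)⁆
  let R4 : SΓ → W := fun p => (φ p.1)⁻¹ * (c k0 (φ p.1) * c k1 (φ p.1))
  let R5 : SΓ × SV 12 → W := fun p => ⁅U p.1.1, I (fun _ => p.2.1)⁆
  let R6 : (Fin S.k × Fin S.k) × Bd × (SV 12 × SV 12) → W := fun p =>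
    if ∀ q, ¬ (S.a q = p.1.1 ∧ S.a (p.2.1.1⁻¹ * q) = p.1.2) then
      ⁅I (Pi.mulSingle p.1.1 p.2.2.1.1), U (gG p.2.1.1) * I (Pi.mulSingle p.1.2 p.2.2.2.1) * (U (gG p.2.1.1))⁻¹⁆ else 1
  let R7 : SV 12 → W := fun p => (U gT * I (Pi.mulSingle (S.a 1) p.1) * (U gT)⁻¹)⁻¹ * I (ind {S.a 1}ᶜ p.1)
  let R : Set W := Set.range R2 ∪ Set.range R3 ∪ Set.range R3b ∪ Set.range R4 ∪ Set.range R5 ∪ Set.range R6 ∪ Set.range R7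
  have hR : R.Finite := by
    refine Set.Finite.union (Set.Finite.union (Set.Finite.union (Set.Finite.union (Set.Finite.union (Set.Finite.union ?_ ?_) ?_) ?_) ?_) ?_) ?_
    all_goals exact Set.finite_range _
  let N : Subgroup W := Subgroup.normalClosure R
  haveI : N.Normal := inferInstance
  let q : W →* W ⧸ N := QuotientGroup.mk' N
  have hq : ∀ w ∈ R, q w = 1 := fun w hw => (QuotientGroup.eq_one_iff _).2 (Subgroup.subset_normalClosure hw)
  have hqc : ∀ {x y : W}, ⁅x, y⁆ ∈ R → Commute (q x) (q y) := by
    intro x y h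
    have := hq _ h
    rwa [map_commutatorElement, commutatorElement_eq_one_iff_commute] at this
  have m2 : ∀ p, R2 p ∈ R := fun p => Or.inl (Or.inl (Or.inl (Or.inl (Or.inl (Or.inl ⟨p, rfl⟩)))))
  have m3 : ∀ p, R3 p ∈ R := fun p => Or.inl (Or.inl (Or.inl (Or.inl (Or.inl (Or.inr ⟨p, rfl⟩)))))
  have m3b : ∀ p, R3b p ∈ R := fun p => Or.inl (Or.inl (Or.inl (Or.inl (Or.inr ⟨p, rfl⟩))))
  have m4 : ∀ p, R4 p ∈ R := fun p => Or.inl (Or.inl (Or.inl (Or.inr ⟨p, rfl⟩)))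
  have m5 : ∀ p, R5 p ∈ R := fun p => Or.inl (Or.inl (Or.inr ⟨p, rfl⟩))
  have m6 : ∀ p, R6 p ∈ R := fun p => Or.inl (Or.inr ⟨p, rfl⟩)
  have m7 : ∀ p, R7 p ∈ R := fun p => Or.inr ⟨p, rfl⟩
  let I' := q.comp I
  let φ' := q.comp φ
  let cc : V → (W ⧸ N) →* W ⧸ N := fun v => cj (I' (fun _ => v))
  have hcc : ∀ v w, q (c v w) = cc v (q w) := by
    intro v w; simp only [c, cc, cj_apply, map_mul, map_inv]; rfl
  have e3 : ∀ γ γ', Commute ((cc k0).comp φ' γ) ((cc k1).comp φ' γ') :=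
    commute_gens _ _ hΓ hΓ (fun a ha b hb => by
      have := hqc (m3 (⟨a, ha⟩, ⟨b, hb⟩)); rwa [hcc, hcc] at this)
  have e3b : ∀ γ γ', Commute (φ' γ) ((cc sw).comp φ' γ') :=
    commute_gens _ _ hΓ hΓ (fun a ha b hb => by
      have := hqc (m3b (⟨a, ha⟩, ⟨b, hb⟩)); rwa [hcc] at this)
  have e4 : φ' = mulHom _ _ e3 := by
    apply MonoidHom.eq_of_eqOn_dense hΓ
    intro a ha
    have := hq _ (m4 ⟨a, ha⟩)
    simp only [R4, map_mul, map_inv, hcc] at this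
    exact inv_mul_eq_one.1 this
  let U' := mulHom _ _ e3b
  have hU : ∀ γ, q (U γ) = U' γ := by
    intro γ; simp only [U, map_mul, hcc]; rfl
  let D : Dat S (W ⧸ N) :=
    { I := I', φ := φ'
      r2 := fun γ α v => commute_gens φ' (I'.comp ((sgl α).comp (cor [true]))) hΓ closure_SV (fun a ha b hb =>
        hqc (m2 (⟨a, ha⟩, α, ⟨b, hb⟩))) γ v
      r3 := e3
      r3b := e3b
      r4 := fun γ => DFunLike.congr_fun e4 γ
      r5 := fun γ v => commute_gens U' (I'.comp (cst S.k)) hΓ closure_SV (fun a ha b hb => by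
        have := hqc (m5 (⟨a, ha⟩, ⟨b, hb⟩)); rwa [hU] at this) γ v
      r6 := fun α β g hg h v w => commute_gens (I'.comp (sgl α)) ((cj (U' (gG g))).comp (I'.comp (sgl β))) closure_SV closure_SV
        (fun a ha b hb => by
          have := m6 ((α, β), ⟨g, hg⟩, (⟨a, ha⟩, ⟨b, hb⟩))
          simp only [R6] at this
          rw [if_pos h] at this
          have := hqc this
          have e : q (U (gG g) * I (Pi.mulSingle β b) * (U (gG g))⁻¹) = q (U (gG g)) * q (I (Pi.mulSingle β b)) * (q (U (gG g)))⁻¹ := rfl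
          rw [e, hU] at this
          exact this) v w
      r7 := fun v => by
        have : ((cj (U' gT)).comp (I'.comp (sgl (S.a 1)))) = I'.comp (ind {S.a 1}ᶜ) := by
          apply MonoidHom.eq_of_eqOn_dense closure_SV
          intro a ha
          have := hq _ (m7 ⟨a, ha⟩)
          simp only [R7] at this
          rw [map_mul] at this
          have e : q (U gT * I (Pi.mulSingle (S.a 1) a) * (U gT)⁻¹)⁻¹ = (q (U gT) * q (I (Pi.mulSingle (S.a 1) a)) * (q (U gT))⁻¹)⁻¹ := rfl
          rw [e, hU] at this
          exact inv_mul_eq_one.1 this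
        exact DFunLike.congr_fun this v }
  refine ⟨W ⧸ N, inferInstance, D, Group.IsFinitelyPresented.quotient N ⟨R, hR, rfl⟩, ?_, ?_⟩
  · intro Q _ E
    let h0 : W →* Q := Monoid.Coprod.lift E.I E.φ
    have hI : ∀ F, h0 (I F) = E.I F := fun F => Monoid.Coprod.lift_apply_inl _ _ _
    have hφ : ∀ γ, h0 (φ γ) = E.φ γ := fun F => Monoid.Coprod.lift_apply_inr _ _ _
    have hinv : ∀ w : W, h0 w⁻¹ = (h0 w)⁻¹ := fun w => map_inv h0 w
    have hN : N ≤ h0.ker := by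
      apply Subgroup.normalClosure_le_normal
      rintro w ((((((⟨p, rfl⟩ | ⟨p, rfl⟩) | ⟨p, rfl⟩) | ⟨p, rfl⟩) | ⟨p, rfl⟩) | ⟨p, rfl⟩) | ⟨p, rfl⟩)
      all_goals rw [SetLike.mem_coe, MonoidHom.mem_ker]
      · simp only [R2, map_commutatorElement, commutatorElement_eq_one_iff_commute, hI, hφ]
        exact E.r2 _ _ _
      · simp only [R3, map_commutatorElement, commutatorElement_eq_one_iff_commute, c, map_mul, hinv, map_mul, hI, hφ]
        exact E.r3 _ _
      · simp only [R3b, map_commutatorElement, commutatorElement_eq_one_iff_commute, c, map_mul, hinv, map_mul, hI, hφ]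
        exact E.r3b _ _
      · simp only [R4, c, map_mul, hinv, map_mul, hI, hφ]
        exact inv_mul_eq_one.2 (E.r4 _)
      · simp only [R5, map_commutatorElement, commutatorElement_eq_one_iff_commute, U, c, map_mul, hinv, map_mul, hI, hφ]
        exact E.r5 _ _
      · simp only [R6]
        split_ifs with h
        · simp only [map_commutatorElement, commutatorElement_eq_one_iff_commute, U, c, map_mul, hinv, map_mul, hI, hφ]
          exact E.r6 _ _ _ p.2.1.2 h _ _
        · exact map_one _
      · simp only [R7, U, c, map_mul, hinv, map_mul, hI, hφ]
        exact inv_mul_eq_one.2 (E.r7 _)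
    exact ⟨QuotientGroup.lift N h0 hN, hI, hφ⟩
  · intro H h1 h2
    rw [eq_top_iff]
    rintro p -
    obtain ⟨w, rfl⟩ := QuotientGroup.mk_surjective p
    have ht : MonoidHom.range (Monoid.Coprod.inl : (Fin S.k → V) →* W) ⊔ MonoidHom.range (Monoid.Coprod.inr : Gam G →* W) ≤
        Subgroup.comap (QuotientGroup.mk' N) H := by
      apply sup_le
      · rintro _ ⟨F, rfl⟩; exact h1 F
      · rintro _ ⟨F, rfl⟩; exact h2 F
    rw [Monoid.Coprod.range_inl_sup_range_inr] at ht
    exact ht (Subgroup.mem_top w)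

end HE

namespace HE
open Classical

theorem fix_cor {v : V} (h : ∀ y, v.1 (app [false] y) = app [false] y) : ∃ u, v = cor [true] u := by
  have aux : ∀ v : V, (∀ y, v.1 (app [false] y) = app [false] y) → ∀ y, ∃ z, v.1 (app [true] y) = app [true] z := by
    intro v h y
    obtain ⟨b, z, hz⟩ := exists_ycons (v.1 (app [true] y))
    cases b with
    | true => exact ⟨z, hz⟩
    | false =>
      have h2 := h z
      change v.1 (app [false] z) = ycons false z at h2
      rw [← hz] at h2
      exact absurd (v.1.injective h2) (inc_ft.ne _ _)
  have h' : ∀ y, (v⁻¹).1 (app [false] y) = app [false] y := fun y => V_inv_eq (h y)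
  choose f hf using aux v h
  choose f' hf' using aux v⁻¹ h'
  obtain ⟨N, hN⟩ := V_depth2 v 1
  refine ⟨⟨⟨f, f', fun y => ?_, fun y => ?_⟩, N, fun α hα => ?_⟩, eq_cor hf ?_⟩
  · apply app_inj (α := [true]); rw [← hf', ← hf, V_inv_app]
  · apply app_inj (α := [true]); rw [← hf, ← hf', V_app_inv]
  · obtain ⟨β, hβ, hh⟩ := hN (true :: α) (by simp; omega)
    obtain ⟨b, β, rfl⟩ := List.exists_cons_of_ne_nil (List.ne_nil_of_length_pos hβ)
    have hb : b = true := by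
      have h1 := hh (fun _ => true)
      rw [app_cons] at h1
      have h2 := hf (app α (fun _ => true))
      rw [app_cons, app_nil, h1] at h2
      exact (ycons_inj h2).1
    subst hb
    refine ⟨β, fun y => ?_⟩
    apply app_inj (α := [true])
    show app [true] (f (app α y)) = _
    rw [← hf]
    exact hh y
  · intro y hy
    obtain ⟨b, z, rfl⟩ := exists_ycons y
    cases b with
    | true => exact absurd ⟨z, rfl⟩ hy
    | false => exact h z

theorem fix_cor' {v : V} (h : ∀ y, v.1 (app [true] y) = app [true] y) : ∃ u, v = cor [false] u := by
  obtain ⟨u, hu⟩ := fix_cor (v := sw⁻¹ * v * sw) (fun y => by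
    rw [V_mul, V_mul, sw_app, h]; exact V_inv_eq (sw_app y))
  refine ⟨u, ?_⟩
  rw [← cor_conj sw_app', ← hu]; group

noncomputable def mv (α β : List Bool) : V :=
  if h : α ≠ [] ∧ β ≠ [] then (mover h.1 h.2).choose else 1

theorem mv_app {α β : List Bool} (hα : α ≠ []) (hβ : β ≠ []) (y : Y) : (mv α β).1 (app α y) = app β y := by
  rw [mv, dif_pos ⟨hα, hβ⟩]; exact (mover hα hβ).choose_spec y

theorem conj_of_commute {P : Type} [Group P] {a b p q : P} (h : Commute (b⁻¹ * a) p) (hq : q = b * p * b⁻¹) :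
    a * p * a⁻¹ = q := by
  have := h.eq
  rw [hq]
  calc a * p * a⁻¹ = b * (b⁻¹ * a * p) * a⁻¹ := by group
    _ = _ := by rw [this]; group

theorem Inc.ne_nil {α β : List Bool} (h : Inc α β) : α ≠ [] := by
  rintro rfl; exact h.1 (by simp)

namespace Dat
variable {G : Type} [Group G] {S : Star G} {P : Type} [Group P] (D : Dat S P)

noncomputable def δ : V →* P := D.I.comp (cst S.k)

theorem δ_eq (v : V) : D.δ v = D.I (fun _ => v) := rfl

theorem δ_single (v : V) (α : Fin S.k) (w : V) :
    D.δ v * D.I (Pi.mulSingle α w) * (D.δ v)⁻¹ = D.I (Pi.mulSingle α (v * w * v⁻¹)) := by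
  rw [δ_eq, ← map_inv, ← map_mul, ← map_mul, ← ind_single, ← ind_single, ← conj_ind]

theorem off0 (γ : Gam G) (F : Fin S.k → V) (h : ∀ α y, (F α).1 (app [false] y) = app [false] y) :
    Commute (D.I F) (D.φ γ) := by
  choose u hu using fun α => fix_cor (h α)
  let Q : (Fin S.k → V) →* P := D.I.comp (MonoidHom.pi (fun α => (cor [true]).comp (Pi.evalMonoidHom _ α)))
  have : u ∈ (Subgroup.centralizer {D.φ γ}).comap Q := by
    apply Subgroup.pi_mem_of_mulSingle_mem
    intro α
    rw [Subgroup.mem_comap, Subgroup.mem_centralizer_singleton_iff]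
    have : Q (Pi.mulSingle α (u α)) = D.I (Pi.mulSingle α (cor [true] (u α))) := by
      show D.I _ = _
      congr 1
      funext β
      show cor [true] ((Pi.mulSingle α (u α) : Fin S.k → V) β) = _
      by_cases hb : β = α
      · subst hb; simp
      · simp [Pi.mulSingle_eq_of_ne hb]
    rw [this]
    exact (D.r2 γ α (u α)).symm.eq
  rw [Subgroup.mem_comap, Subgroup.mem_centralizer_singleton_iff] at this
  have e : Q u = D.I F := by
    show D.I _ = _
    congr 1
    funext β
    exact (hu β).symm
  rw [e] at this
  exact this

noncomputable def pw (α : List Bool) : Gam G →* P := (cj (D.δ (mv [false] α))).comp D.φ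

theorem pw_eq (α : List Bool) (γ : Gam G) : D.pw α γ = D.δ (mv [false] α) * D.φ γ * (D.δ (mv [false] α))⁻¹ := rfl

theorem φ_move {μ : V} {β : List Bool} (hβ : β ≠ []) (h : ∀ y, μ.1 (app [false] y) = app β y) (γ : Gam G) :
    D.δ μ * D.φ γ * (D.δ μ)⁻¹ = D.pw β γ := by
  refine conj_of_commute (b := D.δ (mv [false] β)) ?_ (D.pw_eq β γ)
  rw [← map_inv, ← map_mul]
  apply off0
  intro _ y
  show ((mv [false] β)⁻¹ * μ : V).1 (app [false] y) = _
  rw [V_mul, h]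
  exact V_inv_eq (mv_app (by simp) hβ y)

theorem pw_move {μ : V} {α β : List Bool} (hα : α ≠ []) (hβ : β ≠ []) (h : ∀ y, μ.1 (app α y) = app β y) (γ : Gam G) :
    D.δ μ * D.pw α γ * (D.δ μ)⁻¹ = D.pw β γ := by
  rw [← D.φ_move hβ (μ := μ * mv [false] α) (fun y => by rw [V_mul, mv_app (by simp) hα, h]), pw_eq, map_mul]
  group

theorem pw_false (γ : Gam G) : D.pw [false] γ = D.φ γ := by
  rw [← D.φ_move (μ := 1) (by simp) (fun y => rfl), map_one]; group

theorem pw_off {α : List Bool} (hα : α ≠ []) (γ : Gam G) (F : Fin S.k → V) (h : ∀ i y, (F i).1 (app α y) = app α y) :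
    Commute (D.I F) (D.pw α γ) := by
  have := D.off0 γ ((fun _ => mv [false] α)⁻¹ * F * (fun _ => mv [false] α)) (fun i y => by
    simp only [Pi.mul_apply, Pi.inv_apply]
    rw [V_mul, V_mul, mv_app (by simp) hα, h]; exact V_inv_eq (mv_app (by simp) hα y))
  have h2 := this.map (cj (D.δ (mv [false] α)))
  rw [pw_eq]
  rw [cj_apply, cj_apply] at h2
  convert h2 using 1
  rw [δ_eq, ← map_inv, ← map_mul, ← map_mul]
  congr 1; group

theorem pw_offδ {α : List Bool} (hα : α ≠ []) (γ : Gam G) {v : V} (h : ∀ y, v.1 (app α y) = app α y) :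
    Commute (D.δ v) (D.pw α γ) := D.pw_off hα γ (fun _ => v) (fun _ => h)

theorem r3' (γ γ' : Gam G) : Commute (D.pw [false, false] γ) (D.pw [false, true] γ') := by
  rw [← D.φ_move (by simp) k0_app, ← D.φ_move (by simp) k1_app]; exact D.r3 γ γ'

theorem r4' (γ : Gam G) : D.φ γ = D.pw [false, false] γ * D.pw [false, true] γ := by
  rw [← D.φ_move (by simp) k0_app, ← D.φ_move (by simp) k1_app]; exact D.r4 γ

theorem r3b' (γ γ' : Gam G) : Commute (D.φ γ) (D.pw [true] γ') := by
  rw [← D.φ_move (by simp) sw_app]; exact D.r3b γ γ'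

theorem pw_split {α : List Bool} (hα : α ≠ []) (γ : Gam G) :
    D.pw α γ = D.pw (α ++ [false]) γ * D.pw (α ++ [true]) γ := by
  have h0 := D.pw_move (μ := mv [false] α) (α := [false, false]) (β := α ++ [false]) (by simp) (by simp) (fun y => by
    have := mv_app (α := [false]) (by simp) hα (app [false] y)
    rw [app_append, ← this]; rfl) γ
  have h1 := D.pw_move (μ := mv [false] α) (α := [false, true]) (β := α ++ [true]) (by simp) (by simp) (fun y => by
    have := mv_app (α := [false]) (by simp) hα (app [true] y)
    rw [app_append, ← this]; rfl) γ
  rw [pw_eq, D.r4', ← h0, ← h1]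
  group

theorem pw_comm_move {α β α' β' : List Bool} (v : V) (hα : α ≠ []) (hβ : β ≠ []) (hα' : α' ≠ []) (hβ' : β' ≠ [])
    (h1 : ∀ y, v.1 (app α y) = app α' y) (h2 : ∀ y, v.1 (app β y) = app β' y)
    {γ γ' : Gam G} (h : Commute (D.pw α' γ) (D.pw β' γ')) : Commute (D.pw α γ) (D.pw β γ') := by
  have e1 := D.pw_move (μ := v⁻¹) hα' hα (fun y => V_inv_eq (h1 y)) γ
  have e2 := D.pw_move (μ := v⁻¹) hβ' hβ (fun y => V_inv_eq (h2 y)) γ'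
  rw [← e1, ← e2]
  exact h.map (cj (D.δ v⁻¹))

theorem pw_comm {α β : List Bool} (hi : Inc α β) (γ γ' : Gam G) : Commute (D.pw α γ) (D.pw β γ') := by
  have h1011 : Commute (D.pw [true, false] γ) (D.pw [true, true] γ') :=
    D.pw_comm_move sw (by simp) (by simp) (by simp) (by simp) (α' := [false, false]) (β' := [false, true])
      (fun y => sw_app' (app [false] y)) (fun y => sw_app' (app [true] y)) (D.r3' _ _)
  have h10 : ∀ ε : List Bool, 2 ≤ ε.length → Inc [true, false] ε → Commute (D.pw [true, false] γ) (D.pw ε γ') := by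
    intro ε hl hi
    have i1 : Inc [true, false] [true, true] := (inc_ft).prep [true]
    have c0 : ∀ ε, Commute (D.pw [true, false] γ) (D.pw (false :: ε) γ') := by
      intro ε
      have hi : Inc [true, false] (false :: ε) := inc_cons (by simp) _ _
      have i2 : Inc (false :: ε) [true, true] := inc_cons (by simp) _ _
      exact D.pw_comm_move (tr (false :: ε) [true, true]) (by simp) (by simp) (by simp) (by simp)
        (tr_fix hi i1) (tr_l i2) h1011
    match ε, hl, hi with
    | false :: ε, _, hi => exact c0 ε
    | true :: false :: ε, _, hi => exact absurd ⟨ε, rfl⟩ hi.1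
    | true :: true :: ε, _, hi =>
      have i3 : Inc (true :: true :: ε) [false] := inc_cons (by simp) _ _
      exact D.pw_comm_move (tr (true :: true :: ε) [false]) (by simp) (by simp) (by simp) (by simp)
        (tr_fix hi (inc_cons (by simp) _ _)) (tr_l i3) (c0 [])
  have hα : α ≠ [] := hi.ne_nil
  have hβ : β ≠ [] := hi.symm.ne_nil
  obtain ⟨N, hN⟩ := V_depth2 (mv α [true, false]) 2
  have deep : ∀ ε, N ≤ (β ++ ε).length → Commute (D.pw α γ) (D.pw (β ++ ε) γ') := by
    intro ε hε
    obtain ⟨ζ, hl, hζ⟩ := hN _ hε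
    have hα' := mv_app hα (β := [true, false]) (by simp)
    have h2 : Inc α (β ++ ε) := by have := hi.append [] ε; rwa [List.append_nil] at this
    have h3 := h2.map _ hα' hζ
    exact D.pw_comm_move (mv α [true, false]) hα (by simp [hβ]) (by simp) h3.symm.ne_nil hα' hζ (h10 ζ hl h3)
  have all : ∀ n ε, N ≤ (β ++ ε).length + n → Commute (D.pw α γ) (D.pw (β ++ ε) γ') := by
    intro n
    induction n with
    | zero => exact deep
    | succ n ih =>
      intro ε hε
      rw [D.pw_split (α := β ++ ε) (by simp [hβ]), List.append_assoc, List.append_assoc]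
      exact (ih _ (by simp at hε ⊢; omega)).mul_right (ih _ (by simp at hε ⊢; omega))
  have := all N [] (by omega)
  rwa [List.append_nil] at this

noncomputable def U : Gam G →* P := mulHom D.φ (D.pw [true]) D.r3b'

theorem U_eq (γ : Gam G) : D.U γ = D.φ γ * D.pw [true] γ := rfl
theorem U_eq' (γ : Gam G) : D.U γ = D.φ γ * (D.I (fun _ => sw) * D.φ γ * (D.I (fun _ => sw))⁻¹) := by
  rw [U_eq, ← D.φ_move (by simp) sw_app]; rfl

theorem U_δ (γ : Gam G) (v : V) : Commute (D.U γ) (D.δ v) := by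
  rw [U_eq']; exact D.r5 γ v

def P0 : Subgroup P := Subgroup.closure ({p | ∃ α v, p = D.I (Pi.mulSingle α (cor [false] v))} ∪ Set.range D.φ)
def P1 : Subgroup P := Subgroup.closure ({p | ∃ α v, p = D.I (Pi.mulSingle α (cor [true] v))} ∪ Set.range (D.pw [true]))

theorem φ_P0 (γ : Gam G) : D.φ γ ∈ D.P0 := Subgroup.subset_closure (Or.inr ⟨γ, rfl⟩)
theorem pw_P1 (γ : Gam G) : D.pw [true] γ ∈ D.P1 := Subgroup.subset_closure (Or.inr ⟨γ, rfl⟩)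

theorem P_comm : ∀ p ∈ D.P0, ∀ q ∈ D.P1, Commute p q := by
  intro p hp q hq
  have h1 : D.P0 ≤ Subgroup.centralizer D.P1 := by
    rw [P0, Subgroup.closure_le]
    intro p hp
    rw [SetLike.mem_coe, Subgroup.mem_centralizer_iff]
    intro q hq
    have : D.P1 ≤ Subgroup.centralizer {p} := by
      rw [P1, Subgroup.closure_le]
      intro q hq
      rw [SetLike.mem_coe, Subgroup.mem_centralizer_singleton_iff]
      suffices Commute p q from this.symm.eq
      rcases hp with ⟨α, v, rfl⟩ | ⟨γ, rfl⟩ <;> rcases hq with ⟨β, w, rfl⟩ | ⟨γ', rfl⟩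
      · apply Commute.map
        by_cases h : α = β
        · subst h
          exact (cor_comm inc_ft v w).map (sgl α)
        · exact Pi.mulSingle_commute h _ _
      · apply D.pw_off (by simp)
        intro i y
        by_cases h : i = α
        · subst h
          rw [Pi.mulSingle_eq_same]; exact cor_fix inc_ft _ _
        · rw [Pi.mulSingle_eq_of_ne h]; rfl
      · exact D.r2 _ _ _
      · exact D.r3b' _ _
    exact Subgroup.mem_centralizer_singleton_iff.1 (this hq)
  exact (Subgroup.mem_centralizer_iff.1 (h1 hp) q hq).symm

noncomputable def sys : Sys S P where
  I := D.I
  U := D.U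
  P0 := D.P0
  P1 := D.P1
  P_comm := D.P_comm
  P0_U := by
    intro γ p hp
    have h := (D.P_comm p hp _ (D.pw_P1 γ)).symm.eq
    have : D.U γ * p * (D.U γ)⁻¹ = D.φ γ * p * (D.φ γ)⁻¹ := by
      rw [U_eq]
      calc _ = D.φ γ * (D.pw [true] γ * p) * (D.pw [true] γ)⁻¹ * (D.φ γ)⁻¹ := by group
        _ = _ := by rw [h]; group
    rw [this]
    exact mul_mem (mul_mem (D.φ_P0 γ) hp) (inv_mem (D.φ_P0 γ))
  P1_U := by
    intro γ p hp
    have h := (D.P_comm _ (D.φ_P0 γ) p hp).eq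
    have : D.U γ * p * (D.U γ)⁻¹ = D.pw [true] γ * p * (D.pw [true] γ)⁻¹ := by
      rw [U_eq, (D.r3b' γ γ).eq]
      calc _ = D.pw [true] γ * (D.φ γ * p) * (D.φ γ)⁻¹ * (D.pw [true] γ)⁻¹ := by group
        _ = _ := by rw [h]; group
    rw [this]
    exact mul_mem (mul_mem (D.pw_P1 γ) hp) (inv_mem (D.pw_P1 γ))
  I0 := fun α v => Subgroup.subset_closure (Or.inl ⟨α, v, rfl⟩)
  I1 := fun α v => Subgroup.subset_closure (Or.inl ⟨α, v, rfl⟩)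
  Uδ := D.U_δ
  rel6 := by
    intro α β g hg h v w
    rw [U_eq']; exact D.r6 α β g hg h v w
  rel7 := by
    intro v
    rw [U_eq', D.r7, ← map_inv, ← map_mul]
    congr 1
    have hc := (ind_disj (A := {S.a 1}) (B := {S.a 1}ᶜ) (fun z hz h => h hz) v v)
    rw [← ind_single, ← ind_compl {S.a 1} v]
    rw [hc.eq, mul_inv_cancel_right]

end Dat
end HE

namespace HE
open Classical

section piDat
variable {G : Type} [Group G]

def fib : (XX G → V) →* Equiv.Perm (XX G × Y) where
  toFun f := ⟨fun p => (p.1, (f p.1).1 p.2), fun p => (p.1, ((f p.1)⁻¹ : V).1 p.2),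
    fun p => by simp only [V_inv_app], fun p => by simp only [V_app_inv]⟩
  map_one' := by ext p : 1; rfl
  map_mul' f g := by ext p : 1; rfl

theorem fib_apply (f : XX G → V) (x : XX G) (y : Y) : fib f (x, y) = (x, (f x).1 y) := rfl

noncomputable def cA (A : Set Y) : Gam G →* Equiv.Perm (XX G × Y) where
  toFun γ := ⟨fun p => if p.2 ∈ A then (act γ p.1, p.2) else p, fun p => if p.2 ∈ A then (act γ⁻¹ p.1, p.2) else p,
    fun p => by by_cases h : p.2 ∈ A <;> simp [h, act_inv_act],
    fun p => by by_cases h : p.2 ∈ A <;> simp [h, act_act_inv]⟩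
  map_one' := by
    ext p : 1
    by_cases h : p.2 ∈ A <;> simp [h, act_one]
  map_mul' γ η := by
    ext p : 1
    by_cases h : p.2 ∈ A <;> simp [h, act_mul]

theorem cA_pos {A : Set Y} {y : Y} (h : y ∈ A) (γ : Gam G) (x : XX G) : cA A γ (x, y) = (act γ x, y) := if_pos h
theorem cA_neg {A : Set Y} {y : Y} (h : y ∉ A) (γ : Gam G) (x : XX G) : cA A γ (x, y) = (x, y) := if_neg h

theorem cA_comm {A B : Set Y} (h : ∀ y, y ∈ A → y ∉ B) (γ η : Gam G) : Commute (cA A γ) (cA B η) := by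
  show _ * _ = _ * _
  ext ⟨x, y⟩ : 1
  simp only [Equiv.Perm.mul_apply]
  by_cases hA : y ∈ A
  · rw [cA_neg (h y hA), cA_pos hA, cA_neg (h y hA)]
  · rw [cA_neg hA]
    by_cases hB : y ∈ B
    · rw [cA_pos hB, cA_neg hA]
    · rw [cA_neg hB, cA_neg hA]

theorem cA_mul {A B C : Set Y} (h : ∀ y, y ∈ A → y ∉ B) (hC : ∀ y, y ∈ C ↔ y ∈ A ∨ y ∈ B) (γ : Gam G) :
    cA C γ = cA A γ * cA B γ := by
  ext ⟨x, y⟩ : 1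
  simp only [Equiv.Perm.mul_apply]
  by_cases hA : y ∈ A
  · rw [cA_neg (h y hA), cA_pos hA, cA_pos ((hC y).2 (Or.inl hA))]
  · by_cases hB : y ∈ B
    · rw [cA_pos hB, cA_neg hA, cA_pos ((hC y).2 (Or.inr hB))]
    · rw [cA_neg hB, cA_neg hA, cA_neg (fun h => (((hC y).1 h).elim hA hB))]

theorem cA_fib {A : Set Y} {f : XX G → V} (h : ∀ x, ∀ y ∈ A, (f x).1 y = y) (γ : Gam G) : Commute (cA A γ) (fib f) := by
  show _ * _ = _ * _
  ext ⟨x, y⟩ : 1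
  simp only [Equiv.Perm.mul_apply]
  by_cases hA : y ∈ A
  · rw [fib_apply, h x y hA, cA_pos hA, fib_apply, h _ y hA]
  · rw [cA_neg hA, fib_apply, cA_neg]
    intro h2
    exact hA (by rwa [(f x).1.injective (h x _ h2)] at h2)

theorem cA_conj {A B : Set Y} {v : V} (h : ∀ y, v.1 y ∈ B ↔ y ∈ A) (γ : Gam G) :
    fib (fun _ => v) * cA A γ * (fib (fun _ => v))⁻¹ = cA B γ := by
  rw [mul_inv_eq_iff_eq_mul]
  ext ⟨x, y⟩ : 1
  simp only [Equiv.Perm.mul_apply]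
  by_cases hA : y ∈ A
  · rw [cA_pos hA, fib_apply, fib_apply, cA_pos ((h y).2 hA)]
  · rw [cA_neg hA, fib_apply, cA_neg (fun h' => hA ((h y).1 h'))]

theorem cA_univ (γ : Gam G) (f : XX G → V) :
    cA Set.univ γ * fib f * (cA Set.univ γ)⁻¹ = fib (actF γ f) := by
  rw [mul_inv_eq_iff_eq_mul]
  ext ⟨x, y⟩ : 1
  simp only [Equiv.Perm.mul_apply, fib_apply]
  rw [cA_pos (Set.mem_univ _), cA_pos (Set.mem_univ _), fib_apply, actF_act]

def cone (α : List Bool) : Set Y := {y | Pre α y}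

theorem cone_move {α β : List Bool} {v : V} (h : ∀ y, v.1 (app α y) = app β y) (y : Y) : v.1 y ∈ cone β ↔ y ∈ cone α := by
  constructor
  · rintro ⟨z, hz⟩
    rw [← h] at hz
    exact ⟨z, v.1.injective hz⟩
  · rintro ⟨z, rfl⟩
    exact ⟨z, h z⟩

theorem cone_inc {α β : List Bool} (h : Inc α β) (y : Y) (hy : y ∈ cone α) : y ∉ cone β := by
  obtain ⟨z, rfl⟩ := hy
  exact h.not_pre z

theorem cone_split (α : List Bool) (y : Y) : y ∈ cone α ↔ y ∈ cone (α ++ [false]) ∨ y ∈ cone (α ++ [true]) := by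
  constructor
  · rintro ⟨z, rfl⟩
    obtain ⟨b, z, rfl⟩ := exists_ycons z
    cases b
    · exact Or.inl ⟨z, (app_append α [false] z).symm⟩
    · exact Or.inr ⟨z, (app_append α [true] z).symm⟩
  · rintro (⟨z, rfl⟩ | ⟨z, rfl⟩) <;> exact ⟨_, app_append _ _ _⟩

theorem cone_nil : cone [] = Set.univ := by
  ext y; exact ⟨fun _ => trivial, fun _ => ⟨y, rfl⟩⟩

variable (S : Star G)

noncomputable def pI : (Fin S.k → V) →* (XX G → V) where
  toFun F := fun x => F (S.a x.hd)
  map_one' := rfl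
  map_mul' _ _ := rfl

theorem pI_single (α : Fin S.k) (v : V) : pI S (Pi.mulSingle α v) = hdF (ind {p | S.a p = α} v) := by
  funext x
  show (Pi.mulSingle α v : Fin S.k → V) (S.a x.hd) = ind {p | S.a p = α} v x.hd
  rw [ind_apply, ← ind_single, ind_apply]; rfl

noncomputable def piDat : Dat S (Equiv.Perm (XX G × Y)) := by
  have hsw : ∀ γ : Gam G, fib (fun _ => sw) * cA (cone [false]) γ * (fib (fun _ => sw))⁻¹ = cA (cone [true]) γ :=
    fun γ => cA_conj (cone_move sw_app) γ
  have hU : ∀ γ : Gam G, cA (cone [false]) γ * (fib (fun _ => sw) * cA (cone [false]) γ * (fib (fun _ => sw))⁻¹) = cA Set.univ γ := by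
    intro γ
    rw [hsw]
    exact (cA_mul (cone_inc inc_ft) (fun y => by rw [← cone_nil]; exact cone_split [] y) γ).symm
  refine
  { I := fib.comp (pI S)
    φ := cA (cone [false])
    r2 := ?_
    r3 := ?_
    r3b := ?_
    r4 := ?_
    r5 := ?_
    r6 := ?_
    r7 := ?_ }
  · intro γ α v
    apply cA_fib
    rintro x _ ⟨y, rfl⟩
    rw [pI_single, hdF_apply, ind_apply]
    split_ifs
    · exact cor_fix inc_ft.symm _ _
    · rfl
  · intro γ γ'
    have h0 := cA_conj (cone_move k0_app) γ
    have h1 := cA_conj (cone_move k1_app) γ'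
    show Commute (fib (fun _ => k0) * _ * (fib (fun _ => k0))⁻¹) (fib (fun _ => k1) * _ * (fib (fun _ => k1))⁻¹)
    rw [h0, h1]
    exact cA_comm (cone_inc (inc_ft.prep [false])) _ _
  · intro γ γ'
    show Commute _ (fib (fun _ => sw) * _ * (fib (fun _ => sw))⁻¹)
    rw [hsw]
    exact cA_comm (cone_inc inc_ft) _ _
  · intro γ
    have h0 := cA_conj (cone_move k0_app) γ
    have h1 := cA_conj (cone_move k1_app) γ
    show _ = (fib (fun _ => k0) * _ * (fib (fun _ => k0))⁻¹) * (fib (fun _ => k1) * _ * (fib (fun _ => k1))⁻¹)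
    rw [h0, h1]
    exact cA_mul (cone_inc (inc_ft.prep [false])) (cone_split [false]) _
  · intro γ v
    show Commute (_ * (fib (fun _ => sw) * _ * (fib (fun _ => sw))⁻¹)) (fib (fun _ => v))
    rw [hU]
    have := cA_univ γ (fun _ => v)
    rw [mul_inv_eq_iff_eq_mul] at this
    exact this
  · intro α β g hg h v w
    show Commute (fib (pI S _)) ((_ * (fib (fun _ => sw) * _ * (fib (fun _ => sw))⁻¹)) * (fib (pI S _)) * (_ * (fib (fun _ => sw) * _ * (fib (fun _ => sw))⁻¹))⁻¹)
    rw [hU, cA_univ]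
    apply Commute.map
    apply commute_disj
    intro x
    rw [pI_single, pI_single, actF_apply, hdF_apply, hdF_apply, ind_apply, ind_apply, ← map_inv, act_G]
    by_cases h1 : S.a x.hd = α
    · right
      rw [if_neg]
      intro h2
      exact h _ ⟨h1, h2⟩
    · left
      exact if_neg h1
  · intro v
    show ((_ * (fib (fun _ => sw) * _ * (fib (fun _ => sw))⁻¹)) * (fib (pI S _)) * (_ * (fib (fun _ => sw) * _ * (fib (fun _ => sw))⁻¹))⁻¹) = fib (pI S _)
    rw [hU, cA_univ]
    congr 1
    funext x
    rw [actF_apply, gT_inv, act_T, ← ind_single]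
    show ind {S.a 1} v (S.a _) = ind {S.a 1}ᶜ v (S.a _)
    by_cases hx : x.hd = 1
    · rw [tf_one hx, ind_neg, ind_neg]
      · simp [hx]
      · intro h; exact sh_ne x (S.isol _ h)
    · rw [tf_ne hx, ind_pos, ind_pos]
      · intro h; exact hx (S.isol _ h)
      · rfl

end piDat

namespace Dat
variable {G : Type} [Group G] {S : Star G} {P : Type} [Group P] (D : Dat S P)

noncomputable def corF (k : ℕ) (w : List Bool) : (Fin k → V) →* (Fin k → V) :=
  MonoidHom.pi (fun α => (cor w).comp (Pi.evalMonoidHom _ α))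

theorem corF_single (k : ℕ) (w : List Bool) (α : Fin k) (v : V) :
    corF k w (Pi.mulSingle α v) = Pi.mulSingle α (cor w v) := by
  funext β
  show cor w ((Pi.mulSingle α v : Fin k → V) β) = _
  by_cases hb : β = α
  · subst hb; simp
  · simp [Pi.mulSingle_eq_of_ne hb]

theorem φ_conj0 (γ : Gam G) {p : P} (hp : p ∈ D.P0) : D.U γ * p * (D.U γ)⁻¹ = D.φ γ * p * (D.φ γ)⁻¹ := by
  have h := (D.P_comm p hp _ (D.pw_P1 γ)).symm.eq
  rw [U_eq]
  calc _ = D.φ γ * (D.pw [true] γ * p) * (D.pw [true] γ)⁻¹ * (D.φ γ)⁻¹ := by group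
    _ = _ := by rw [h]; group

theorem c0_move {μ : V} {α β : List Bool} (h : ∀ y, μ.1 (app α y) = app β y) (γ : Gam G) :
    D.δ (cor [false] μ) * D.pw (false :: α) γ * (D.δ (cor [false] μ))⁻¹ = D.pw (false :: β) γ :=
  D.pw_move (by simp) (by simp) (fun y => by
    have := cor_app [false] μ (app α y)
    rw [h] at this
    exact this) γ

noncomputable def c0Dat : Dat S P := by
  have hsw := fun γ => D.c0_move sw_app γ
  have h0 := fun γ => D.c0_move k0_app γ
  have h1 := fun γ => D.c0_move k1_app γ
  have hU : ∀ γ : Gam G, D.pw [false, false] γ * (D.δ (cor [false] sw) * D.pw [false, false] γ * (D.δ (cor [false] sw))⁻¹) = D.φ γ := by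
    intro γ
    rw [hsw, ← r4']
  have hP0 : ∀ α v, D.I (Pi.mulSingle α (cor [false] v)) ∈ D.P0 := fun α v => D.sys.I0 α v
  refine
  { I := D.I.comp (corF S.k [false])
    φ := D.pw [false, false]
    r2 := ?_
    r3 := ?_
    r3b := ?_
    r4 := ?_
    r5 := ?_
    r6 := ?_
    r7 := ?_ }
  · intro γ α v
    symm
    show Commute (D.I (corF _ _ _)) _
    rw [corF_single, cor_cor]
    apply D.pw_off (by simp)
    intro i y
    rw [← ind_single, ind_apply]
    split_ifs
    · exact cor_fix (inc_ft.symm.prep [false]) _ _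
    · rfl
  · intro γ γ'
    show Commute (D.δ (cor [false] k0) * _ * (D.δ (cor [false] k0))⁻¹) (D.δ (cor [false] k1) * _ * (D.δ (cor [false] k1))⁻¹)
    rw [h0, h1]
    exact D.pw_comm (inc_ft.prep [false, false]) _ _
  · intro γ γ'
    show Commute _ (D.δ (cor [false] sw) * _ * (D.δ (cor [false] sw))⁻¹)
    rw [hsw]
    exact D.pw_comm (inc_ft.prep [false]) _ _
  · intro γ
    show _ = (D.δ (cor [false] k0) * _ * (D.δ (cor [false] k0))⁻¹) * (D.δ (cor [false] k1) * _ * (D.δ (cor [false] k1))⁻¹)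
    rw [h0, h1]
    exact D.pw_split (by simp) _
  · intro γ v
    show Commute (_ * (D.δ (cor [false] sw) * _ * (D.δ (cor [false] sw))⁻¹)) (D.δ (cor [false] v))
    rw [hU]
    have e : D.φ γ = D.U γ * (D.pw [true] γ)⁻¹ := by rw [U_eq]; group
    rw [e]
    exact (D.U_δ γ _).mul_left (D.pw_offδ (by simp) γ (cor_fix inc_ft _)).symm.inv_left
  · intro α β g hg h v w
    show Commute (D.I (corF _ _ _)) ((_ * (D.δ (cor [false] sw) * _ * (D.δ (cor [false] sw))⁻¹)) * (D.I (corF _ _ _)) * (_ * (D.δ (cor [false] sw) * _ * (D.δ (cor [false] sw))⁻¹))⁻¹)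
    rw [hU, corF_single, corF_single, ← D.φ_conj0 _ (hP0 _ _)]
    exact D.sys.rel6 α β g hg h _ _
  · intro v
    show ((_ * (D.δ (cor [false] sw) * _ * (D.δ (cor [false] sw))⁻¹)) * (D.I (corF _ _ _)) * (_ * (D.δ (cor [false] sw) * _ * (D.δ (cor [false] sw))⁻¹))⁻¹) = D.I (corF _ _ _)
    rw [hU, corF_single, ← D.φ_conj0 _ (hP0 _ _), U_eq', D.r7]
    congr 1
    funext i
    show _ = cor [false] (ind {S.a 1}ᶜ v i)
    rw [ind_apply, ind_apply]
    split_ifs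
    · rfl
    · exact (map_one _).symm

structure Univ (D : Dat S P) : Prop where
  hom : ∀ (Q : Type) [Group Q] (E : Dat S Q), ∃ h : P →* Q, (∀ F, h (D.I F) = E.I F) ∧ ∀ γ, h (D.φ γ) = E.φ γ
  gen : ∀ H : Subgroup P, (∀ F, D.I F ∈ H) → (∀ γ, D.φ γ ∈ H) → H = ⊤

namespace Univ
variable {D} (u : D.Univ)

noncomputable def π : P →* Equiv.Perm (XX G × Y) := (u.hom _ (piDat S)).choose
theorem π_I (F : Fin S.k → V) : u.π (D.I F) = fib (pI S F) := (u.hom _ (piDat S)).choose_spec.1 F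
theorem π_φ (γ : Gam G) : u.π (D.φ γ) = cA (cone [false]) γ := (u.hom _ (piDat S)).choose_spec.2 γ
theorem π_δ (v : V) : u.π (D.δ v) = fib (fun _ => v) := u.π_I _
theorem π_pw {α : List Bool} (hα : α ≠ []) (γ : Gam G) : u.π (D.pw α γ) = cA (cone α) γ := by
  rw [pw_eq, map_mul, map_mul, map_inv, π_δ, π_φ]
  exact cA_conj (cone_move (mv_app (by simp) hα)) γ
theorem π_U (γ : Gam G) : u.π (D.U γ) = cA Set.univ γ := by
  rw [U_eq, map_mul, π_φ, u.π_pw (by simp)]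
  exact (cA_mul (cone_inc inc_ft) (fun y => by rw [← cone_nil]; exact cone_split [] y) γ).symm

theorem π_L [Nonempty (Lt G)] {f : XX G → V} (hf : f ∈ LCX S) : u.π (D.sys.Lm ⟨f, hf⟩) = fib f := by
  let H : Subgroup (XX G → V) :=
    { carrier := {f | ∃ hf : f ∈ LCX S, u.π (D.sys.Lm ⟨f, hf⟩) = fib f}
      one_mem' := ⟨one_mem _, by
        have : (⟨1, one_mem _⟩ : LCX S) = 1 := rfl
        rw [this, map_one, map_one, map_one]⟩
      mul_mem' := by
        rintro a b ⟨ha, ha'⟩ ⟨hb, hb'⟩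
        refine ⟨mul_mem ha hb, ?_⟩
        have : (⟨a * b, mul_mem ha hb⟩ : LCX S) = ⟨a, ha⟩ * ⟨b, hb⟩ := rfl
        rw [this, map_mul, map_mul, ha', hb', map_mul]
      inv_mem' := by
        rintro a ⟨ha, ha'⟩
        refine ⟨inv_mem ha, ?_⟩
        have : (⟨a⁻¹, inv_mem ha⟩ : LCX S) = ⟨a, ha⟩⁻¹ := rfl
        rw [this, map_inv, map_inv, ha', map_inv] }
  have : f ∈ H := by
    refine LCX_min S H ?_ ?_ hf
    · intro α v
      refine ⟨hdF_LCX S (Sys.ind_a_LCG α v), ?_⟩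
      rw [Sys.Lm_gen]
      rw [← pI_single]
      exact u.π_I _
    · rintro γ f ⟨hf, h⟩
      refine ⟨actF_LCX S γ hf, ?_⟩
      rw [Sys.Lm_act _ _ hf, map_mul, map_mul, map_inv, h]
      have : u.π (D.sys.U γ) = _ := u.π_U γ
      rw [this, cA_univ]
  exact this.2

noncomputable def c0 : P →* P := (u.hom _ D.c0Dat).choose
theorem c0_I (F : Fin S.k → V) : u.c0 (D.I F) = D.I (corF S.k [false] F) := (u.hom _ D.c0Dat).choose_spec.1 F
theorem c0_φ (γ : Gam G) : u.c0 (D.φ γ) = D.pw [false, false] γ := (u.hom _ D.c0Dat).choose_spec.2 γ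
theorem c0_δ (v : V) : u.c0 (D.δ v) = D.δ (cor [false] v) := u.c0_I _

theorem ext (u : D.Univ) {Q : Type} [Group Q] {f g : P →* Q} (h1 : ∀ F, f (D.I F) = g (D.I F)) (h2 : ∀ γ, f (D.φ γ) = g (D.φ γ)) :
    f = g := by
  have := u.gen (f.eqLocus g) h1 h2
  ext p
  have hp : p ∈ f.eqLocus g := by rw [this]; trivial
  exact hp

theorem induct (u : D.Univ) {p : P → Prop} (h1 : p 1) (hI : ∀ F w, p w → p (D.I F * w)) (hφ : ∀ γ w, p w → p (D.φ γ * w))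
    (w : P) : p w := by
  have : w ∈ Subgroup.closure (Set.range D.I ∪ Set.range D.φ) := by
    rw [u.gen _ (fun F => Subgroup.subset_closure (Or.inl ⟨F, rfl⟩)) (fun γ => Subgroup.subset_closure (Or.inr ⟨γ, rfl⟩))]
    trivial
  induction this using Subgroup.closure_induction_left with
  | one => exact h1
  | mul_left x hx y _ ih =>
    rcases hx with ⟨F, rfl⟩ | ⟨γ, rfl⟩
    · exact hI _ _ ih
    · exact hφ _ _ ih
  | inv_mul_cancel x hx y _ ih =>
    rcases hx with ⟨F, rfl⟩ | ⟨γ, rfl⟩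
    · rw [← map_inv]; exact hI _ _ ih
    · rw [← map_inv]; exact hφ _ _ ih

end Univ
end Dat
end HE

namespace HE
open Classical

section LC
variable {G : Type} [Group G] {S : Star G}

theorem LCX_comp (T : V → V) {f : XX G → V} (hf : f ∈ LCX S) : (fun x => T (f x)) ∈ LCX S := by
  obtain ⟨n, hn⟩ := hf
  exact ⟨n, fun x y h => by simp only [hn x y h]⟩

theorem LCX_const (v : V) : (fun _ => v) ∈ LCX S := ⟨0, fun _ _ _ => rfl⟩

theorem LCX_pI [Nonempty (Lt G)] (F : Fin S.k → V) : pI S F ∈ LCX S := by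
  have : F ∈ (LCX S).comap (pI S) := by
    apply Subgroup.pi_mem_of_mulSingle_mem
    intro α
    rw [Subgroup.mem_comap, pI_single]
    exact hdF_LCX S (Sys.ind_a_LCG α _)
  exact this

end LC

namespace Dat
variable {G : Type} [Group G] {S : Star G} {P : Type} [Group P] (D : Dat S P) [Nonempty (Lt G)]

noncomputable def L (f : XX G → V) : P := if h : f ∈ LCX S then D.sys.Lm ⟨f, h⟩ else 1

variable {D}
theorem L_eq {f : XX G → V} (hf : f ∈ LCX S) : D.L f = D.sys.Lm ⟨f, hf⟩ := dif_pos hf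

theorem L_mul {f g : XX G → V} (hf : f ∈ LCX S) (hg : g ∈ LCX S) : D.L (f * g) = D.L f * D.L g := by
  rw [L_eq hf, L_eq hg, L_eq (mul_mem hf hg), Sys.Lm_mul]

theorem L_one : D.L 1 = 1 := by
  rw [L_eq (one_mem _)]; exact map_one _

theorem L_inv {f : XX G → V} (hf : f ∈ LCX S) : D.L f⁻¹ = (D.L f)⁻¹ := by
  rw [eq_inv_iff_mul_eq_one, ← L_mul (inv_mem hf) hf, inv_mul_cancel, L_one]

theorem L_conj {f g : XX G → V} (hf : f ∈ LCX S) (hg : g ∈ LCX S) : D.L f * D.L g * (D.L f)⁻¹ = D.L (f * g * f⁻¹) := by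
  rw [L_mul (mul_mem hf hg) (inv_mem hf), L_mul hf hg, L_inv hf]

theorem L_const (v : V) : D.L (fun _ => v) = D.δ v := by
  rw [L_eq (LCX_const v), Sys.Lm_const]; rfl

theorem L_act (γ : Gam G) {f : XX G → V} (hf : f ∈ LCX S) : D.U γ * D.L f * (D.U γ)⁻¹ = D.L (actF γ f) := by
  rw [L_eq hf, L_eq (actF_LCX S γ hf), Sys.Lm_act _ γ hf]; rfl

theorem L_I (F : Fin S.k → V) : D.L (pI S F) = D.I F := by
  let H : Subgroup (Fin S.k → V) :=
    { carrier := {F | D.L (pI S F) = D.I F}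
      one_mem' := by
        show D.L (pI S 1) = _
        rw [map_one, map_one]; exact L_one
      mul_mem' := by
        intro a b ha hb
        show D.L (pI S (a * b)) = _
        rw [map_mul, map_mul, L_mul (LCX_pI a) (LCX_pI b), ha, hb]
      inv_mem' := by
        intro a ha
        show D.L (pI S a⁻¹) = _
        rw [map_inv, map_inv, L_inv (LCX_pI a), ha] }
  have : F ∈ H := by
    apply Subgroup.pi_mem_of_mulSingle_mem
    intro α
    show D.L (pI S _) = _
    rw [pI_single, L_eq (hdF_LCX S (Sys.ind_a_LCG α _)), Sys.Lm_gen]; rfl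
  exact this

/-- functions fixing the cone pointwise commute with the cone action -/
theorem L_off {f : XX G → V} (hf : f ∈ LCX S) {α : List Bool} (hα : α ≠ []) (h : ∀ x y, (f x).1 (app α y) = app α y)
    (γ : Gam G) : Commute (D.L f) (D.pw α γ) := by
  have key : ∀ f ∈ LCX S, (∀ x y, (f x).1 (app [false] y) = app [false] y) → Commute (D.L f) (D.φ γ) := by
    intro f hf h
    rw [L_eq hf]
    exact (D.P_comm _ (D.φ_P0 γ) _ (D.sys.Lm_m1 hf (fun x => fix_cor (h x)))).symm
  have hc := LCX_const (S := S) (mv [false] α)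
  have hc' := LCX_const (S := S) (mv [false] α)⁻¹
  have := key _ (mul_mem (mul_mem hc' hf) hc) (fun x y => by
    show ((mv [false] α)⁻¹ * f x * mv [false] α).1 _ = _
    rw [V_mul, V_mul, mv_app (by simp) hα, h]; exact V_inv_eq (mv_app (by simp) hα y))
  have h2 := this.map (cj (D.δ (mv [false] α)))
  rw [cj_apply, cj_apply, ← pw_eq] at h2
  convert h2 using 1
  rw [L_mul (mul_mem hc' hf) hc, L_mul hc' hf, L_const, L_const, map_inv]
  group

theorem L_in {f : XX G → V} (hf : f ∈ LCX S) (h : ∀ x, ∃ v, f x = cor [false] v) (γ : Gam G) :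
    D.φ γ * D.L f * (D.φ γ)⁻¹ = D.L (actF γ f) := by
  rw [← L_act γ hf, D.φ_conj0]
  rw [L_eq hf]; exact D.sys.Lm_m0 hf h

namespace Univ
variable (u : D.Univ)

theorem π_L' {f : XX G → V} (hf : f ∈ LCX S) : u.π (D.L f) = fib f := by rw [L_eq hf, π_L]

theorem c0_P1 (w : P) {p : P} (hp : p ∈ D.P1) : Commute (u.c0 w) p := by
  have key : D.P1 ≤ Subgroup.centralizer (u.c0.range : Set P) := by
    rw [P1, Subgroup.closure_le]
    intro q hq
    rw [SetLike.mem_coe, Subgroup.mem_centralizer_iff]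
    rintro _ ⟨w, rfl⟩
    suffices Commute (u.c0 w) q from this.eq
    induction w using u.induct with
    | h1 => rw [map_one]; exact Commute.one_left _
    | hI F w ih =>
      rw [map_mul]
      refine Commute.mul_left ?_ ih
      rw [c0_I]
      rcases hq with ⟨α, v, rfl⟩ | ⟨γ, rfl⟩
      · apply Commute.map
        show _ * _ = _ * _
        funext i
        show cor [false] (F i) * (Pi.mulSingle α (cor [true] v) : Fin S.k → V) i = (Pi.mulSingle α (cor [true] v) : Fin S.k → V) i * cor [false] (F i)
        rw [← ind_single, ind_apply]
        split_ifs
        · exact (cor_comm inc_ft _ _).eq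
        · simp
      · apply D.pw_off (by simp)
        intro i y
        exact cor_fix inc_ft _ _
    | hφ γ w ih =>
      rw [map_mul]
      refine Commute.mul_left ?_ ih
      rw [c0_φ]
      rcases hq with ⟨α, v, rfl⟩ | ⟨γ', rfl⟩
      · symm
        apply D.pw_off (by simp)
        intro i y
        rw [← ind_single, ind_apply]
        split_ifs
        · exact cor_fix (inc_cons (by simp) _ _) _ _
        · rfl
      · exact D.pw_comm (inc_cons (by simp) _ _) _ _
  exact Subgroup.mem_centralizer_iff.1 (key hp) _ ⟨w, rfl⟩

end Univ
end Dat
end HE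

namespace HE
open Classical

theorem finDepth {k : ℕ} (F : Fin k → V) (K : ℕ) : ∃ N, ∀ i α, N ≤ α.length → ∃ β : List Bool, K ≤ β.length ∧ ∀ y, (F i).1 (app α y) = app β y := by
  choose m hm using fun i => V_depth2 (F i) K
  obtain ⟨N, hN⟩ := Finite.exists_le m
  exact ⟨N, fun i α h => hm i α ((hN i).trans h)⟩

theorem RR_cyl {G : Type} [Group G] {S : Star G} (n : ℕ) (x : XX G) : ∃ l : List (Lt G), ∀ σ, (RR S n) ⟨x.hd, slist l σ⟩ x := by
  induction n generalizing x with
  | zero => exact ⟨[], fun σ => (S.r 0).refl _⟩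
  | succ n ih =>
    obtain ⟨l, hl⟩ := ih (sh x)
    exact ⟨x.tl 0 :: l, fun σ => ⟨(S.r _).refl _, fun _ => hl σ⟩⟩

namespace Dat.Univ
variable {G : Type} [Group G] {S : Star G} {P : Type} [Group P] {D : Dat S P} [Nonempty (Lt G)] (u : D.Univ)

def Claim1 (w : P) : Prop := ∀ K, ∃ N, ∀ β : List Bool, N ≤ β.length → ∃ n, ∀ x0, ∃ (γ : Gam G) (α : List Bool),
  K ≤ α.length ∧ (∀ x, (RR S n) x x0 → ∀ y, u.π w (x, app β y) = (act γ x, app α y)) ∧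
  ∀ E : Set (XX G), (∀ x ∈ E, (RR S n) x x0) → (∀ v, ind E v ∈ LCX S) →
    u.c0 w * D.L (ind E (tr (false :: β) (true :: false :: β))) * (u.c0 w)⁻¹ =
      D.φ γ * D.L (ind E (tr (false :: α) (true :: false :: β))) * (D.φ γ)⁻¹

theorem inc01 (α β : List Bool) : Inc (false :: α) (true :: β) := inc_cons (by simp) _ _

theorem claim1_one : u.Claim1 1 := by
  intro K
  refine ⟨K, fun β hβ => ⟨0, fun x0 => ⟨1, β, hβ, ?_, ?_⟩⟩⟩
  · intro x _ y
    rw [map_one, act_one]; rfl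
  · intro E _ _
    rw [map_one, map_one]

theorem claim1_I (F : Fin S.k → V) (w : P) (ih : u.Claim1 w) : u.Claim1 (D.I F * w) := by
  intro K
  obtain ⟨N1, hN1⟩ := finDepth F K
  obtain ⟨N, hN⟩ := ih N1
  refine ⟨N, fun β hβ => ?_⟩
  obtain ⟨n0, hn0⟩ := hN β hβ
  choose γ α h1 h2 h3 using hn0
  haveI := RR_fin S n0
  have hm : ∀ c : Quotient (RR S n0), ∃ m, actF (γ c.out)⁻¹ (pI S F) ∈ LS (RR S m) :=
    fun c => actF_LCX S _ (LCX_pI F)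
  choose m hm using hm
  obtain ⟨M, hM⟩ := Finite.exists_le m
  refine ⟨max n0 M, fun x0 => ?_⟩
  let c : Quotient (RR S n0) := Quotient.mk _ x0
  have hc : (RR S n0) x0 c.out := (RR S n0).symm (Quotient.mk_out (s := RR S n0) x0)
  obtain ⟨α', hα', hv⟩ := hN1 (S.a (act (γ c.out) x0).hd) (α c.out) (h1 _)
  have hF : ∀ x, (RR S (max n0 M)) x x0 → pI S F (act (γ c.out) x) = F (S.a (act (γ c.out) x0).hd) := by
    intro x hx
    have := hm c x x0 (RR_le S (le_trans (hM c) (le_max_right _ _)) hx)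
    rw [actF_apply, actF_apply, inv_inv] at this
    exact this
  have hR : ∀ x, (RR S (max n0 M)) x x0 → (RR S n0) x c.out :=
    fun x hx => (RR S n0).trans (RR_le S (le_max_left _ _) hx) hc
  refine ⟨γ c.out, α', hα', ?_, ?_⟩
  · intro x hx y
    rw [map_mul, Equiv.Perm.mul_apply, h2 c.out x (hR x hx) y, π_I, fib_apply, hF x hx, hv]
  · intro E hE hLE
    have e := h3 c.out E (fun x hx => hR x (hE x hx)) hLE
    have hg : pI S (corF S.k [false] F) ∈ LCX S := LCX_pI _
    have e2 := L_in (D := D) hg (fun x => ⟨F (S.a x.hd), rfl⟩) (γ c.out)⁻¹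
    have hg' := actF_LCX S (γ c.out)⁻¹ hg
    have e3 : actF (γ c.out)⁻¹ (pI S (corF S.k [false] F)) * ind E (tr (false :: α c.out) (true :: false :: β)) * (actF (γ c.out)⁻¹ (pI S (corF S.k [false] F)))⁻¹
        = ind E (tr (false :: α') (true :: false :: β)) := by
      funext x
      simp only [Pi.mul_apply, Pi.inv_apply]
      by_cases hx : x ∈ E
      · rw [ind_pos hx, ind_pos hx, actF_apply, inv_inv]
        have : pI S (corF S.k [false] F) (act (γ c.out) x) = cor [false] (F (S.a (act (γ c.out) x0).hd)) := by
          rw [← hF x (hE x hx)]; rfl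
        rw [this]
        apply tr_conj (inc01 _ _)
        · intro y
          have := cor_app [false] (F (S.a (act (γ c.out) x0).hd)) (app (α c.out) y)
          rw [hv] at this
          exact this
        · intro y
          exact cor_fix (w := [false]) (inc01 [] (false :: β)) _ y
      · rw [ind_neg hx, ind_neg hx]; simp
    rw [← e3, ← L_conj hg' (hLE _), ← e2, map_mul, c0_I, ← L_I]
    rw [map_inv]
    calc _ = D.L (pI S (corF S.k [false] F)) * (u.c0 w * D.L (ind E (tr (false :: β) (true :: false :: β))) * (u.c0 w)⁻¹) * (D.L (pI S (corF S.k [false] F)))⁻¹ := by group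
      _ = _ := by rw [e]; group

theorem pw_conj (γ η : Gam G) (b : Bool) : D.φ γ * D.pw [false, b] η * (D.φ γ)⁻¹ = D.pw [false, b] (γ * η * γ⁻¹) := by
  cases b with
  | false =>
    rw [r4', map_mul, map_mul, map_inv]
    have := (D.r3' η γ).eq
    calc _ = D.pw [false, false] γ * (D.pw [false, true] γ * D.pw [false, false] η) * (D.pw [false, true] γ)⁻¹ * (D.pw [false, false] γ)⁻¹ := by group
      _ = _ := by rw [← this]; group
  | true =>
    rw [r4', map_mul, map_mul, map_inv]
    have := (D.r3' γ (γ * η * γ⁻¹)).eq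
    rw [map_mul, map_mul, map_inv] at this
    calc _ = D.pw [false, false] γ * (D.pw [false, true] γ * D.pw [false, true] η * (D.pw [false, true] γ)⁻¹) * (D.pw [false, false] γ)⁻¹ := by group
      _ = _ := by rw [this]; group

theorem claim1_φ (η : Gam G) (w : P) (ih : u.Claim1 w) : u.Claim1 (D.φ η * w) := by
  intro K
  obtain ⟨N, hN⟩ := ih (max K 1)
  refine ⟨N, fun β hβ => ?_⟩
  obtain ⟨n0, hn0⟩ := hN β hβ
  refine ⟨n0, fun x0 => ?_⟩
  obtain ⟨γ, α, h1, h2, h3⟩ := hn0 x0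
  have key : ∀ (b b' : Bool) (α' : List Bool), b ≠ b' → α = b :: α' → ∀ E : Set (XX G), (∀ v, ind E v ∈ LCX S) → ∀ η, Commute
      (D.L (ind E (tr (false :: α) (true :: false :: β)))) (D.pw [false, b'] η) := by
    intro b b' α' hb hα E hE η
    apply L_off (hE _) (by simp)
    intro x y
    by_cases hx : x ∈ E
    · rw [ind_pos hx]
      apply tr_fix
      · subst hα
        exact (inc_cons hb.symm [] α').prep [false]
      · exact inc_cons (by simp) _ _
    · rw [ind_neg hx]; rfl
  obtain ⟨b, α', rfl⟩ := List.exists_cons_of_ne_nil (List.ne_nil_of_length_pos ((le_max_right _ _).trans h1))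
  cases b with
  | false =>
    refine ⟨η * γ, false :: α', (le_max_left _ _).trans h1, ?_, ?_⟩
    · intro x hx y
      rw [map_mul, Equiv.Perm.mul_apply, h2 x hx y, π_φ, cA_pos (show app (false :: α') y ∈ cone [false] from ⟨app α' y, rfl⟩), act_mul]
    · intro E hE hLE
      have e := h3 E hE hLE
      have k := key false true α' (by simp) rfl E hLE (γ⁻¹ * η * γ)
      have c := pw_conj (D := D) γ (γ⁻¹ * η * γ) true
      have c' : D.pw [false, true] η * D.φ γ = D.φ γ * D.pw [false, true] (γ⁻¹ * η * γ) := by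
        have : γ * (γ⁻¹ * η * γ) * γ⁻¹ = η := by group
        rw [this] at c
        rw [← c]; group
      rw [map_mul, c0_φ, map_mul, D.r4' η]
      calc _ = D.pw [false, false] η * (u.c0 w * D.L (ind E (tr (false :: β) (true :: false :: β))) * (u.c0 w)⁻¹) * (D.pw [false, false] η)⁻¹ := by group
        _ = D.pw [false, false] η * (D.φ γ * (D.L (ind E (tr (false :: false :: α') (true :: false :: β))) * D.pw [false, true] (γ⁻¹ * η * γ)) * (D.pw [false, true] (γ⁻¹ * η * γ))⁻¹ * (D.φ γ)⁻¹) * (D.pw [false, false] η)⁻¹ := by rw [e]; group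
        _ = D.pw [false, false] η * ((D.φ γ * D.pw [false, true] (γ⁻¹ * η * γ)) * D.L (ind E (tr (false :: false :: α') (true :: false :: β))) * (D.φ γ * D.pw [false, true] (γ⁻¹ * η * γ))⁻¹) * (D.pw [false, false] η)⁻¹ := by rw [k.eq]; group
        _ = _ := by rw [← c']; group
  | true =>
    refine ⟨γ, true :: α', (le_max_left _ _).trans h1, ?_, ?_⟩
    · intro x hx y
      rw [map_mul, Equiv.Perm.mul_apply, h2 x hx y, π_φ, cA_neg]
      exact cone_inc inc_ft.symm _ ⟨app α' y, rfl⟩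
    · intro E hE hLE
      have e := h3 E hE hLE
      have k := key true false α' (by simp) rfl E hLE (γ⁻¹ * η * γ)
      have c := pw_conj (D := D) γ (γ⁻¹ * η * γ) false
      have c' : D.pw [false, false] η * D.φ γ = D.φ γ * D.pw [false, false] (γ⁻¹ * η * γ) := by
        have : γ * (γ⁻¹ * η * γ) * γ⁻¹ = η := by group
        rw [this] at c
        rw [← c]; group
      rw [map_mul, c0_φ]
      calc _ = D.pw [false, false] η * (u.c0 w * D.L (ind E (tr (false :: β) (true :: false :: β))) * (u.c0 w)⁻¹) * (D.pw [false, false] η)⁻¹ := by group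
        _ = (D.pw [false, false] η * D.φ γ) * D.L (ind E (tr (false :: true :: α') (true :: false :: β))) * (D.pw [false, false] η * D.φ γ)⁻¹ := by rw [e]; group
        _ = D.φ γ * (D.pw [false, false] (γ⁻¹ * η * γ) * D.L (ind E (tr (false :: true :: α') (true :: false :: β)))) * (D.pw [false, false] (γ⁻¹ * η * γ))⁻¹ * (D.φ γ)⁻¹ := by rw [c']; group
        _ = _ := by rw [← k.eq]; group

theorem claim1 (w : P) : u.Claim1 w :=
  u.induct u.claim1_one u.claim1_I u.claim1_φ w

theorem ker_tr [Nontrivial (Lt G)] {w : P} (hw : u.π w = 1) :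
    Commute (u.c0 w) (D.δ (tr [false] [true, false])) := by
  obtain ⟨N, hN⟩ := u.claim1 w 0
  have deep : ∀ β : List Bool, N ≤ β.length → Commute (u.c0 w) (D.δ (tr (false :: β) (true :: false :: β))) := by
    intro β hβ
    obtain ⟨n, hn⟩ := hN β hβ
    haveI := RR_fin S n
    let H : Subgroup (XX G → V) :=
      { carrier := {f | f ∈ LCX S ∧ Commute (u.c0 w) (D.L f)}
        one_mem' := ⟨one_mem _, by rw [L_one]; exact Commute.one_right _⟩
        mul_mem' := fun ha hb => ⟨mul_mem ha.1 hb.1, by rw [L_mul ha.1 hb.1]; exact ha.2.mul_right hb.2⟩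
        inv_mem' := fun ha => ⟨inv_mem ha.1, by rw [L_inv ha.1]; exact ha.2.inv_right⟩ }
    have : (fun _ => tr (false :: β) (true :: false :: β)) ∈ H := by
      refine LS_induct (RR S n) H (fun _ _ _ => rfl) ?_
      intro x0
      have hL : ∀ v, ind {x | (RR S n) x x0} v ∈ LCX S := fun v => ⟨n, LS_ind (fun x y hxy hx => (RR S n).trans ((RR S n).symm hxy) hx) v⟩
      refine ⟨hL _, ?_⟩
      obtain ⟨γ, α, -, h2, h3⟩ := hn x0
      have h4 : ∀ x, (RR S n) x x0 → act γ x = x := by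
        intro x hx
        have := h2 x hx (fun _ => true)
        rw [hw] at this
        exact (Prod.ext_iff.1 this).1.symm
      have hα : α = β := by
        apply eq_of_app_eq
        intro y
        have := h2 x0 ((RR S n).refl _) y
        rw [hw] at this
        exact (Prod.ext_iff.1 this).2.symm
      obtain ⟨l, hl⟩ := RR_cyl (S := S) n x0
      have hγ : γ = 1 := top_free γ x0.hd l (fun σ => h4 _ (hl σ))
      have := h3 _ (fun x hx => hx) hL
      rw [hγ, hα, map_one, one_mul, inv_one, mul_one, mul_inv_eq_iff_eq_mul] at this
      exact this
    have h2 := this.2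
    rw [L_const] at h2
    exact h2
  have all : ∀ n (β : List Bool), N ≤ β.length + n → Commute (u.c0 w) (D.δ (tr (false :: β) (true :: false :: β))) := by
    intro n
    induction n with
    | zero => exact deep
    | succ n ih =>
      intro β hβ
      rw [tr_split (inc01 _ _), map_mul]
      exact (ih (β ++ [false]) (by simp; omega)).mul_right (ih (β ++ [true]) (by simp; omega))
  exact all N [] (by omega)

theorem ker_central [Nontrivial (Lt G)] {w : P} (hw : u.π w = 1) (p : P) : Commute (u.c0 w) p := by
  have hδ : ∀ v, Commute (u.c0 w) (D.δ v) := by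
    have : (Subgroup.centralizer {u.c0 w}).comap D.δ = ⊤ := by
      apply V_gen
      · intro v
        rw [Subgroup.mem_comap, Subgroup.mem_centralizer_singleton_iff]
        refine (u.c0_P1 w ?_).symm.eq
        rw [← L_const, L_eq (LCX_const _)]
        exact D.sys.Lm_m1 _ (fun _ => ⟨v, rfl⟩)
      · rw [Subgroup.mem_comap, Subgroup.mem_centralizer_singleton_iff]
        exact (u.ker_tr hw).symm.eq
    intro v
    have hv : v ∈ (Subgroup.centralizer {u.c0 w}).comap D.δ := by rw [this]; trivial
    rw [Subgroup.mem_comap, Subgroup.mem_centralizer_singleton_iff] at hv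
    exact Eq.symm hv
  have hs : ∀ α v, Commute (u.c0 w) (D.I (Pi.mulSingle α v)) := by
    intro α
    let N : Subgroup V := (Subgroup.centralizer {u.c0 w}).comap (D.I.comp (sgl α))
    have hN : ∀ v, v ∈ N ↔ Commute (u.c0 w) (D.I (Pi.mulSingle α v)) := by
      intro v
      rw [Subgroup.mem_comap, Subgroup.mem_centralizer_singleton_iff]
      exact eq_comm
    haveI : N.Normal := ⟨fun v hv g => by
      rw [hN] at hv ⊢
      rw [← D.δ_single]
      exact ((hδ g).mul_right hv).mul_right (hδ g).inv_right⟩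
    have : N = ⊤ := normal_top (w := [true]) (fun v => by
      rw [hN]
      exact u.c0_P1 w (D.sys.I1 α v))
    intro v
    rw [← hN, this]; trivial
  have : Subgroup.centralizer {u.c0 w} = ⊤ := by
    apply u.gen
    · intro F
      have : F ∈ (Subgroup.centralizer {u.c0 w}).comap D.I := by
        apply Subgroup.pi_mem_of_mulSingle_mem
        intro α
        rw [Subgroup.mem_comap, Subgroup.mem_centralizer_singleton_iff]
        exact (hs _ _).symm.eq
      exact this
    · intro γ
      rw [Subgroup.mem_centralizer_singleton_iff]
      have e := D.pw_move (μ := sw) (α := [true]) (β := [false]) (by simp) (by simp) sw_app' γ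
      rw [← D.pw_false, ← e]
      exact (((hδ _).mul_right (u.c0_P1 w (D.pw_P1 γ))).mul_right (hδ _).inv_right).symm.eq
  have hp : p ∈ Subgroup.centralizer {u.c0 w} := by rw [this]; trivial
  rw [Subgroup.mem_centralizer_singleton_iff] at hp
  exact Eq.symm hp

end Dat.Univ
end HE

namespace HE
open Classical

theorem halves {v : V} (h : ∀ b y, ∃ z, v.1 (ycons b y) = ycons b z) :
    ∃ u : Bool → V, ∀ b y, v.1 (ycons b y) = ycons b ((u b).1 y) := by
  have h' : ∀ b y, ∃ z, (v⁻¹).1 (ycons b y) = ycons b z := by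
    intro b y
    obtain ⟨b', z, hz⟩ := exists_ycons ((v⁻¹).1 (ycons b y))
    obtain ⟨z', hz'⟩ := h b' z
    rw [← hz, V_app_inv] at hz'
    obtain ⟨rfl, -⟩ := ycons_inj hz'
    exact ⟨z, hz⟩
  choose f hf using h
  choose f' hf' using h'
  obtain ⟨N, hN⟩ := V_depth2 v 1
  refine ⟨fun b => ⟨⟨f b, f' b, fun y => ?_, fun y => ?_⟩, N, fun α hα => ?_⟩, hf⟩
  · exact (ycons_inj ((hf' b (f b y)).symm.trans (by rw [← hf, V_inv_app]))).2
  · exact (ycons_inj ((hf b (f' b y)).symm.trans (by rw [← hf', V_app_inv]))).2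
  · obtain ⟨β, hβ, hh⟩ := hN (b :: α) (by simp; omega)
    obtain ⟨b', β, rfl⟩ := List.exists_cons_of_ne_nil (List.ne_nil_of_length_pos hβ)
    refine ⟨β, fun y => ?_⟩
    have h1 := hh y
    rw [app_cons, hf, app_cons] at h1
    exact (ycons_inj h1).2

noncomputable def hv (b : Bool) (v : V) : V :=
  if h : ∃ u : Bool → V, ∀ b y, v.1 (ycons b y) = ycons b ((u b).1 y) then h.choose b else 1

theorem hv_spec {v : V} (h : ∀ b y, ∃ z, v.1 (ycons b y) = ycons b z) (b : Bool) (y : Y) :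
    v.1 (ycons b y) = ycons b ((hv b v).1 y) := by
  rw [hv, dif_pos (halves h)]
  exact (halves h).choose_spec b y

theorem cor2_app (u u' : V) (b : Bool) (y : Y) :
    (cor [false] u * cor [true] u').1 (ycons b y) = ycons b ((if b then u' else u).1 y) := by
  rw [V_mul]
  cases b with
  | false =>
    have h1 : (cor [true] u').1 (ycons false y) = ycons false y := cor_fix inc_ft.symm _ y
    rw [h1]; exact cor_app [false] u y
  | true =>
    have h1 : (cor [true] u').1 (ycons true y) = ycons true (u'.1 y) := cor_app [true] u' y
    rw [h1]; exact cor_fix inc_ft u _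

theorem cor2_eq {v : V} (h : ∀ b y, ∃ z, v.1 (ycons b y) = ycons b z) :
    v = cor [false] (hv false v) * cor [true] (hv true v) := by
  apply V_ext
  intro y
  obtain ⟨b, y, rfl⟩ := exists_ycons y
  rw [cor2_app, hv_spec h]
  cases b <;> rfl

noncomputable def tau : V := tr [false, true] [true, false]

theorem inc_tau : Inc [false, true] [true, false] := inc_cons (by simp) _ _

theorem tau_app (e b : Bool) (y : Y) : tau.1 (ycons e (ycons b y)) = ycons b (ycons e y) := by
  cases e <;> cases b
  · exact tr_fix (γ := [false, false]) (inc_ft.prep [false]) (inc_cons (by simp) _ _) y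
  · exact tr_l inc_tau y
  · exact tr_r inc_tau y
  · exact tr_fix (γ := [true, true]) (inc_cons (by simp) _ _) (inc_ft.symm.prep [true]) y

theorem tau_inv_app (e b : Bool) (y : Y) : (tau⁻¹).1 (ycons e (ycons b y)) = ycons b (ycons e y) :=
  V_inv_eq (tau_app b e y)

/-- `β` belongs to the code of the shuffle `θ`. -/
def Cd (θ : V) (β : List Bool) : Prop := ∀ e z, θ.1 (ycons e (app β z)) = app β (ycons e z)

theorem exists_Cd (N : ℕ) : ∃ θ : V, ∀ β : List Bool, β.length = N → Cd θ β := by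
  induction N with
  | zero => exact ⟨1, fun β hβ e z => by rw [List.length_eq_zero_iff.1 hβ]; rfl⟩
  | succ N ih =>
    obtain ⟨θ, hθ⟩ := ih
    refine ⟨cor [false] θ * cor [true] θ * tau, fun β hβ e z => ?_⟩
    obtain ⟨b, β, rfl⟩ := List.exists_cons_of_ne_nil (List.ne_nil_of_length_pos (by omega : 0 < β.length))
    rw [V_mul, app_cons, tau_app, cor2_app, ite_self, hθ β (by simpa using hβ), app_cons]

namespace Dat.Univ
variable {G : Type} [Group G] {S : Star G} {P : Type} [Group P] {D : Dat S P} [Nonempty (Lt G)] (u : D.Univ)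

def Sh (θ : XX G → V) (K : ℕ) : Prop := ∀ x y, ∃ β z, y = app β z ∧ K ≤ β.length ∧ Cd (θ x) β

noncomputable def c1 : P →* P := (cj (D.δ sw)).comp u.c0
theorem c1_eq (w : P) : u.c1 w = D.δ sw * u.c0 w * (D.δ sw)⁻¹ := rfl

theorem c1_I (F : Fin S.k → V) : u.c1 (D.I F) = D.I (corF S.k [true] F) := by
  rw [c1_eq, c0_I, δ_eq, ← map_inv, ← map_mul, ← map_mul]
  congr 1
  funext i
  exact cor_conj sw_app _

theorem c1_φ (γ : Gam G) : u.c1 (D.φ γ) = D.pw [true, false] γ := by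
  rw [c1_eq, c0_φ]
  exact D.pw_move (by simp) (by simp) (fun y => sw_app (app [false] y)) γ

theorem c0_pw (w : P) (γ : Gam G) : Commute (u.c0 w) (D.pw [true, false] γ) := by
  induction w using u.induct with
  | h1 => rw [map_one]; exact Commute.one_left _
  | hI F w ih =>
    rw [map_mul]
    refine Commute.mul_left ?_ ih
    rw [c0_I]
    apply D.pw_off (by simp)
    intro i y
    exact cor_fix (inc_cons (by simp) _ _) _ _
  | hφ γ w ih =>
    rw [map_mul]
    refine Commute.mul_left ?_ ih
    rw [c0_φ]
    exact D.pw_comm (inc_cons (by simp) _ _) _ _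

theorem c0_c1 (w w' : P) : Commute (u.c0 w) (u.c1 w') := by
  induction w' using u.induct with
  | h1 => rw [map_one]; exact Commute.one_right _
  | hI F w' ih =>
    rw [map_mul]
    refine Commute.mul_right ?_ ih
    apply u.c0_P1
    rw [c1_I, ← L_I, L_eq (LCX_pI _)]
    exact D.sys.Lm_m1 _ (fun x => ⟨F (S.a x.hd), rfl⟩)
  | hφ γ w' ih =>
    rw [map_mul]
    refine Commute.mul_right ?_ ih
    rw [c1_φ]; exact u.c0_pw _ _

def Claim2 (w : P) : Prop := ∀ K, ∃ N, ∀ θ ∈ LCX S, Sh θ N → ∃ θ' ∈ LCX S, Sh θ' K ∧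
  D.L θ' * (u.c0 w * u.c1 w) = w * D.L θ ∧
  ∀ x β, N ≤ β.length → Cd (θ x) β → ∃ x' α, K ≤ α.length ∧ Cd (θ' x') α ∧ ∀ y, u.π w (x, app β y) = (x', app α y)

theorem claim2_mul {s w : P} (hs : u.Claim2 s) (hw : u.Claim2 w) : u.Claim2 (s * w) := by
  intro K
  obtain ⟨N1, h1⟩ := hs K
  obtain ⟨N, h⟩ := hw N1
  refine ⟨N, fun θ hθ hSh => ?_⟩
  obtain ⟨θ1, hθ1, hSh1, e1, t1⟩ := h θ hθ hSh
  obtain ⟨θ2, hθ2, hSh2, e2, t2⟩ := h1 θ1 hθ1 hSh1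
  refine ⟨θ2, hθ2, hSh2, ?_, ?_⟩
  · rw [map_mul, map_mul]
    have c := (u.c0_c1 w s).eq
    calc _ = D.L θ2 * (u.c0 s * (u.c0 w * u.c1 s) * u.c1 w) := by group
      _ = D.L θ2 * (u.c0 s * u.c1 s) * (u.c0 w * u.c1 w) := by rw [c]; group
      _ = _ := by rw [e2, mul_assoc, e1]; group
  · intro x β hβ hC
    obtain ⟨x', α, hα, hC', e⟩ := t1 x β hβ hC
    obtain ⟨x'', α', hα', hC'', e'⟩ := t2 x' α hα hC'
    refine ⟨x'', α', hα', hC'', fun y => ?_⟩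
    rw [map_mul, Equiv.Perm.mul_apply, e, e']

theorem claim2_one : u.Claim2 1 := by
  intro K
  refine ⟨K, fun θ hθ hSh => ⟨θ, hθ, hSh, by simp, fun x β hβ hC => ⟨x, β, hβ, hC, fun y => by rw [map_one]; rfl⟩⟩⟩

theorem claim2_I (F : Fin S.k → V) : u.Claim2 (D.I F) := by
  intro K
  obtain ⟨N, hN⟩ := finDepth F K
  refine ⟨N, fun θ hθ hSh => ?_⟩
  have g := LCX_pI F
  have g0 := LCX_pI (S := S) (corF S.k [false] F)
  have g1 := LCX_pI (S := S) (corF S.k [true] F)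
  have gg := mul_mem g0 g1
  have key : ∀ x β α, (∀ y, (pI S F x).1 (app β y) = app α y) → Cd (θ x) β →
      Cd ((pI S F * θ * (pI S (corF S.k [false] F) * pI S (corF S.k [true] F))⁻¹) x) α := by
    intro x β α hv hC e z
    show (pI S F x * θ x * (cor [false] (pI S F x) * cor [true] (pI S F x))⁻¹).1 _ = _
    have h1 : ((cor [false] (pI S F x) * cor [true] (pI S F x))⁻¹).1 (ycons e (app α z)) = ycons e (app β z) := by
      apply V_inv_eq
      rw [cor2_app, ite_self, hv]
    rw [V_mul, h1, V_mul, hC, hv]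
  refine ⟨_, mul_mem (mul_mem g hθ) (inv_mem gg), ?_, ?_, ?_⟩
  · intro x y
    obtain ⟨β, z, hy, hβ, hC⟩ := hSh x ((pI S F x)⁻¹.1 y)
    obtain ⟨α, hα, hv⟩ := hN (S.a x.hd) β hβ
    refine ⟨α, z, ?_, hα, key x β α hv hC⟩
    rw [← hv, ← hy]
    exact (V_app_inv _ _).symm
  · rw [c0_I, c1_I, L_mul (mul_mem g hθ) (inv_mem gg), L_inv gg, L_mul g hθ, L_mul g0 g1, L_I, L_I, L_I]
    group
  · intro x β hβ hC
    obtain ⟨α, hα, hv⟩ := hN (S.a x.hd) β hβ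
    refine ⟨x, α, hα, key x β α hv hC, fun y => ?_⟩
    rw [π_I, fib_apply]
    exact congrArg (Prod.mk x) (hv y)

theorem claim2_φ (γ : Gam G) : u.Claim2 (D.φ γ) := by
  intro K
  refine ⟨max K 1, fun θ hθ hSh => ?_⟩
  have hpres : ∀ x b y, ∃ z, (θ x * tau⁻¹).1 (ycons b y) = ycons b z := by
    intro x b y
    obtain ⟨e, y, rfl⟩ := exists_ycons y
    obtain ⟨β, z, hy, hβ, hC⟩ := hSh x (ycons b y)
    obtain ⟨b', β, rfl⟩ := List.exists_cons_of_ne_nil (List.ne_nil_of_length_pos ((le_max_right _ _).trans hβ))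
    have := hy
    rw [app_cons] at this
    obtain ⟨rfl, -⟩ := ycons_inj this
    rw [V_mul, tau_inv_app, hy, hC, app_cons]
    exact ⟨_, rfl⟩
  let f0 : XX G → V := fun x => cor [false] (hv false (θ x * tau⁻¹))
  let f1 : XX G → V := fun x => cor [true] (hv true (θ x * tau⁻¹))
  have h0 : f0 ∈ LCX S := LCX_comp (fun v => cor [false] (hv false (v * tau⁻¹))) hθ
  have h1 : f1 ∈ LCX S := LCX_comp (fun v => cor [true] (hv true (v * tau⁻¹))) hθ
  have ht := LCX_const (S := S) tau
  have h0' := actF_LCX S γ h0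
  have eθ : θ = f0 * f1 * (fun _ => tau) := by
    funext x
    have := cor2_eq (hpres x)
    show θ x = f0 x * f1 x * tau
    rw [← mul_inv_eq_iff_eq_mul]
    exact this
  let xb : Bool → XX G → XX G := fun b x => if b then x else act γ⁻¹ x
  have key : ∀ x b e z, ((actF γ f0 * f1 * (fun _ => tau) : XX G → V) x).1 (ycons e (ycons b z)) = (θ (xb b x)).1 (ycons e (ycons b z)) := by
    intro x b e z
    rw [eθ]
    show (f0 (act γ⁻¹ x) * f1 x * tau).1 _ = (f0 (xb b x) * f1 (xb b x) * tau).1 _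
    rw [V_mul, V_mul _ tau, tau_app, cor2_app, cor2_app]
    cases b <;> rfl
  have key2 : ∀ x b β, Cd (θ (xb b x)) (b :: β) → Cd ((actF γ f0 * f1 * (fun _ => tau) : XX G → V) x) (b :: β) := by
    intro x b β h e z
    rw [app_cons, key]
    exact h e z
  refine ⟨actF γ f0 * f1 * (fun _ => tau), mul_mem (mul_mem h0' h1) ht, ?_, ?_, ?_⟩
  · intro x y
    obtain ⟨b, y, rfl⟩ := exists_ycons y
    obtain ⟨β, z, hy, hβ, hC⟩ := hSh (xb b x) (ycons b y)
    obtain ⟨b', β, rfl⟩ := List.exists_cons_of_ne_nil (List.ne_nil_of_length_pos ((le_max_right _ _).trans hβ))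
    have := hy
    rw [app_cons] at this
    obtain ⟨rfl, -⟩ := ycons_inj this
    exact ⟨_, z, hy, (le_max_left _ _).trans hβ, key2 x _ _ hC⟩
  · have c : D.δ tau * (D.pw [false, false] γ * D.pw [true, false] γ) = D.φ γ * D.δ tau := by
      have e1 := D.pw_move (μ := tau) (α := [false, false]) (β := [false, false]) (by simp) (by simp) (fun y => tau_app _ _ y) γ
      have e2 := D.pw_move (μ := tau) (α := [true, false]) (β := [false, true]) (by simp) (by simp) (fun y => tau_app _ _ y) γ
      rw [D.r4', ← e2]
      nth_rw 2 [← e1]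
      group
    have k := L_off (D := D) h1 (α := [false]) (by simp) (fun x y => cor_fix inc_ft.symm _ y) γ
    rw [pw_false] at k
    have k' := k.eq
    conv_rhs => rw [eθ]
    rw [c0_φ, c1_φ, L_mul (mul_mem h0' h1) ht, L_mul h0' h1, L_mul (mul_mem h0 h1) ht, L_mul h0 h1, L_const,
      ← L_in h0 (fun x => ⟨_, rfl⟩) γ, mul_assoc, c]
    calc _ = D.φ γ * D.L f0 * (D.φ γ)⁻¹ * (D.L f1 * D.φ γ) * D.δ tau := by group
      _ = _ := by rw [k']; group
  · intro x β hβ hC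
    obtain ⟨b, β, rfl⟩ := List.exists_cons_of_ne_nil (List.ne_nil_of_length_pos ((le_max_right _ _).trans hβ))
    cases b with
    | false =>
      refine ⟨act γ x, false :: β, (le_max_left _ _).trans hβ, key2 (act γ x) false β ?_, fun y => ?_⟩
      · show Cd (θ (act γ⁻¹ (act γ x))) _
        rw [act_inv_act]; exact hC
      · rw [π_φ, cA_pos (show app (false :: β) y ∈ cone [false] from ⟨app β y, rfl⟩)]
    | true =>
      refine ⟨x, true :: β, (le_max_left _ _).trans hβ, key2 x true β hC, fun y => ?_⟩
      rw [π_φ, cA_neg]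
      exact cone_inc inc_ft.symm _ ⟨app β y, rfl⟩

theorem claim2 (w : P) : u.Claim2 w :=
  u.induct u.claim2_one (fun F _ h => u.claim2_mul (u.claim2_I F) h) (fun γ _ h => u.claim2_mul (u.claim2_φ γ) h) w

theorem c0_c0 (w : P) : u.c0 (u.c0 w) = D.δ k0 * u.c0 w * (D.δ k0)⁻¹ := by
  have : u.c0.comp u.c0 = (cj (D.δ k0)).comp u.c0 := by
    apply u.ext
    · intro F
      show u.c0 (u.c0 (D.I F)) = D.δ k0 * u.c0 (D.I F) * (D.δ k0)⁻¹
      rw [c0_I, c0_I, δ_eq, ← map_inv, ← map_mul, ← map_mul]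
      congr 1
      funext i
      show cor [false] (cor [false] (F i)) = k0 * cor [false] (F i) * k0⁻¹
      rw [cor_conj k0_app, cor_cor]; rfl
    · intro γ
      show u.c0 (u.c0 (D.φ γ)) = D.δ k0 * u.c0 (D.φ γ) * (D.δ k0)⁻¹
      rw [c0_φ, D.pw_move (β := [false, false, false]) (by simp) (by simp) (fun y => k0_app (app [false] y)), pw_eq, map_mul, map_mul, map_inv, c0_δ, c0_φ]
      exact D.c0_move (mv_app (by simp) (by simp)) γ
  exact DFunLike.congr_fun this w

theorem ker_trivial [Nontrivial (Lt G)] {w : P} (hw : u.π w = 1) : w = 1 := by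
  have hz := u.ker_central hw
  have hc1 : u.c1 w = u.c0 w := by rw [c1_eq, ← (hz _).eq]; group
  obtain ⟨N, hN⟩ := u.claim2 w 0
  obtain ⟨θ, hθ⟩ := exists_Cd N
  have hSh : Sh (fun _ : XX G => θ) N := by
    intro x y
    obtain ⟨α, z, hα, hy⟩ := app_split N y
    exact ⟨α, z, hy, hα.ge, hθ α hα⟩
  obtain ⟨θ', hθ', hSh', e, t⟩ := hN _ (LCX_const θ) hSh
  have : θ' = fun _ => θ := by
    funext x
    apply V_ext
    intro y
    obtain ⟨b, y, rfl⟩ := exists_ycons y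
    obtain ⟨α, z, hα, rfl⟩ := app_split N y
    obtain ⟨x', β, -, hC, hy⟩ := t x α hα.ge (hθ α hα)
    rw [hw] at hy
    have hx : x = x' := (Prod.ext_iff.1 (hy z)).1
    have hβ : α = β := eq_of_app_eq (fun y => (Prod.ext_iff.1 (hy y)).2)
    subst hx hβ
    rw [hC, hθ α hα]
  have hw2 : w = u.c0 w * u.c0 w := by
    rw [this, hc1, ← ((hz _).mul_left (hz _)).eq] at e
    exact (mul_right_cancel e).symm
  have h2 : u.c0 (u.c0 w) = u.c0 w := by
    rw [c0_c0, ← (hz _).eq]; group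
  have h3 : u.c0 w = u.c0 w * u.c0 w := by
    conv_lhs => rw [hw2]
    rw [map_mul, h2]
  have h4 : u.c0 w = 1 := by
    have := h3; rwa [left_eq_mul] at this
  rw [hw2, h4, one_mul]

theorem π_inj [Nontrivial (Lt G)] : Function.Injective u.π := by
  rw [injective_iff_map_eq_one]
  exact fun w hw => u.ker_trivial hw

end Dat.Univ
end HE

namespace HE
open Classical commutatorElement

theorem app_lt {α : List Bool} {i : ℕ} (h : i < α.length) (y y' : Y) : app α y i = app α y' i := by
  induction α generalizing i with
  | nil => simp at h
  | cons b α ih =>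
    cases i with
    | zero => rfl
    | succ i => exact ih (by simpa using h)

theorem app_sep {α β : List Bool} {z : Y} (h : app α z ≠ app β z) : ∃ ζ z', z = app ζ z' ∧
    ∀ y1 y2, app (α ++ ζ) y1 ≠ app (β ++ ζ) y2 := by
  obtain ⟨i, hi⟩ := Function.ne_iff.1 h
  obtain ⟨ζ, z', hζ, rfl⟩ := app_split (i+1) z
  refine ⟨ζ, z', rfl, fun y1 y2 he => hi ?_⟩
  rw [← app_append, ← app_append, app_lt (by simp; omega) z' y1, app_lt (α := β ++ ζ) (by simp; omega) z' y2, he]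

theorem perfect_mem {H : Subgroup V} (h : ∀ v w : V, ⁅v, w⁆ ∈ H) (v : V) : v ∈ H := by
  have : commutator V ≤ H := by
    rw [commutator_def, Subgroup.commutator_le]
    exact fun a _ b _ => h a b
  rw [V_perfect] at this
  exact this trivial

section
variable {G : Type} [Group G] {S : Star G}

theorem RR_sep (i : ℕ) : ∀ x x' : XX G, (x.hd ≠ x'.hd ∨ ∃ j < i, x.tl j ≠ x'.tl j) → ∃ n, ∀ m, n ≤ m → ¬ (RR S m) x x' := by
  induction i with
  | zero =>
    rintro x x' (h | ⟨j, hj, -⟩)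
    · obtain ⟨n, hn⟩ := S.sing_ex x'.hd
      exact ⟨n, fun m hm hR => h (S.sing_mono hm hn _ (RR_hd S hR))⟩
    · omega
  | succ i ih =>
    intro x x' h
    by_cases hh : x.hd = x'.hd
    · obtain ⟨j, hj, hne⟩ := h.resolve_left (not_not_intro hh)
      obtain ⟨n1, h1⟩ := S.sing_ex x.hd
      obtain ⟨n2, h2⟩ := ih (sh x) (sh x') (by
        cases j with
        | zero => left; exact fun e => hne (Subtype.ext e)
        | succ j => right; exact ⟨j, by omega, hne⟩)
      refine ⟨max n1 n2 + 1, fun m hm hR => ?_⟩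
      obtain ⟨m, rfl⟩ : ∃ k, m = k + 1 := ⟨m - 1, by omega⟩
      exact h2 m (by omega) ((RR_succ S).1 hR |>.2 (S.sing_mono (by omega) h1))
    · obtain ⟨n, hn⟩ := S.sing_ex x'.hd
      exact ⟨n, fun m hm hR => hh (S.sing_mono hm hn _ (RR_hd S hR))⟩

theorem RR_sep' {x x' : XX G} (h : x ≠ x') : ∃ n, ¬ (RR S n) x x' := by
  by_cases hh : x.hd = x'.hd
  · have : x.tl ≠ x'.tl := fun e => h (XX.ext' hh e)
    obtain ⟨i, hi⟩ := Function.ne_iff.1 this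
    obtain ⟨n, hn⟩ := RR_sep (S := S) (i+1) x x' (Or.inr ⟨i, by omega, hi⟩)
    exact ⟨n, hn n le_rfl⟩
  · obtain ⟨n, hn⟩ := RR_sep (S := S) 0 x x' (Or.inl hh)
    exact ⟨n, hn n le_rfl⟩

def cyl (h : G) (l : List (Lt G)) : Set (XX G) := {x | ∃ σ, x = ⟨h, slist l σ⟩}
def US : Set (XX G) := {x | x.hd = 1}

theorem ind_cyl (h : G) (l : List (Lt G)) (v : V) : ind (cyl h l) v = actF (uu h l) (ind US v) := by
  funext x
  obtain ⟨x, rfl⟩ : ∃ x', x = act (uu h l) x' := ⟨act (uu h l)⁻¹ x, by rw [act_act_inv]⟩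
  rw [actF_act]
  have : act (uu h l) x ∈ cyl h l ↔ x ∈ US := by
    constructor
    · rintro ⟨σ, hσ⟩
      rw [← act_uu] at hσ
      rw [(act (uu h l)).injective hσ]; rfl
    · intro hx
      refine ⟨x.tl, ?_⟩
      rw [← act_uu]
      congr 1
      exact XX.ext' hx rfl
  by_cases hx : x ∈ US
  · rw [ind_pos hx, ind_pos (this.2 hx)]
  · rw [ind_neg hx, ind_neg (fun h => hx (this.1 h))]

theorem ind_US_LCX [Nonempty (Lt G)] (v : V) : ind US v ∈ LCX S := by
  have : (ind US v : XX G → V) = hdF (ind {1} v) := by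
    funext x; rw [hdF_apply, ind_apply, ind_apply]; rfl
  rw [this]
  exact hdF_LCX S (Sys.ex_sing 1 v)

theorem actT_US (v : V) : actF gT (ind (US : Set (XX G)) v) = ind USᶜ v := by
  funext x
  rw [actF_apply, gT_inv, act_T]
  have : tf x ∈ (US : Set (XX G)) ↔ x ∈ (USᶜ : Set (XX G)) := by
    show (tf x).hd = 1 ↔ ¬ (x.hd = 1)
    by_cases hx : x.hd = 1
    · rw [tf_one hx]; simp [hx, sh_ne x]
    · rw [tf_ne hx]; simp [hx]
  by_cases hx : x ∈ (USᶜ : Set (XX G))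
  · rw [ind_pos hx, ind_pos (this.2 hx)]
  · rw [ind_neg hx, ind_neg (fun h => hx (this.1 h))]
end

namespace Dat.Univ
variable {G : Type} [Group G] {S : Star G} {P : Type} [Group P] {D : Dat S P} [Nontrivial (Lt G)] (u : D.Univ)

theorem exists_box {n : P} (hn : n ≠ 1) : ∃ (h : G) (l : List (Lt G)) (β : List Bool), ∀ x ∈ cyl h l, ∀ y,
    ¬ ((u.π n (x, app β y)).1 ∈ cyl h l ∧ Pre β (u.π n (x, app β y)).2) := by
  have hπ : u.π n ≠ 1 := fun h => hn (u.ker_trivial h)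
  obtain ⟨⟨x, y⟩, hxy⟩ : ∃ p, u.π n p ≠ p := by
    by_contra hc; push Not at hc
    exact hπ (Equiv.ext hc)
  obtain ⟨N, hN⟩ := u.claim1 n 0
  obtain ⟨β, z, hβ, rfl⟩ := app_split N y
  obtain ⟨m, hm⟩ := hN β hβ.ge
  obtain ⟨γ, α, -, hf, -⟩ := hm x
  rw [hf x ((RR S m).refl x)] at hxy
  by_cases hx : act γ x = x
  · have hz : app α z ≠ app β z := fun h => hxy (by rw [hx, h])
    obtain ⟨ζ, z', rfl, hs⟩ := app_sep hz
    obtain ⟨l, hl⟩ := RR_cyl (S := S) m x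
    refine ⟨x.hd, l, β ++ ζ, ?_⟩
    rintro _ ⟨σ, rfl⟩ y ⟨-, w, hw⟩
    rw [app_append, hf _ (hl σ), ← app_append] at hw
    exact hs _ _ hw
  · obtain ⟨n1, h1⟩ := RR_sep' (S := S) hx
    have hne : (sw : V) ≠ 1 := by
      intro h
      have := sw_app (fun _ => false)
      rw [h] at this
      have := congrFun this 0
      exact absurd this (by decide)
    let f : XX G → V := ind {x' | (RR S n1) x' x} sw
    have fL : f ∈ LCX S := ⟨n1, LS_ind (fun x y hxy hx => (RR S n1).trans ((RR S n1).symm hxy) hx) _⟩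
    obtain ⟨n2, h2⟩ := actF_LCX S γ⁻¹ fL
    obtain ⟨l, hl⟩ := RR_cyl (S := S) (max m (max n1 n2)) x
    refine ⟨x.hd, l, β, ?_⟩
    rintro _ ⟨σ, rfl⟩ y ⟨⟨σ', h'⟩, -⟩
    rw [hf _ (RR_le S (le_max_left _ _) (hl σ))] at h'
    have e := h2 _ _ (RR_le S ((le_max_right _ _).trans (le_max_right _ _)) (hl σ))
    rw [actF_apply, actF_apply, inv_inv] at e
    have e' : act γ ⟨x.hd, slist l σ⟩ = ⟨x.hd, slist l σ'⟩ := h'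
    rw [e'] at e
    have i1 : f ⟨x.hd, slist l σ'⟩ = sw := ind_pos (RR_le S ((le_max_left _ _).trans (le_max_right _ _)) (hl σ')) _
    have i2 : f (act γ x) = 1 := ind_neg h1 _
    exact hne (by rw [← i1, e, i2])

theorem box_mem {N : Subgroup P} [hN : N.Normal] {n : P} (hn : n ∈ N) {h : G} {l : List (Lt G)} {β : List Bool}
    (hb : ∀ x ∈ cyl h l, ∀ y, ¬ ((u.π n (x, app β y)).1 ∈ cyl h l ∧ Pre β (u.π n (x, app β y)).2)) (v : V) :
    D.L (ind (cyl h l) (cor β v)) ∈ N := by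
  have hL : ∀ v, ind (cyl h l) v ∈ LCX S := fun v => by rw [ind_cyl]; exact actF_LCX S _ (ind_US_LCX v)
  let T : V →* P :=
    { toFun := fun v => D.L (ind (cyl h l) (cor β v))
      map_one' := by rw [map_one, map_one, L_one]
      map_mul' := fun a b => by rw [map_mul, map_mul, L_mul (hL _) (hL _)] }
  have hT : ∀ v, u.π (T v) = fib (ind (cyl h l) (cor β v)) := fun v => u.π_L' (hL _)
  have fixT : ∀ v p, ¬ (p.1 ∈ cyl h l ∧ Pre β p.2) → u.π (T v) p = p := by
    rintro v ⟨x, y⟩ hp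
    rw [hT, fib_apply]
    by_cases hx : x ∈ cyl h l
    · rw [ind_pos hx, cor_o (fun hy => hp ⟨hx, hy⟩)]
    · rw [ind_neg hx]; rfl
  have preT : ∀ v p, (p.1 ∈ cyl h l ∧ Pre β p.2) → ((u.π (T v) p).1 ∈ cyl h l ∧ Pre β (u.π (T v) p).2) := by
    rintro v ⟨x, y⟩ ⟨hx, z, hz⟩
    rw [hT, fib_apply]
    refine ⟨hx, v.1 z, ?_⟩
    show (ind (cyl h l) (cor β v) x).1 y = _
    rw [ind_pos hx]
    have hz' : y = app β z := hz
    rw [hz', cor_app]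
  have hb' : ∀ p : XX G × Y, (p.1 ∈ cyl h l ∧ Pre β p.2) → ¬ ((u.π n p).1 ∈ cyl h l ∧ Pre β (u.π n p).2) := by
    rintro ⟨x, y⟩ ⟨hx, z, hz⟩
    have hz' : y = app β z := hz
    rw [hz']
    exact hb x hx z
  have comm : ∀ v w, Commute (n * T v * n⁻¹) (T w) := by
    intro v w
    apply u.π_inj
    apply Equiv.ext
    intro p
    rw [map_mul u.π (n * T v * n⁻¹) (T w), map_mul u.π (T w) (n * T v * n⁻¹)]
    show u.π (n * T v * n⁻¹) (u.π (T w) p) = u.π (T w) (u.π (n * T v * n⁻¹) p)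
    have ex : ∀ q, u.π (n * T v * n⁻¹) q = u.π n (u.π (T v) ((u.π n)⁻¹ q)) := by
      intro q; rw [map_mul, map_mul, map_inv]; rfl
    have hfix : ∀ q : XX G × Y, (q.1 ∈ cyl h l ∧ Pre β q.2) → u.π (n * T v * n⁻¹) q = q := by
      intro q hq
      rw [ex, fixT v]
      · exact (u.π n).apply_symm_apply q
      · intro hc
        apply hb' _ hc
        rwa [show u.π n ((u.π n)⁻¹ q) = q from (u.π n).apply_symm_apply q]
    by_cases hp : p.1 ∈ cyl h l ∧ Pre β p.2
    · rw [hfix _ (preT w p hp), hfix p hp]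
    · rw [fixT w p hp, fixT w]
      rw [ex]
      by_cases hq : ((u.π n)⁻¹ p).1 ∈ cyl h l ∧ Pre β ((u.π n)⁻¹ p).2
      · exact hb' _ (preT v _ hq)
      · rw [fixT v _ hq, show u.π n ((u.π n)⁻¹ p) = p from (u.π n).apply_symm_apply p]
        exact hp
  refine perfect_mem (H := N.comap T) ?_ v
  intro a b
  show T ⁅a, b⁆ ∈ N
  have c := (comm a⁻¹ b).eq
  have m1 : n * T a⁻¹ * n⁻¹ * (T a⁻¹)⁻¹ ∈ N := by
    have := N.mul_mem hn (hN.conj_mem _ (N.inv_mem hn) (T a⁻¹))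
    convert this using 1; group
  have m2 := N.mul_mem (hN.conj_mem _ m1 (T a⁻¹)⁻¹) (N.inv_mem (hN.conj_mem _ m1 (T b * (T a⁻¹)⁻¹)))
  have c1 := (comm a⁻¹ a⁻¹).eq
  have c2 := (comm a⁻¹ a).eq
  convert m2 using 1
  rw [map_commutatorElement, commutatorElement_def]
  set A := n * T a⁻¹ * n⁻¹
  rw [map_inv, inv_inv]
  rw [map_inv] at c1
  have k2 : T a * (A * T a) * (T a)⁻¹ = T a * A := by group
  rw [k2]
  have k3 : T b * T a * (A * T a) * (T b * T a)⁻¹ = T b * (T a * A) * (T b)⁻¹ := by group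
  rw [k3]
  have k4 : (T b * (T a * A) * (T b)⁻¹) = T b * T a * (T b)⁻¹ * A := by
    have c3 : A * (T b)⁻¹ = (T b)⁻¹ * A := (comm a⁻¹ b).inv_right.eq
    calc _ = T b * T a * (A * (T b)⁻¹) := by group
      _ = _ := by rw [c3]; group
  rw [k4]
  group

theorem normal_eq_top (u : D.Univ) {N : Subgroup P} [hN : N.Normal] {n : P} (hn : n ∈ N) (h1 : n ≠ 1) : N = ⊤ := by
  obtain ⟨h, l, β, hb⟩ := u.exists_box h1
  have hE := u.box_mem hn hb
  have hU : ∀ v, D.L (ind US (cor β v)) ∈ N := by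
    intro v
    have := hN.conj_mem _ (hE v) (D.U (uu h l)⁻¹)
    rw [L_act _ (by rw [ind_cyl]; exact actF_LCX S _ (ind_US_LCX _)), ind_cyl, ← actF_mul, inv_mul_cancel, actF_one] at this
    exact this
  have hδ0 : ∀ v, D.δ (cor β v) ∈ N := by
    intro v
    have h2 := hN.conj_mem _ (hU v) (D.U gT)
    rw [L_act _ (ind_US_LCX _), actT_US] at h2
    have hc : ind (USᶜ : Set (XX G)) (cor β v) ∈ LCX S := by rw [← actT_US]; exact actF_LCX S _ (ind_US_LCX _)
    have := N.mul_mem (hU v) h2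
    rw [← L_mul (ind_US_LCX _) hc, ind_compl, L_const] at this
    exact this
  have hδ : ∀ v, D.δ v ∈ N := by
    have : N.comap D.δ = ⊤ := normal_top (w := β) hδ0
    intro v
    have hv : v ∈ N.comap D.δ := by rw [this]; trivial
    exact hv
  have hs : ∀ i v, D.I (Pi.mulSingle i v) ∈ N := by
    intro i v
    refine perfect_mem (H := N.comap (D.I.comp (sgl i))) ?_ v
    intro a b
    show D.I (Pi.mulSingle i ⁅a, b⁆) ∈ N
    have e : (Pi.mulSingle i ⁅a, b⁆ : Fin S.k → V) = Pi.mulSingle i a * ((fun _ => b) * (Pi.mulSingle i a)⁻¹ * (fun _ => b)⁻¹) := by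
      funext j
      by_cases hj : j = i
      · subst hj
        simp [commutatorElement_def, mul_assoc]
      · simp [hj]
    have e2 : D.I (Pi.mulSingle i ⁅a, b⁆) = (D.I (Pi.mulSingle i a) * D.δ b * (D.I (Pi.mulSingle i a))⁻¹) * (D.δ b)⁻¹ := by
      rw [e, map_mul, map_mul, map_mul, map_inv, map_inv, δ_eq]; group
    rw [e2]
    exact N.mul_mem (hN.conj_mem _ (hδ b) _) (N.inv_mem (hδ b))
  apply u.gen
  · intro F
    have : F ∈ N.comap D.I := Subgroup.pi_mem_of_mulSingle_mem F (fun i => hs i (F i))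
    exact this
  · intro γ
    let q := QuotientGroup.mk' N
    have hq : ∀ α, q (D.pw α γ) = q (D.φ γ) := by
      intro α
      have : q (D.δ (mv [false] α)) = 1 := (QuotientGroup.eq_one_iff _).2 (hδ _)
      rw [pw_eq, map_mul, map_mul, map_inv, this]; simp
    have := congrArg q (D.r4' γ)
    rw [map_mul, hq, hq] at this
    have h2 : q (D.φ γ) = 1 := left_eq_mul.1 this
    exact (QuotientGroup.eq_one_iff _).1 h2

def emb : G →* P := D.φ.comp gG

theorem emb_inj (u : D.Univ) : Function.Injective (emb (D := D)) := by
  rw [injective_iff_map_eq_one]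
  intro g hg
  obtain ⟨a⟩ : Nonempty (Lt G) := inferInstance
  have h := congrArg u.π (show D.φ (gG g) = 1 from hg)
  rw [π_φ, map_one] at h
  have h2 := congrArg (fun e : Equiv.Perm (XX G × Y) => e (⟨1, fun _ => a⟩, app [false] (fun _ => false))) h
  rw [cA_pos (show app [false] (fun _ => false) ∈ cone [false] from ⟨_, rfl⟩), act_G] at h2
  have h3 := congrArg (fun p : XX G × Y => p.1.hd) h2
  simpa using h3

theorem simple (u : D.Univ) : IsSimpleGroup P := by
  obtain ⟨a, b, hab⟩ := exists_pair_ne (Lt G)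
  haveI : Nontrivial P := ⟨⟨emb (D := D) a.1, emb (D := D) b.1, fun h => hab (Subtype.ext (u.emb_inj h))⟩⟩
  refine ⟨fun N hN => ?_⟩
  by_cases h : N = ⊥
  · exact Or.inl h
  · right
    obtain ⟨n, hn⟩ := Subgroup.ne_bot_iff_exists_ne_one.1 h
    exact u.normal_eq_top n.2 (fun e => hn (Subtype.ext e))

end Dat.Univ
end HE

namespace HE
universe w

def HypLen.map {G : Type w} [Group G] (L : HypLen G) {H : Type} [Group H] (e : G ≃* H) : HypLen H where
  ℓ h := L.ℓ (e.symm h)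
  one := by rw [map_one, L.one]
  eq_one g h := by simpa using L.eq_one _ h
  inv g := by rw [map_inv, L.inv]
  mul_le g h := by rw [map_mul]; exact L.mul_le _ _
  fin n := by
    refine ((L.fin n).image e).subset ?_
    intro h hh
    exact ⟨e.symm h, hh, e.apply_symm_apply h⟩
  geod g k hk := by
    obtain ⟨h, h1, h2⟩ := L.geod _ k hk
    exact ⟨e h, by simpa using h1, by simpa using h2⟩
  N := L.N
  hyp x y z t := by
    have := L.hyp (e.symm x) (e.symm y) (e.symm z) (e.symm t)
    simpa only [map_mul, map_inv] using this

theorem fp_conv (Q : Type) [Group Q] (h : Group.IsFinitelyPresented Q) : IsFinitelyPresented Q := by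
  obtain ⟨n, f, hf, R, hR, hk⟩ := h.out
  refine ⟨n, hR.toFinset, ⟨?_⟩⟩
  have e := QuotientGroup.quotientKerEquivOfSurjective f hf
  refine e.symm.trans (QuotientGroup.quotientMulEquivOfEq ?_)
  rw [← hk, hR.coe_toFinset]

theorem main0 {G : Type} [Group G] [Nontrivial (Lt G)] (L : HypLen G) :
    ∃ (Q : Type) (_ : Group Q), IsFinitelyPresented Q ∧ IsSimpleGroup Q ∧
      ∃ φ : G →* Q, Function.Injective φ := by
  haveI := L.fp
  obtain ⟨S⟩ := L.exists_star
  obtain ⟨P, _, D, hfp, hom, gen⟩ := exists_univ S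
  have u : D.Univ := ⟨hom, gen⟩
  exact ⟨P, _, fp_conv P hfp, u.simple, Dat.Univ.emb (D := D), u.emb_inj⟩

theorem main1 {G : Type} [Group G] (L : HypLen G) :
    ∃ (Q : Type) (_ : Group Q), IsFinitelyPresented Q ∧ IsSimpleGroup Q ∧
      ∃ φ : G →* Q, Function.Injective φ := by
  by_cases hn : Nontrivial (Lt G)
  · exact main0 L
  · haveI : Subsingleton (Lt G) := not_nontrivial_iff_subsingleton.1 hn
    haveI : Finite (Lt G) := inferInstance
    haveI : Finite G := by
      have h : (Set.univ : Set G) ⊆ {1} ∪ {g | g ≠ 1} := fun g _ => by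
        by_cases h : g = 1
        · exact Or.inl h
        · exact Or.inr h
      have h2 : ({g : G | g ≠ 1}).Finite := Set.Subsingleton.finite (fun a ha b hb => congrArg Subtype.val (Subsingleton.elim (⟨a, ha⟩ : Lt G) ⟨b, hb⟩))
      exact Set.finite_univ_iff.1 (((Set.finite_singleton (1 : G)).union h2).subset h)
    let H := G × Multiplicative (ZMod 3)
    haveI : Finite H := inferInstanceAs (Finite (G × Multiplicative (ZMod 3)))
    have h1 : Multiplicative.ofAdd (1 : ZMod 3) ≠ 1 := by decide
    have h2 : Multiplicative.ofAdd (2 : ZMod 3) ≠ 1 := by decide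
    have h3 : Multiplicative.ofAdd (1 : ZMod 3) ≠ Multiplicative.ofAdd (2 : ZMod 3) := by decide
    haveI : Nontrivial (Lt H) := ⟨⟨⟨(1, Multiplicative.ofAdd (1 : ZMod 3)), fun h => h1 (congrArg Prod.snd h)⟩,
      ⟨(1, Multiplicative.ofAdd (2 : ZMod 3)), fun h => h2 (congrArg Prod.snd h)⟩,
      fun h => h3 (congrArg (fun p => p.1.2) h)⟩⟩
    obtain ⟨Q, gQ, a, b, φ, hφ⟩ := main0 (HypLen.ofFinite H)
    exact ⟨Q, gQ, a, b, φ.comp (MonoidHom.inl G (Multiplicative (ZMod 3))), hφ.comp (fun x y h => congrArg Prod.fst h)⟩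

end HE

theorem hyperbolic_embeds_in_finitely_presented_simple (G : Type*) [Group G]
    (hG : IsHyperbolic G) :
    ∃ (Q : Type) (_ : Group Q), IsFinitelyPresented Q ∧ IsSimpleGroup Q ∧
      ∃ φ : G →* Q, Function.Injective φ := by
  obtain ⟨L⟩ := HE.hypLen_of_isHyperbolic hG
  obtain ⟨n, f, hf, -⟩ := L.fp.out
  let e := (QuotientGroup.quotientKerEquivOfSurjective f hf).symm
  obtain ⟨Q, gQ, a, b, φ, hφ⟩ := HE.main1 (L.map e)
  exact ⟨Q, gQ, a, b, φ.comp e.toMonoidHom, hφ.comp e.injective⟩
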